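/- Let m ≥ 1 and let π be an irreducible permutation of {1,...,m}. Then for Lebesgue-almost every λ in the positive orthant ℝ_+^m, the following holds for every ν ∈ ℝ^m: if there exists an orbit S ∈ Σ(π) with b_S · ν ∉ ℤ, then the functional equation f(T_{(λ,π)} x) = φ_{(λ,ν)}(x) f(x) (for Lebesgue-almost every x ∈ [0,|λ|)) admits no measurable solution f : [0,|λ|) → ℂ that is nonzero on a set of positive Lebesgue measure. -/

import Mathlib

open MeasureTheory Set

noncomputable section

open scoped Classical

/-- Left endpoint of the `j`-th subinterval: `∑_{i<j} λ_i`. -/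
def pre {m : ℕ} (lam : Fin m → ℝ) (j : Fin m) : ℝ :=
  ∑ i ∈ Finset.univ.filter (fun i => i < j), lam i

/-- The `j`-th subinterval `I_j^λ = [∑_{i<j} λ_i, ∑_{i≤j} λ_i)`. -/
def block {m : ℕ} (lam : Fin m → ℝ) (j : Fin m) : Set ℝ :=
  Set.Ico (pre lam j) (pre lam j + lam j)

/-- The translation vector `w_j = ∑_{i : π(i) < π(j)} λ_i − ∑_{i<j} λ_i`. -/
def wvec {m : ℕ} (lam : Fin m → ℝ) (π : Equiv.Perm (Fin m)) (j : Fin m) : ℝ :=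
  (∑ i ∈ Finset.univ.filter (fun i => π i < π j), lam i) - pre lam j

/-- The interval exchange transformation `T_{(λ,π)}`: on `I_j^λ` it is `x ↦ x + w_j`
(the subintervals `I_j^λ` are pairwise disjoint, so at most one summand is nonzero). -/
def iet {m : ℕ} (lam : Fin m → ℝ) (π : Equiv.Perm (Fin m)) (x : ℝ) : ℝ :=
  x + ∑ j : Fin m, if x ∈ block lam j then wvec lam π j else 0

/-- The multiplier `φ_{(λ,ν)}(x) = exp(2πi ν_j)` for `x ∈ I_j^λ`. -/
def phiFn {m : ℕ} (lam : Fin m → ℝ) (nu : Fin m → ℝ) (x : ℝ) : ℂ :=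
  ∏ j : Fin m,
    if x ∈ block lam j then Complex.exp (2 * Real.pi * Complex.I * (nu j : ℂ)) else 1

/-- `π` is irreducible: `π({1,…,k}) = {1,…,k}` (for `1 ≤ k ≤ m`) only for `k = m`. -/
def PermIrreducible {m : ℕ} (π : Equiv.Perm (Fin m)) : Prop :=
  ∀ k : ℕ, 1 ≤ k → k ≤ m →
    (Finset.univ.filter (fun i : Fin m => (i : ℕ) < k)).image π =
      Finset.univ.filter (fun i : Fin m => (i : ℕ) < k) →
    k = m

/-- `π` extended to `{0,1,…,m+1}` (as a map of `ℕ`) by `π(0) = 0`, `π(m+1) = m+1`. -/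
def piExt {m : ℕ} (π : Equiv.Perm (Fin m)) (i : ℕ) : ℕ :=
  if h : 1 ≤ i ∧ i ≤ m then (π ⟨i - 1, by omega⟩ : ℕ) + 1 else i

/-- The corresponding extension of `π⁻¹`. -/
def piExtInv {m : ℕ} (π : Equiv.Perm (Fin m)) (i : ℕ) : ℕ :=
  if h : 1 ≤ i ∧ i ≤ m then (π.symm ⟨i - 1, by omega⟩ : ℕ) + 1 else i

/-- The map `σ_π(i) = π⁻¹(π(i)+1) − 1`, for `0 ≤ i ≤ m`. -/
def sigmaPi {m : ℕ} (π : Equiv.Perm (Fin m)) (i : ℕ) : ℕ :=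
  piExtInv π (piExt π i + 1) - 1

/-- The orbit of `i ∈ {0,…,m}` under iteration of `σ_π`. -/
def orbitOf {m : ℕ} (π : Equiv.Perm (Fin m)) (i : ℕ) : Finset ℕ :=
  (Finset.Iic m).filter (fun j => ∃ n : ℕ, (sigmaPi π)^[n] i = j)

/-- `Σ(π)`: the set of orbits of `σ_π` on `{0,1,…,m}`. -/
def orbitsOf {m : ℕ} (π : Equiv.Perm (Fin m)) : Finset (Finset ℕ) :=
  (Finset.Iic m).image (orbitOf π)

/-- The vector `b_S ∈ ℤ^m`, `(b_S)_i = χ_S(i−1) − χ_S(i)` for `1 ≤ i ≤ m`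
(the index `i : Fin m` encodes the 1-based index `i+1`). -/
def bvec {m : ℕ} (S : Finset ℕ) (i : Fin m) : ℤ :=
  (if (i : ℕ) ∈ S then 1 else 0) - (if (i : ℕ) + 1 ∈ S then 1 else 0)

/-! ### The interval exchange as a dynamical system -/

/-- Cumulative sums `∑_{i < k} λ_i`. -/
def cum {m : ℕ} (lam : Fin m → ℝ) (k : ℕ) : ℝ := ∑ i : Fin m, if (i : ℕ) < k then lam i else 0

theorem pre_eq_cum {m : ℕ} (lam : Fin m → ℝ) (j : Fin m) : pre lam j = cum lam j := by
  unfold pre cum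
  rw [Finset.sum_filter]
  rfl

theorem cum_zero {m : ℕ} (lam : Fin m → ℝ) : cum lam 0 = 0 := by simp [cum]

theorem cum_top {m : ℕ} (lam : Fin m → ℝ) : cum lam m = ∑ i, lam i := by simp [cum]

theorem cum_succ {m : ℕ} (lam : Fin m → ℝ) (j : Fin m) :
    cum lam ((j : ℕ) + 1) = cum lam j + lam j := by
  unfold cum
  have : ∀ i : Fin m, (if (i : ℕ) < (j : ℕ) + 1 then lam i else 0) =
      (if (i : ℕ) < j then lam i else 0) + (if i = j then lam i else 0) := by
    intro i
    rcases lt_trichotomy (i : ℕ) j with h | h | h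
    · have : i ≠ j := fun e => by simp [e] at h
      simp [h, this, Nat.lt_succ_of_lt h]
    · have : i = j := Fin.ext h
      simp [this]
    · have h1 : i ≠ j := fun e => by simp [e] at h
      have h2 : ¬ (i : ℕ) < j := by omega
      have h3 : ¬ (i : ℕ) < j + 1 := by omega
      simp [h1, h2, h3]
  simp_rw [this, Finset.sum_add_distrib]
  simp

theorem cum_mono {m : ℕ} {lam : Fin m → ℝ} (hpos : ∀ j, 0 ≤ lam j) : Monotone (cum lam) := by
  intro a b hab
  unfold cum
  apply Finset.sum_le_sum
  intro i _
  split_ifs with h1 h2 h2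
  · exact le_rfl
  · omega
  · exact hpos i
  · exact le_rfl

theorem mem_block_iff {m : ℕ} {lam : Fin m → ℝ} {j : Fin m} {x : ℝ} :
    x ∈ block lam j ↔ cum lam j ≤ x ∧ x < cum lam (j + 1) := by
  rw [block, mem_Ico, pre_eq_cum, cum_succ]

theorem exists_mem_block {m : ℕ} {lam : Fin m → ℝ} {x : ℝ}
    (hx : x ∈ Ico (0 : ℝ) (∑ i, lam i)) : ∃ j, x ∈ block lam j := by
  have key : ∀ k ≤ m, x < cum lam k → ∃ j, x ∈ block lam j := by
    intro k
    induction k with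
    | zero =>
      intro _ h
      rw [cum_zero] at h
      exact absurd hx.1 (not_le.2 h)
    | succ k ih =>
      intro hk h
      by_cases h' : x < cum lam k
      · exact ih (by omega) h'
      · exact ⟨⟨k, by omega⟩, mem_block_iff.2 ⟨not_lt.1 h', h⟩⟩
  exact key m le_rfl (by rw [cum_top]; exact hx.2)

theorem block_unique {m : ℕ} {lam : Fin m → ℝ} (hpos : ∀ j, 0 ≤ lam j) {x : ℝ} {i j : Fin m}
    (hi : x ∈ block lam i) (hj : x ∈ block lam j) : i = j := by
  rw [mem_block_iff] at hi hj
  rcases lt_trichotomy (i : ℕ) j with h | h | h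
  · have := cum_mono hpos (show (i : ℕ) + 1 ≤ j by omega)
    linarith
  · exact Fin.ext h
  · have := cum_mono hpos (show (j : ℕ) + 1 ≤ i by omega)
    linarith

theorem block_subset {m : ℕ} {lam : Fin m → ℝ} (hpos : ∀ j, 0 ≤ lam j) (j : Fin m) :
    block lam j ⊆ Ico (0 : ℝ) (∑ i, lam i) := by
  intro x hx
  rw [mem_block_iff] at hx
  have h1 := cum_mono hpos (Nat.zero_le (j : ℕ))
  have h2 := cum_mono hpos (show (j : ℕ) + 1 ≤ m by omega)
  rw [cum_zero] at h1
  rw [cum_top] at h2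
  exact ⟨h1.trans hx.1, hx.2.trans_le h2⟩

/-- The letter of the block containing `x` (a default letter if there is none). -/
def letter {m : ℕ} [NeZero m] (lam : Fin m → ℝ) (x : ℝ) : Fin m :=
  if h : ∃ j, x ∈ block lam j then h.choose else 0

theorem letter_spec {m : ℕ} [NeZero m] {lam : Fin m → ℝ} {x : ℝ}
    (hx : x ∈ Ico (0 : ℝ) (∑ i, lam i)) : x ∈ block lam (letter lam x) := by
  have h := exists_mem_block hx
  rw [letter, dif_pos h]
  exact h.choose_spec

theorem letter_eq {m : ℕ} [NeZero m] {lam : Fin m → ℝ} (hpos : ∀ j, 0 ≤ lam j) {x : ℝ} {j : Fin m}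
    (hx : x ∈ block lam j) : letter lam x = j :=
  block_unique hpos (letter_spec (block_subset hpos j hx)) hx

theorem iet_of_mem {m : ℕ} {lam : Fin m → ℝ} (hpos : ∀ j, 0 ≤ lam j) (π : Equiv.Perm (Fin m))
    {x : ℝ} {j : Fin m} (hx : x ∈ block lam j) : iet lam π x = x + wvec lam π j := by
  unfold iet
  congr 1
  rw [Finset.sum_eq_single j]
  · rw [if_pos hx]
  · intro i _ hij
    rw [if_neg]
    intro hi
    exact hij (block_unique hpos hi hx)
  · simp

theorem phiFn_of_mem {m : ℕ} {lam : Fin m → ℝ} (hpos : ∀ j, 0 ≤ lam j) (nu : Fin m → ℝ)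
    {x : ℝ} {j : Fin m} (hx : x ∈ block lam j) :
    phiFn lam nu x = Complex.exp (2 * Real.pi * Complex.I * (nu j : ℂ)) := by
  unfold phiFn
  rw [Finset.prod_eq_single j]
  · rw [if_pos hx]
  · intro i _ hij
    rw [if_neg]
    intro hi
    exact hij (block_unique hpos hi hx)
  · simp

theorem iet_of_notMem {m : ℕ} {lam : Fin m → ℝ} (hpos : ∀ j, 0 ≤ lam j) (π : Equiv.Perm (Fin m))
    {x : ℝ} (hx : x ∉ Ico (0 : ℝ) (∑ i, lam i)) : iet lam π x = x := by
  unfold iet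
  rw [Finset.sum_eq_zero, add_zero]
  intro i _
  rw [if_neg]
  intro hi
  exact hx (block_subset hpos i hi)

/-- Left endpoint of the image of the `j`-th block. -/
theorem pre_add_wvec {m : ℕ} (lam : Fin m → ℝ) (π : Equiv.Perm (Fin m)) (j : Fin m) :
    pre lam j + wvec lam π j = pre (lam ∘ π.symm) (π j) := by
  unfold wvec
  rw [add_sub_cancel]
  conv_rhs => rw [pre, Finset.sum_filter, ← Equiv.sum_comp π]
  rw [Finset.sum_filter]
  simp

theorem add_wvec_mem_block {m : ℕ} {lam : Fin m → ℝ} {π : Equiv.Perm (Fin m)} {j : Fin m} {x : ℝ} :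
    x + wvec lam π j ∈ block (lam ∘ π.symm) (π j) ↔ x ∈ block lam j := by
  unfold block
  rw [← pre_add_wvec]
  simp only [mem_Ico, Function.comp_apply, Equiv.symm_apply_apply]
  constructor <;> rintro ⟨h1, h2⟩ <;> constructor <;> linarith

theorem sum_comp_symm {m : ℕ} (lam : Fin m → ℝ) (π : Equiv.Perm (Fin m)) :
    ∑ i, (lam ∘ π.symm) i = ∑ i, lam i := Equiv.sum_comp π.symm lam

theorem iet_mem {m : ℕ} {lam : Fin m → ℝ} (hpos : ∀ j, 0 ≤ lam j) (π : Equiv.Perm (Fin m))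
    {x : ℝ} (hx : x ∈ Ico (0 : ℝ) (∑ i, lam i)) : iet lam π x ∈ Ico (0 : ℝ) (∑ i, lam i) := by
  obtain ⟨j, hj⟩ := exists_mem_block hx
  rw [iet_of_mem hpos π hj, ← sum_comp_symm lam π]
  exact block_subset (fun i => hpos _) (π j) (add_wvec_mem_block.2 hj)

theorem iet_injective {m : ℕ} {lam : Fin m → ℝ} (hpos : ∀ j, 0 ≤ lam j) (π : Equiv.Perm (Fin m)) :
    Function.Injective (iet lam π) := by
  intro x y hxy
  by_cases hx : x ∈ Ico (0 : ℝ) (∑ i, lam i) <;> by_cases hy : y ∈ Ico (0 : ℝ) (∑ i, lam i)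
  · obtain ⟨i, hi⟩ := exists_mem_block hx
    obtain ⟨j, hj⟩ := exists_mem_block hy
    rw [iet_of_mem hpos π hi, iet_of_mem hpos π hj] at hxy
    have h1 := (add_wvec_mem_block (π := π)).2 hi
    have h2 := (add_wvec_mem_block (π := π)).2 hj
    rw [hxy] at h1
    have : i = j := π.injective (block_unique (fun i => hpos _) h1 h2)
    subst this
    linarith
  · have := iet_mem hpos π hx
    rw [hxy, iet_of_notMem hpos π hy] at this
    exact absurd this hy
  · have := iet_mem hpos π hy
    rw [← hxy, iet_of_notMem hpos π hx] at this
    exact absurd this hx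
  · rwa [iet_of_notMem hpos π hx, iet_of_notMem hpos π hy] at hxy

theorem iet_surjOn {m : ℕ} {lam : Fin m → ℝ} (hpos : ∀ j, 0 ≤ lam j) (π : Equiv.Perm (Fin m))
    {y : ℝ} (hy : y ∈ Ico (0 : ℝ) (∑ i, lam i)) :
    ∃ x ∈ Ico (0 : ℝ) (∑ i, lam i), iet lam π x = y := by
  rw [← sum_comp_symm lam π] at hy
  obtain ⟨j, hj⟩ := exists_mem_block hy
  obtain ⟨i, rfl⟩ := π.surjective j
  have h : (y - wvec lam π i) ∈ block lam i := by
    rw [← add_wvec_mem_block (π := π), sub_add_cancel]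
    exact hj
  exact ⟨_, block_subset hpos i h, by rw [iet_of_mem hpos π h]; ring⟩

theorem measurableSet_block {m : ℕ} (lam : Fin m → ℝ) (j : Fin m) : MeasurableSet (block lam j) :=
  measurableSet_Ico

theorem measurable_iet {m : ℕ} (lam : Fin m → ℝ) (π : Equiv.Perm (Fin m)) :
    Measurable (iet lam π) := by
  unfold iet
  refine measurable_id.add (Finset.measurable_sum _ fun j _ => ?_)
  exact Measurable.ite (measurableSet_block lam j) measurable_const measurable_const

theorem iUnion_block {m : ℕ} {lam : Fin m → ℝ} (hpos : ∀ j, 0 ≤ lam j) :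
    ⋃ j, block lam j = Ico (0 : ℝ) (∑ i, lam i) := by
  ext x
  rw [mem_iUnion]
  exact ⟨fun ⟨j, hj⟩ => block_subset hpos j hj, exists_mem_block⟩

theorem volume_inter_Ico_eq_sum {m : ℕ} {lam : Fin m → ℝ} (hpos : ∀ j, 0 ≤ lam j) {s : Set ℝ}
    (hs : MeasurableSet s) :
    volume (s ∩ Ico (0 : ℝ) (∑ i, lam i)) = ∑ j, volume (s ∩ block lam j) := by
  rw [← iUnion_block hpos, inter_iUnion, measure_iUnion, tsum_fintype]
  · intro i j hij
    rw [Function.onFun, Set.disjoint_left]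
    rintro x ⟨_, hi⟩ ⟨_, hj⟩
    exact hij (block_unique hpos hi hj)
  · exact fun j => hs.inter (measurableSet_block lam j)

theorem measurePreserving_iet {m : ℕ} {lam : Fin m → ℝ} (hpos : ∀ j, 0 ≤ lam j)
    (π : Equiv.Perm (Fin m)) :
    MeasurePreserving (iet lam π) (volume.restrict (Ico (0 : ℝ) (∑ i, lam i)))
      (volume.restrict (Ico (0 : ℝ) (∑ i, lam i))) := by
  refine ⟨measurable_iet lam π, ?_⟩
  ext s hs
  rw [Measure.map_apply (measurable_iet lam π) hs, Measure.restrict_apply hs,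
    Measure.restrict_apply (measurable_iet lam π hs),
    volume_inter_Ico_eq_sum hpos (measurable_iet lam π hs), ← sum_comp_symm lam π,
    volume_inter_Ico_eq_sum (lam := lam ∘ π.symm) (fun i => hpos _) hs,
    ← Equiv.sum_comp π (fun j => volume (s ∩ block (lam ∘ π.symm) j))]
  refine Finset.sum_congr rfl fun j _ => ?_
  have : iet lam π ⁻¹' s ∩ block lam j =
      (fun x => x + wvec lam π j) ⁻¹' (s ∩ block (lam ∘ π.symm) (π j)) := by
    ext x
    simp only [mem_inter_iff, mem_preimage, add_wvec_mem_block]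
    constructor
    · rintro ⟨h1, h2⟩
      rw [iet_of_mem hpos π h2] at h1
      exact ⟨h1, h2⟩
    · rintro ⟨h1, h2⟩
      rw [iet_of_mem hpos π h2]
      exact ⟨h1, h2⟩
  rw [this, measure_preimage_add_right]

/-- The itinerary of a point. -/
def itin {m : ℕ} [NeZero m] (lam : Fin m → ℝ) (π : Equiv.Perm (Fin m)) (x : ℝ) (k : ℕ) : Fin m :=
  letter lam ((iet lam π)^[k] x)

/-- The total displacement along the first `k` letters of `a`. -/
def disp {m : ℕ} (lam : Fin m → ℝ) (π : Equiv.Perm (Fin m)) (a : ℕ → Fin m) (k : ℕ) : ℝ :=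
  ∑ j ∈ Finset.range k, wvec lam π (a j)

theorem disp_succ {m : ℕ} (lam : Fin m → ℝ) (π : Equiv.Perm (Fin m)) (a : ℕ → Fin m) (k : ℕ) :
    disp lam π a (k + 1) = disp lam π a k + wvec lam π (a k) := Finset.sum_range_succ _ _

theorem disp_congr {m : ℕ} (lam : Fin m → ℝ) (π : Equiv.Perm (Fin m)) {a b : ℕ → Fin m} {k : ℕ}
    (h : ∀ j < k, a j = b j) : disp lam π a k = disp lam π b k :=
  Finset.sum_congr rfl fun j hj => by rw [h j (Finset.mem_range.1 hj)]

theorem iterate_mem {m : ℕ} {lam : Fin m → ℝ} (hpos : ∀ j, 0 ≤ lam j) (π : Equiv.Perm (Fin m))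
    {x : ℝ} (hx : x ∈ Ico (0 : ℝ) (∑ i, lam i)) (k : ℕ) :
    (iet lam π)^[k] x ∈ Ico (0 : ℝ) (∑ i, lam i) := by
  induction k with
  | zero => exact hx
  | succ k ih =>
    rw [Function.iterate_succ_apply']
    exact iet_mem hpos π ih

theorem iterate_mem_block {m : ℕ} [NeZero m] {lam : Fin m → ℝ} (hpos : ∀ j, 0 ≤ lam j)
    (π : Equiv.Perm (Fin m)) {x : ℝ} (hx : x ∈ Ico (0 : ℝ) (∑ i, lam i)) (k : ℕ) :
    (iet lam π)^[k] x ∈ block lam (itin lam π x k) := letter_spec (iterate_mem hpos π hx k)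

theorem iterate_eq {m : ℕ} [NeZero m] {lam : Fin m → ℝ} (hpos : ∀ j, 0 ≤ lam j)
    (π : Equiv.Perm (Fin m)) {x : ℝ} (hx : x ∈ Ico (0 : ℝ) (∑ i, lam i)) (k : ℕ) :
    (iet lam π)^[k] x = x + disp lam π (itin lam π x) k := by
  induction k with
  | zero => simp [disp]
  | succ k ih =>
    rw [Function.iterate_succ_apply', iet_of_mem hpos π (iterate_mem_block hpos π hx k), disp_succ,
      ih]
    ring

theorem itin_iet {m : ℕ} [NeZero m] (lam : Fin m → ℝ) (π : Equiv.Perm (Fin m)) (x : ℝ) (k : ℕ) :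
    itin lam π (iet lam π x) k = itin lam π x (k + 1) := by
  rw [itin, itin, Function.iterate_succ_apply]

theorem itin_iterate {m : ℕ} [NeZero m] (lam : Fin m → ℝ) (π : Equiv.Perm (Fin m)) (x : ℝ)
    (j k : ℕ) : itin lam π ((iet lam π)^[j] x) k = itin lam π x (k + j) := by
  rw [itin, itin, Function.iterate_add_apply]

/-- If a point moves along the blocks prescribed by `a`, then its itinerary is `a`. -/
theorem itin_eq_of_forall_mem {m : ℕ} [NeZero m] {lam : Fin m → ℝ} (hpos : ∀ j, 0 ≤ lam j)
    (π : Equiv.Perm (Fin m)) {x : ℝ} {a : ℕ → Fin m} {n : ℕ}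
    (h : ∀ k < n, x + disp lam π a k ∈ block lam (a k)) :
    ∀ k < n, itin lam π x k = a k ∧ (iet lam π)^[k] x = x + disp lam π a k := by
  intro k
  induction k with
  | zero =>
    intro hk
    have := h 0 hk
    simp only [disp, Finset.range_zero, Finset.sum_empty, add_zero] at this ⊢
    exact ⟨letter_eq hpos this, rfl⟩
  | succ k ih =>
    intro hk
    obtain ⟨h1, h2⟩ := ih (by omega)
    have h3 : (iet lam π)^[k + 1] x = x + disp lam π a (k + 1) := by
      rw [Function.iterate_succ_apply', h2, iet_of_mem hpos π (h k (by omega)), disp_succ]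
      ring
    refine ⟨?_, h3⟩
    rw [itin, h3]
    exact letter_eq hpos (h (k + 1) hk)

/-- Between two points with the same first `n` letters, everything is carried rigidly. -/
theorem itin_eq_of_between {m : ℕ} [NeZero m] {lam : Fin m → ℝ} (hpos : ∀ j, 0 ≤ lam j)
    (π : Equiv.Perm (Fin m)) {x y z : ℝ} {n : ℕ} (hx : x ∈ Ico (0 : ℝ) (∑ i, lam i))
    (hy : y ∈ Ico (0 : ℝ) (∑ i, lam i)) (hxy : ∀ k < n, itin lam π x k = itin lam π y k)
    (h1 : x ≤ z) (h2 : z ≤ y) : ∀ k < n, itin lam π z k = itin lam π x k := by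
  intro k hk
  refine (itin_eq_of_forall_mem hpos π (a := itin lam π x) (n := n) ?_ k hk).1
  intro k hk
  have hx' := iterate_mem_block hpos π hx k
  have hy' := iterate_mem_block hpos π hy k
  rw [iterate_eq hpos π hx, mem_block_iff] at hx'
  rw [iterate_eq hpos π hy, ← hxy k hk, mem_block_iff,
    disp_congr lam π (fun j hj => (hxy j (hj.trans hk)).symm)] at hy'
  rw [mem_block_iff]
  exact ⟨by linarith [hx'.1], by linarith [hy'.2]⟩

theorem iterate_sub_of_itin_eq {m : ℕ} [NeZero m] {lam : Fin m → ℝ} (hpos : ∀ j, 0 ≤ lam j)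
    (π : Equiv.Perm (Fin m)) {x y : ℝ} {n : ℕ} (hx : x ∈ Ico (0 : ℝ) (∑ i, lam i))
    (hy : y ∈ Ico (0 : ℝ) (∑ i, lam i)) (hxy : ∀ k < n, itin lam π x k = itin lam π y k) :
    (iet lam π)^[n] y - (iet lam π)^[n] x = y - x := by
  rw [iterate_eq hpos π hx, iterate_eq hpos π hy, disp_congr lam π hxy]
  ring

/-! ### Generic length vectors -/

theorem sum_val_le_sum_perm {m : ℕ} (π : Equiv.Perm (Fin m)) (k : ℕ) :
    ∑ b : Fin m, (if (b : ℕ) < k then (b : ℤ) else 0) ≤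
      ∑ b : Fin m, (if (b : ℕ) < k then (π b : ℤ) else 0) ∧
    ((Finset.univ.filter (fun i : Fin m => (i : ℕ) < k)).image π ≠
      Finset.univ.filter (fun i : Fin m => (i : ℕ) < k) →
    ∑ b : Fin m, (if (b : ℕ) < k then (b : ℤ) else 0) <
      ∑ b : Fin m, (if (b : ℕ) < k then (π b : ℤ) else 0)) := by
  set A : Finset (Fin m) := Finset.univ.filter (fun i : Fin m => (i : ℕ) < k) with hA
  have e1 : ∑ b : Fin m, (if (b : ℕ) < k then (b : ℤ) else 0) = ∑ b ∈ A, (b : ℤ) := by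
    rw [hA, Finset.sum_filter]
  have e2 : ∑ b : Fin m, (if (b : ℕ) < k then (π b : ℤ) else 0) = ∑ b ∈ A.image π, (b : ℤ) := by
    rw [Finset.sum_image (fun x _ y _ h => π.injective h), hA, Finset.sum_filter]
  have hc : (A \ A.image π).card = (A.image π \ A).card := by
    have h1 := Finset.card_sdiff_add_card_inter A (A.image π)
    have h2 := Finset.card_sdiff_add_card_inter (A.image π) A
    rw [Finset.inter_comm] at h2
    rw [Finset.card_image_of_injective _ π.injective] at h2
    omega
  have h1 : ∑ b ∈ A \ A.image π, (b : ℤ) ≤ (A \ A.image π).card • ((k : ℤ) - 1) := by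
    apply Finset.sum_le_card_nsmul
    intro x hx
    have := (Finset.mem_filter.1 (Finset.mem_sdiff.1 hx).1).2
    omega
  have h2 : (A.image π \ A).card • (k : ℤ) ≤ ∑ b ∈ A.image π \ A, (b : ℤ) := by
    apply Finset.card_nsmul_le_sum
    intro x hx
    have := (Finset.mem_sdiff.1 hx).2
    rw [hA, Finset.mem_filter] at this
    simp only [Finset.mem_univ, true_and] at this
    omega
  have h3 := Finset.sum_inter_add_sum_sdiff A (A.image π) (fun b : Fin m => (b : ℤ))
  have h4 := Finset.sum_inter_add_sum_sdiff (A.image π) A (fun b : Fin m => (b : ℤ))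
  rw [Finset.inter_comm] at h4
  rw [e1, e2]
  rw [hc] at h1
  simp only [nsmul_eq_mul] at h1 h2
  refine ⟨by nlinarith [Nat.zero_le (A.image π \ A).card], fun hne => ?_⟩
  have hpos : 0 < (A.image π \ A).card := by
    rw [Finset.card_pos, Finset.sdiff_nonempty]
    intro hsub
    exact hne (Finset.eq_of_subset_of_card_le hsub
      (Finset.card_image_of_injective _ π.injective).ge)
  have : (0 : ℤ) < (A.image π \ A).card := by exact_mod_cast hpos
  nlinarith

theorem image_symm_eq {m : ℕ} {π : Equiv.Perm (Fin m)} {A : Finset (Fin m)}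
    (h : A.image π.symm = A) : A.image π = A := by
  conv_lhs => rw [← h]
  rw [Finset.image_image]
  simp

theorem PermIrreducible.apply_zero_ne {m : ℕ} {π : Equiv.Perm (Fin m)} (h : PermIrreducible π)
    (hm : 2 ≤ m) {a : Fin m} (ha : (a : ℕ) = 0) : (π a : ℕ) ≠ 0 := by
  intro h0
  have : π a = a := Fin.ext (by rw [h0, ha])
  have hA : Finset.univ.filter (fun i : Fin m => (i : ℕ) < 1) = {a} := by
    ext i
    simp [Fin.ext_iff, ha]
  have := h 1 le_rfl (by omega) (by rw [hA, Finset.image_singleton, this])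
  omega

/-- The direction `π(b) - b`, along which every translation is negative. -/
def shiftDir {m : ℕ} (π : Equiv.Perm (Fin m)) (b : Fin m) : ℝ := ((π b : ℤ) - (b : ℤ) : ℤ)

theorem cum_shiftDir {m : ℕ} {π : Equiv.Perm (Fin m)} (h : PermIrreducible π) {k : ℕ}
    (hk : k < m) : 0 ≤ cum (shiftDir π) k ∧ (k ≠ 0 → 0 < cum (shiftDir π) k) := by
  have e : cum (shiftDir π) k = ((∑ b : Fin m, (if (b : ℕ) < k then (π b : ℤ) else 0) -
      ∑ b : Fin m, (if (b : ℕ) < k then (b : ℤ) else 0) : ℤ) : ℝ) := by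
    rw [← Finset.sum_sub_distrib]
    push_cast
    unfold cum shiftDir
    refine Finset.sum_congr rfl fun b _ => ?_
    split_ifs <;> simp
  obtain ⟨h1, h2⟩ := sum_val_le_sum_perm π k
  rw [e]
  constructor
  · exact Int.cast_nonneg (sub_nonneg.2 h1)
  · intro hk0
    have := h2 (fun h' => by have := h k (by omega) hk.le h'; omega)
    exact Int.cast_pos.2 (sub_pos.2 this)

theorem cum_shiftDir_symm {m : ℕ} {π : Equiv.Perm (Fin m)} (h : PermIrreducible π) {k : ℕ}
    (hk : k < m) : cum (shiftDir π ∘ π.symm) k ≤ 0 ∧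
      (k ≠ 0 → cum (shiftDir π ∘ π.symm) k < 0) := by
  have e : cum (shiftDir π ∘ π.symm) k = ((∑ b : Fin m, (if (b : ℕ) < k then (b : ℤ) else 0) -
      ∑ b : Fin m, (if (b : ℕ) < k then (π.symm b : ℤ) else 0) : ℤ) : ℝ) := by
    rw [← Finset.sum_sub_distrib]
    push_cast
    unfold cum shiftDir
    refine Finset.sum_congr rfl fun b _ => ?_
    split_ifs <;> simp
  obtain ⟨h1, h2⟩ := sum_val_le_sum_perm π.symm k
  rw [e]
  constructor
  · exact Int.cast_nonpos.2 (sub_nonpos.2 h1)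
  · intro hk0
    have := h2 (fun h' => by have := h k (by omega) hk.le (image_symm_eq h'); omega)
    exact Int.cast_lt_zero.2 (sub_neg.2 this)

theorem wvec_shiftDir_neg {m : ℕ} {π : Equiv.Perm (Fin m)} (h : PermIrreducible π) (hm : 2 ≤ m)
    (a : Fin m) : wvec (shiftDir π) π a < 0 := by
  have e := pre_add_wvec (shiftDir π) π a
  rw [pre_eq_cum, pre_eq_cum] at e
  have h1 := cum_shiftDir h a.isLt
  have h2 := cum_shiftDir_symm h (π a).isLt
  by_cases ha : (a : ℕ) = 0
  · have := h2.2 (h.apply_zero_ne hm ha)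
    linarith [h1.1]
  · have := h1.2 ha
    linarith [h2.1]

/-- The genericity assumptions on the lengths. -/
structure Generic {m : ℕ} (lam : Fin m → ℝ) (π : Equiv.Perm (Fin m)) : Prop where
  pos : ∀ j, 0 < lam j
  noPeriod : ∀ N : Fin m → ℕ, N ≠ 0 → ∑ b, (N b : ℝ) * wvec lam π b ≠ 0
  noConnection : ∀ b c : Fin m, (c : ℕ) ≠ 0 → ∀ N : Fin m → ℕ, N b ≠ 0 →
    pre lam b + ∑ b, (N b : ℝ) * wvec lam π b ≠ pre lam c

/-- `pre` as a linear form. -/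
def preLin {m : ℕ} (j : Fin m) : (Fin m → ℝ) →ₗ[ℝ] ℝ :=
  ∑ i ∈ Finset.univ.filter (fun i => i < j), LinearMap.proj i

theorem preLin_apply {m : ℕ} (j : Fin m) (lam : Fin m → ℝ) : preLin j lam = pre lam j := by
  simp [preLin, pre]

/-- `wvec` as a linear form. -/
def wvecLin {m : ℕ} (π : Equiv.Perm (Fin m)) (j : Fin m) : (Fin m → ℝ) →ₗ[ℝ] ℝ :=
  ∑ i ∈ Finset.univ.filter (fun i => π i < π j), LinearMap.proj i - preLin j

theorem wvecLin_apply {m : ℕ} (π : Equiv.Perm (Fin m)) (j : Fin m) (lam : Fin m → ℝ) :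
    wvecLin π j lam = wvec lam π j := by
  simp [wvecLin, wvec, preLin_apply]

theorem ae_ne_zero_of_linear {m : ℕ} (l : (Fin m → ℝ) →ₗ[ℝ] ℝ) {v : Fin m → ℝ} (hv : l v ≠ 0) :
    ∀ᵐ lam ∂(volume : Measure (Fin m → ℝ)), l lam ≠ 0 := by
  have := Measure.addHaar_submodule (volume : Measure (Fin m → ℝ)) (LinearMap.ker l) (by
    intro h
    exact hv (LinearMap.mem_ker.1 (h ▸ Submodule.mem_top)))
  rw [ae_iff]
  convert this using 2
  ext x
  simp

theorem ae_generic {m : ℕ} {π : Equiv.Perm (Fin m)} (h : PermIrreducible π) (hm : 2 ≤ m) :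
    ∀ᵐ lam ∂(volume : Measure (Fin m → ℝ)), (∀ j, 0 < lam j) → Generic lam π := by
  have hsum : ∀ N : Fin m → ℕ, ∑ b, (N b : ℝ) * wvec (shiftDir π) π b ≤ 0 := fun N =>
    Finset.sum_nonpos fun b _ =>
      mul_nonpos_of_nonneg_of_nonpos (Nat.cast_nonneg _) (wvec_shiftDir_neg h hm b).le
  have h1 : ∀ᵐ lam ∂(volume : Measure (Fin m → ℝ)), ∀ N : Fin m → ℕ, N ≠ 0 →
      ∑ b, (N b : ℝ) * wvec lam π b ≠ 0 := by
    rw [ae_all_iff]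
    intro N
    by_cases hN : N = 0
    · simp [hN]
    · obtain ⟨b, hb⟩ := Function.ne_iff.1 hN
      have hlt : ∑ b, (N b : ℝ) * wvec (shiftDir π) π b < 0 := by
        refine Finset.sum_neg' (fun b _ =>
          mul_nonpos_of_nonneg_of_nonpos (Nat.cast_nonneg _) (wvec_shiftDir_neg h hm b).le)
          ⟨b, Finset.mem_univ b, ?_⟩
        exact mul_neg_of_pos_of_neg (by exact_mod_cast Nat.pos_of_ne_zero hb)
          (wvec_shiftDir_neg h hm b)
      have := ae_ne_zero_of_linear (∑ b, (N b : ℝ) • wvecLin π b) (v := shiftDir π) (by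
        simpa [wvecLin_apply] using hlt.ne)
      filter_upwards [this] with lam hlam _
      simpa [wvecLin_apply] using hlam
  have h2 : ∀ᵐ lam ∂(volume : Measure (Fin m → ℝ)), ∀ b c : Fin m, ∀ N : Fin m → ℕ,
      (c : ℕ) ≠ 0 → N b ≠ 0 → pre lam b + ∑ b, (N b : ℝ) * wvec lam π b ≠ pre lam c := by
    simp only [ae_all_iff]
    intro b c N hc hb
    have hlt : pre (shiftDir π) b + ∑ b, (N b : ℝ) * wvec (shiftDir π) π b -
        pre (shiftDir π) c < 0 := by
      have e1 : ∑ b, (N b : ℝ) * wvec (shiftDir π) π b ≤ wvec (shiftDir π) π b := by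
        rw [← Finset.add_sum_erase _ _ (Finset.mem_univ b)]
        have a1 : ∑ x ∈ Finset.univ.erase b, (N x : ℝ) * wvec (shiftDir π) π x ≤ 0 :=
          Finset.sum_nonpos fun b _ =>
            mul_nonpos_of_nonneg_of_nonpos (Nat.cast_nonneg _) (wvec_shiftDir_neg h hm b).le
        have a2 : (1 : ℝ) ≤ N b := by exact_mod_cast Nat.pos_of_ne_zero hb
        nlinarith [wvec_shiftDir_neg h hm b]
      have e2 := pre_add_wvec (shiftDir π) π b
      rw [pre_eq_cum _ (π b)] at e2
      have e3 := (cum_shiftDir_symm h (π b).isLt).1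
      have e4 := (cum_shiftDir h c.isLt).2 hc
      rw [← pre_eq_cum] at e4
      linarith
    have := ae_ne_zero_of_linear (preLin b + ∑ b, (N b : ℝ) • wvecLin π b - preLin c)
      (v := shiftDir π) (by simpa [wvecLin_apply, preLin_apply] using hlt.ne)
    filter_upwards [this] with lam hlam
    have : pre lam b + ∑ b, (N b : ℝ) * wvec lam π b - pre lam c ≠ 0 := by
      simpa [wvecLin_apply, preLin_apply] using hlam
    exact fun h' => this (sub_eq_zero.2 h')
  filter_upwards [h1, h2] with lam a1 a2 hp
  exact ⟨hp, a1, fun b c hc N hN => a2 b c N hc hN⟩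

/-! ### Consequences of genericity -/

/-- The phase space of the interval exchange. -/
abbrev base {m : ℕ} (lam : Fin m → ℝ) : Set ℝ := Ico (0 : ℝ) (∑ i, lam i)

/-- Two points have the same first `n` letters. -/
def SameCode {m : ℕ} [NeZero m] (lam : Fin m → ℝ) (π : Equiv.Perm (Fin m)) (n : ℕ) (x y : ℝ) :
    Prop := ∀ k < n, itin lam π x k = itin lam π y k

theorem disp_eq_sum_count {m : ℕ} (lam : Fin m → ℝ) (π : Equiv.Perm (Fin m)) (a : ℕ → Fin m)
    (k : ℕ) : disp lam π a k =
      ∑ b, (((Finset.range k).filter (fun j => a j = b)).card : ℝ) * wvec lam π b := by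
  unfold disp
  rw [← Finset.sum_fiberwise (Finset.range k) a]
  refine Finset.sum_congr rfl fun b _ => ?_
  rw [Finset.sum_congr rfl (g := fun _ => wvec lam π b), Finset.sum_const, nsmul_eq_mul]
  intro j hj
  rw [(Finset.mem_filter.1 hj).2]

section

set_option linter.unusedSectionVars false

variable {m : ℕ} [NeZero m] {lam : Fin m → ℝ} {π : Equiv.Perm (Fin m)}

theorem Generic.nonneg (h : Generic lam π) (j : Fin m) : 0 ≤ lam j := (h.pos j).le

theorem Generic.disp_ne_zero (h : Generic lam π) (a : ℕ → Fin m) {k : ℕ} (hk : k ≠ 0) :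
    disp lam π a k ≠ 0 := by
  rw [disp_eq_sum_count]
  refine h.noPeriod (fun b => ((Finset.range k).filter (fun j => a j = b)).card) fun h0 => ?_
  have := congrFun h0 (a 0)
  rw [Pi.zero_apply, Finset.card_eq_zero, Finset.filter_eq_empty_iff] at this
  exact this (Finset.mem_range.2 (Nat.pos_of_ne_zero hk)) rfl

theorem pre_mem_block (hpos : ∀ j, 0 < lam j) (b : Fin m) : pre lam b ∈ block lam b :=
  ⟨le_rfl, by linarith [hpos b]⟩

theorem pre_mem_base (hpos : ∀ j, 0 < lam j) (b : Fin m) : pre lam b ∈ base lam :=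
  block_subset (fun j => (hpos j).le) b (pre_mem_block hpos b)

theorem itin_pre_zero (hpos : ∀ j, 0 < lam j) (b : Fin m) : itin lam π (pre lam b) 0 = b :=
  letter_eq (fun j => (hpos j).le) (pre_mem_block hpos b)

theorem Generic.iterate_pre_ne (h : Generic lam π) (b : Fin m) {c : Fin m} (hc : (c : ℕ) ≠ 0)
    {k : ℕ} (hk : k ≠ 0) : (iet lam π)^[k] (pre lam b) ≠ pre lam c := by
  rw [iterate_eq h.nonneg π (pre_mem_base h.pos b), disp_eq_sum_count]
  refine h.noConnection b c hc _ fun h0 => ?_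
  rw [Finset.card_eq_zero, Finset.filter_eq_empty_iff] at h0
  exact h0 (Finset.mem_range.2 (Nat.pos_of_ne_zero hk)) (itin_pre_zero h.pos b)

/-- The inverse of the interval exchange. -/
def tinv (lam : Fin m → ℝ) (π : Equiv.Perm (Fin m)) (y : ℝ) : ℝ :=
  if h : ∃ x ∈ base lam, iet lam π x = y then h.choose else y

theorem tinv_spec (hpos : ∀ j, 0 ≤ lam j) (π : Equiv.Perm (Fin m)) {y : ℝ} (hy : y ∈ base lam) :
    tinv lam π y ∈ base lam ∧ iet lam π (tinv lam π y) = y := by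
  have h := iet_surjOn hpos π hy
  rw [tinv, dif_pos h]
  exact h.choose_spec

theorem tinv_iterate_mem (hpos : ∀ j, 0 ≤ lam j) (π : Equiv.Perm (Fin m)) {y : ℝ}
    (hy : y ∈ base lam) (k : ℕ) : (tinv lam π)^[k] y ∈ base lam := by
  induction k with
  | zero => exact hy
  | succ k ih =>
    rw [Function.iterate_succ_apply']
    exact (tinv_spec hpos π ih).1

theorem iet_tinv_iterate (hpos : ∀ j, 0 ≤ lam j) (π : Equiv.Perm (Fin m)) {y : ℝ}
    (hy : y ∈ base lam) (k : ℕ) :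
    iet lam π ((tinv lam π)^[k + 1] y) = (tinv lam π)^[k] y := by
  rw [Function.iterate_succ_apply']
  exact (tinv_spec hpos π (tinv_iterate_mem hpos π hy k)).2

theorem iterate_tinv_iterate (hpos : ∀ j, 0 ≤ lam j) (π : Equiv.Perm (Fin m)) {y : ℝ}
    (hy : y ∈ base lam) (k j : ℕ) :
    (iet lam π)^[k] ((tinv lam π)^[k + j] y) = (tinv lam π)^[j] y := by
  induction k with
  | zero => simp
  | succ k ih =>
    rw [Function.iterate_succ_apply, show k + 1 + j = (k + j) + 1 by ring,
      iet_tinv_iterate hpos π hy, ih]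

theorem tinv_iterate_iterate (hpos : ∀ j, 0 ≤ lam j) (π : Equiv.Perm (Fin m)) {x : ℝ}
    (hx : x ∈ base lam) (k : ℕ) : (tinv lam π)^[k] ((iet lam π)^[k] x) = x := by
  apply (iet_injective hpos π).iterate k
  have := iterate_tinv_iterate hpos π (iterate_mem hpos π hx k) k 0
  simpa using this

theorem Generic.tinv_iterate_pre_ne (h : Generic lam π) (b : Fin m) {c : Fin m}
    (hc : (c : ℕ) ≠ 0) {k : ℕ} (hk : k ≠ 0) : (tinv lam π)^[k] (pre lam c) ≠ pre lam b := by
  intro he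
  apply h.iterate_pre_ne b hc hk
  rw [← he]
  simpa using iterate_tinv_iterate h.nonneg π (pre_mem_base h.pos c) k 0

theorem exists_sub_mem_block {y : ℝ} {b : Fin m} (hy : y ∈ block lam b)
    (hne : y ≠ pre lam b) : ∃ t > 0, ∀ s, 0 ≤ s → s < t → y - s ∈ block lam b := by
  refine ⟨y - pre lam b, sub_pos.2 (lt_of_le_of_ne hy.1 hne.symm), fun s h1 h2 => ⟨?_, ?_⟩⟩
  · linarith
  · linarith [hy.2]

theorem pre_sub_mem_block {b c : Fin m} (hbc : (b : ℕ) + 1 = c) {s : ℝ} (h1 : 0 < s)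
    (h2 : s ≤ lam b) : pre lam c - s ∈ block lam b := by
  rw [mem_block_iff, pre_eq_cum, ← hbc, cum_succ]
  constructor <;> linarith

theorem exists_common_pos {ι : Type*} [Finite ι] {P : ι → ℝ → Prop}
    (h : ∀ i, ∃ t > 0, ∀ s, 0 ≤ s → s < t → P i s) :
    ∃ t > 0, ∀ s, 0 ≤ s → s < t → ∀ i, P i s := by
  choose t ht hP using h
  cases nonempty_fintype ι
  rcases isEmpty_or_nonempty ι with hι | hι
  · exact ⟨1, one_pos, fun s _ _ i => (hι.false i).elim⟩
  · refine ⟨Finset.univ.inf' Finset.univ_nonempty t, ?_, fun s h1 h2 i => ?_⟩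
    · rw [gt_iff_lt, Finset.lt_inf'_iff]
      exact fun i _ => ht i
    · exact hP i s h1 (h2.trans_le (Finset.inf'_le _ (Finset.mem_univ i)))

/-- Points slightly to the left of the backward orbit of a discontinuity follow this orbit. -/
theorem Generic.exists_left_shadow (h : Generic lam π) {c : Fin m} (hc : (c : ℕ) ≠ 0) (J : ℕ) :
    ∃ t > 0, ∀ s, 0 ≤ s → s < t → ∀ j < J,
      (tinv lam π)^[j + 1] (pre lam c) - s ∈ block lam (letter lam ((tinv lam π)^[j + 1] (pre lam c)))
      ∧ iet lam π ((tinv lam π)^[j + 1] (pre lam c) - s) = (tinv lam π)^[j] (pre lam c) - s := by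
  obtain ⟨t, ht, hs⟩ := exists_common_pos (ι := Fin J)
    (P := fun j s => (tinv lam π)^[j + 1] (pre lam c) - s ∈
      block lam (letter lam ((tinv lam π)^[j + 1] (pre lam c)))) (fun j =>
      exists_sub_mem_block
        (letter_spec (tinv_iterate_mem h.nonneg π (pre_mem_base h.pos c) _))
        (h.tinv_iterate_pre_ne _ hc (Nat.succ_ne_zero _)))
  refine ⟨t, ht, fun s h1 h2 j hj => ?_⟩
  have h3 := hs s h1 h2 ⟨j, hj⟩
  refine ⟨h3, ?_⟩
  have h4 := hs 0 le_rfl ht ⟨j, hj⟩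
  rw [sub_zero] at h4
  rw [iet_of_mem h.nonneg π h3, ← iet_tinv_iterate h.nonneg π (pre_mem_base h.pos c) j,
    iet_of_mem h.nonneg π h4]
  ring

/-- Iterated form of the left shadowing. -/
theorem Generic.exists_left_shadow_iterate (h : Generic lam π) {c : Fin m} (hc : (c : ℕ) ≠ 0)
    (J : ℕ) : ∃ t > 0, ∀ s, 0 ≤ s → s < t → ∀ i j, i + j ≤ J →
      (iet lam π)^[i] ((tinv lam π)^[i + j] (pre lam c) - s) = (tinv lam π)^[j] (pre lam c) - s ∧
      SameCode lam π i ((tinv lam π)^[i + j] (pre lam c) - s) ((tinv lam π)^[i + j] (pre lam c)) ∧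
      (i + j ≠ 0 → (tinv lam π)^[i + j] (pre lam c) - s ∈ base lam) := by
  obtain ⟨t, ht, H⟩ := h.exists_left_shadow hc J
  refine ⟨t, ht, fun s h1 h2 i j hij => ⟨?_, ?_, ?_⟩⟩
  · induction i with
    | zero => simp
    | succ i ih =>
      rw [Function.iterate_succ_apply, show i + 1 + j = (i + j) + 1 by ring,
        (H s h1 h2 (i + j) (by omega)).2, ih (by omega)]
  · have aux : ∀ k, k ≤ i → (iet lam π)^[k] ((tinv lam π)^[i + j] (pre lam c) - s) =
        (tinv lam π)^[i + j - k] (pre lam c) - s := by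
      intro k
      induction k with
      | zero => simp
      | succ k ih =>
        intro hk
        rw [Function.iterate_succ_apply', ih (by omega),
          show i + j - k = (i + j - (k + 1)) + 1 by omega]
        exact (H s h1 h2 (i + j - (k + 1)) (by omega)).2
    intro k hk
    rw [itin, itin, aux k hk.le]
    have e1 := iterate_tinv_iterate h.nonneg π (pre_mem_base h.pos c) k (i + j - k)
    rw [show k + (i + j - k) = i + j by omega] at e1
    rw [e1]
    have := (H s h1 h2 (i + j - k - 1) (by omega)).1
    rw [show i + j - k - 1 + 1 = i + j - k by omega] at this
    exact letter_eq h.nonneg this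
  · intro h0
    have := (H s h1 h2 (i + j - 1) (by omega)).1
    rw [show i + j - 1 + 1 = i + j by omega] at this
    exact block_subset h.nonneg _ this

end

/-! ### Invariant saturated sets and generation -/

section

set_option linter.unusedSectionVars false

variable {m : ℕ} [NeZero m] {lam : Fin m → ℝ} {π : Equiv.Perm (Fin m)}

theorem SameCode.symm {n : ℕ} {x y : ℝ} (h : SameCode lam π n x y) : SameCode lam π n y x :=
  fun k hk => (h k hk).symm

theorem SameCode.trans {n : ℕ} {x y z : ℝ} (h : SameCode lam π n x y)
    (h' : SameCode lam π n y z) : SameCode lam π n x z :=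
  fun k hk => (h k hk).trans (h' k hk)

theorem SameCode.mono {n k : ℕ} {x y : ℝ} (h : SameCode lam π n x y) (hk : k ≤ n) :
    SameCode lam π k x y := fun j hj => h j (hj.trans_le hk)

theorem SameCode.iterate {n k j : ℕ} {x y : ℝ} (h : SameCode lam π n x y) (hk : k + j ≤ n) :
    SameCode lam π k ((iet lam π)^[j] x) ((iet lam π)^[j] y) := fun i hi => by
  rw [itin_iterate, itin_iterate]
  exact h _ (by omega)

/-- Points slightly to the right of a point have the same code. -/
theorem exists_right_sameCode (hpos : ∀ j, 0 < lam j) (π : Equiv.Perm (Fin m)) {x : ℝ}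
    (hx : x ∈ base lam) (n : ℕ) :
    ∃ t > 0, ∀ s, 0 ≤ s → s < t → x + s ∈ base lam ∧ SameCode lam π n (x + s) x := by
  have hnn : ∀ j, 0 ≤ lam j := fun j => (hpos j).le
  obtain ⟨t, ht, H⟩ := exists_common_pos (ι := Fin (n + 1))
    (P := fun k s => x + s + disp lam π (itin lam π x) k ∈ block lam (itin lam π x k)) (fun k => by
      have h1 := iterate_mem_block hnn π hx k
      rw [iterate_eq hnn π hx, block, mem_Ico] at h1
      refine ⟨pre lam (itin lam π x k) + lam (itin lam π x k) -
        (x + disp lam π (itin lam π x) k), by linarith [h1.2], fun s h2 h3 => ⟨?_, ?_⟩⟩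
      · linarith [h1.1]
      · linarith)
  refine ⟨t, ht, fun s h1 h2 => ⟨?_, ?_⟩⟩
  · have := H s h1 h2 0
    simp only [disp, Fin.val_zero, Finset.range_zero, Finset.sum_empty, add_zero] at this
    exact block_subset hnn _ this
  · intro k hk
    exact (itin_eq_of_forall_mem hnn π (a := itin lam π x) (n := n)
      (fun k hk => H s h1 h2 ⟨k, by omega⟩) k hk).1

/-- Sets which are unions of cylinders of length `n`. -/
def Saturated (lam : Fin m → ℝ) (π : Equiv.Perm (Fin m)) (n : ℕ) (U : Set ℝ) : Prop :=
  ∀ x ∈ base lam, ∀ y ∈ base lam, SameCode lam π n x y → x ∈ U → y ∈ U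

theorem mem_of_iet_mem (hpos : ∀ j, 0 < lam j) {n : ℕ} {U : Set ℝ} (hU : Saturated lam π n U)
    (hinv : ∀ x ∈ base lam, x ∈ U → iet lam π x ∈ U) {x : ℝ} (hx : x ∈ base lam)
    (hTx : iet lam π x ∈ U) : x ∈ U := by
  have hnn : ∀ j, 0 ≤ lam j := fun j => (hpos j).le
  obtain ⟨t, ht, H⟩ := exists_right_sameCode hpos π hx (n + 1)
  have key : ∀ z ∈ Ico x (x + t), z ∈ base lam ∧ SameCode lam π (n + 1) z x := by
    intro z hz
    have := H (z - x) (by linarith [hz.1]) (by linarith [hz.2])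
    rwa [add_sub_cancel] at this
  have : IsFiniteMeasure (volume.restrict (base lam)) :=
    ⟨by rw [Measure.restrict_apply_univ]; exact measure_Ico_lt_top⟩
  have hcons := (measurePreserving_iet hnn π).conservative
  obtain ⟨z, hz, k, hk, hzk⟩ := hcons.exists_mem_iterate_mem (s := Ico x (x + t))
    measurableSet_Ico.nullMeasurableSet (by
      rw [Measure.restrict_apply measurableSet_Ico, inter_eq_left.2 fun z hz => (key z hz).1]
      simpa using ht)
  obtain ⟨hzb, hzc⟩ := key z hz
  have h1 : iet lam π z ∈ U :=
    hU _ (iet_mem hnn π hx) _ (iet_mem hnn π hzb) (hzc.symm.iterate (j := 1) le_rfl) hTx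
  have h2 : ∀ j, (iet lam π)^[j + 1] z ∈ U := by
    intro j
    induction j with
    | zero => exact h1
    | succ j ih =>
      rw [Function.iterate_succ_apply']
      exact hinv _ (iterate_mem hnn π hzb _) ih
  obtain ⟨hkb, hkc⟩ := key _ hzk
  have h3 := h2 (k - 1)
  rw [Nat.sub_add_cancel (Nat.one_le_iff_ne_zero.2 hk)] at h3
  exact hU _ hkb _ hx (hkc.mono (by omega)) h3

theorem exists_left_mem_iff (h : Generic lam π) (hz : ∀ c : Fin m, (π c : ℕ) = 0 → (c : ℕ) ≠ 0)
    {n : ℕ} {U : Set ℝ} (hU : Saturated lam π n U)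
    (hinv : ∀ x ∈ base lam, (x ∈ U ↔ iet lam π x ∈ U)) {x : ℝ} (hx : x ∈ base lam) (hx0 : x ≠ 0) :
    ∃ t > 0, ∀ s, 0 ≤ s → s < t → (x - s ∈ U ↔ x ∈ U) := by
  by_cases hex : ∃ k < n, ∃ c : Fin m, (c : ℕ) ≠ 0 ∧ (iet lam π)^[k] x = pre lam c
  · obtain ⟨k, hk, c, hc, he⟩ := hex
    obtain ⟨t, ht, H⟩ := h.exists_left_shadow_iterate hc n
    refine ⟨t, ht, fun s h1 h2 => ?_⟩
    have hinv' : ∀ j, ∀ y ∈ base lam, (y ∈ U ↔ (iet lam π)^[j] y ∈ U) := by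
      intro j
      induction j with
      | zero => simp
      | succ j ih =>
        intro y hy
        rw [Function.iterate_succ_apply, hinv y hy]
        exact ih _ (iet_mem h.nonneg π hy)
    have hxk : (tinv lam π)^[k] (pre lam c) = x := by
      rw [← he]
      exact tinv_iterate_iterate h.nonneg π hx k
    obtain ⟨-, a2, a3⟩ := H s h1 h2 n 0 (by omega)
    obtain ⟨b1, -, -⟩ := H s h1 h2 (n - k) k (by omega)
    simp only [add_zero] at a2 a3
    rw [show n - k + k = n by omega] at b1
    have hy := tinv_iterate_mem h.nonneg π (pre_mem_base h.pos c) n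
    have hys := a3 (by omega)
    have c1 := hinv' (n - k) _ hy
    have c2 := hinv' (n - k) _ hys
    have e1 := iterate_tinv_iterate h.nonneg π (pre_mem_base h.pos c) (n - k) k
    rw [show n - k + k = n by omega] at e1
    rw [e1, hxk] at c1
    rw [b1, hxk] at c2
    rw [← c1, ← c2]
    exact ⟨hU _ hys _ hy a2, hU _ hy _ hys a2.symm⟩
  · push Not at hex
    have hne : ∀ k < n, ∀ b : Fin m, (iet lam π)^[k] x ≠ pre lam b := by
      intro k hk b hb
      by_cases hb0 : (b : ℕ) = 0
      · rw [pre_eq_cum, hb0, cum_zero] at hb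
        rcases Nat.eq_zero_or_pos k with rfl | hkpos
        · exact hx0 hb
        · obtain ⟨c, hc⟩ := π.surjective b
          have hc0 := hz c (by rw [hc, hb0])
          apply hex (k - 1) (by omega) c hc0
          have e1 := pre_add_wvec lam π c
          rw [hc, pre_eq_cum _ b, hb0, cum_zero, ← iet_of_mem h.nonneg π (pre_mem_block h.pos c)]
            at e1
          apply iet_injective h.nonneg π
          rw [e1, ← Function.iterate_succ_apply' (f := iet lam π),
            show (k - 1).succ = k by omega, hb]
      · exact hex k hk b hb0 hb
    obtain ⟨t, ht, H⟩ := exists_common_pos (ι := Fin n)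
      (P := fun k s => x + disp lam π (itin lam π x) k - s ∈ block lam (itin lam π x k)) (fun k => by
        have h1 := iterate_mem_block h.nonneg π hx k
        have h2 := hne k k.isLt (itin lam π x k)
        rw [iterate_eq h.nonneg π hx] at h1 h2
        exact exists_sub_mem_block h1 h2)
    refine ⟨min t x, lt_min ht (lt_of_le_of_ne hx.1 hx0.symm), fun s h1 h2 => ?_⟩
    have hxs : x - s ∈ base lam :=
      ⟨by linarith [min_le_right t x], by linarith [hx.2]⟩
    have hc : SameCode lam π n (x - s) x := fun k hk =>
      (itin_eq_of_forall_mem h.nonneg π (a := itin lam π x) (n := n) (fun k hk => by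
        have := H s h1 (h2.trans_le (min_le_left _ _)) ⟨k, hk⟩
        rwa [show x - s + disp lam π (itin lam π x) k = x + disp lam π (itin lam π x) k - s by ring])
        k hk).1
    exact ⟨hU _ hxs _ hx hc, hU _ hx _ hxs hc.symm⟩

/-- A nonempty forward invariant union of cylinders is everything. -/
theorem Generic.base_subset (h : Generic lam π) (hz : ∀ c : Fin m, (π c : ℕ) = 0 → (c : ℕ) ≠ 0)
    {n : ℕ} {U : Set ℝ} (hU : Saturated lam π n U)
    (hinv : ∀ x ∈ base lam, x ∈ U → iet lam π x ∈ U) (hne : ∃ x ∈ base lam, x ∈ U) :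
    ∀ x ∈ base lam, x ∈ U := by
  have hinv' : ∀ x ∈ base lam, (x ∈ U ↔ iet lam π x ∈ U) := fun x hx =>
    ⟨hinv x hx, mem_of_iet_mem h.pos hU hinv hx⟩
  obtain ⟨x0, hx0, hxU⟩ := hne
  intro y hy
  have hcont : ContinuousOn (fun x => decide (x ∈ U)) (base lam) := by
    intro x hx
    obtain ⟨t1, ht1, H1⟩ := exists_right_sameCode h.pos π hx n
    obtain ⟨t2, ht2, H2⟩ : ∃ t > 0, ∀ s, 0 ≤ s → s < t → x - s ∈ base lam →
        (x - s ∈ U ↔ x ∈ U) := by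
      by_cases hx0 : x = 0
      · refine ⟨1, one_pos, fun s h1 _ h3 => ?_⟩
        have : s = 0 := by
          have := h3.1
          linarith
        rw [this, sub_zero]
      · obtain ⟨t, ht, H⟩ := exists_left_mem_iff h hz hU hinv' hx hx0
        exact ⟨t, ht, fun s h1 h2 _ => H s h1 h2⟩
    have hev : ∀ᶠ z in nhdsWithin x (base lam), decide (z ∈ U) = decide (x ∈ U) := by
      have : Metric.ball x (min t1 t2) ∈ nhds x := Metric.ball_mem_nhds x (lt_min ht1 ht2)
      filter_upwards [mem_nhdsWithin_of_mem_nhds this, self_mem_nhdsWithin] with z hz1 hz2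
      rw [Metric.mem_ball, Real.dist_eq] at hz1
      rw [decide_eq_decide]
      rcases le_total x z with hxz | hxz
      · rw [abs_of_nonneg (by linarith)] at hz1
        obtain ⟨b1, b2⟩ := H1 (z - x) (by linarith) (hz1.trans_le (min_le_left _ _))
        rw [add_sub_cancel] at b1 b2
        exact ⟨hU _ hz2 _ hx b2, hU _ hx _ hz2 b2.symm⟩
      · rw [abs_of_nonpos (by linarith)] at hz1
        have := H2 (x - z) (by linarith) (by linarith [min_le_right t1 t2])
        rw [sub_sub_cancel] at this
        exact this hz2
    exact (continuousWithinAt_const (b := decide (x ∈ U))).congr_of_eventuallyEq hev rfl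
  have := isPreconnected_Ico.constant hcont hx0 hy
  rw [decide_eq_decide] at this
  exact this.1 hxU

theorem exists_pos_lower_bound {ι : Type*} [Finite ι] (f : ι → ℝ) (hf : ∀ i, 0 < f i) :
    ∃ v > 0, ∀ i, v ≤ f i := by
  cases nonempty_fintype ι
  rcases isEmpty_or_nonempty ι with hι | hι
  · exact ⟨1, one_pos, fun i => (hι.false i).elim⟩
  · obtain ⟨i, -, hi⟩ := Finset.exists_min_image Finset.univ f Finset.univ_nonempty
    exact ⟨f i, hf i, fun j => hi j (Finset.mem_univ j)⟩

/-- Extension of a finite word to an infinite one. -/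
def extWord {n : ℕ} (w : Fin (n + 1) → Fin m) (k : ℕ) : Fin m := w (Fin.ofNat (n + 1) k)

theorem extWord_of_lt {n : ℕ} (w : Fin (n + 1) → Fin m) {k : ℕ} (hk : k < n + 1) :
    extWord w k = w ⟨k, hk⟩ := by
  unfold extWord
  congr 1
  exact Fin.ext (Nat.mod_eq_of_lt hk)

/-- Points with a sufficiently long common code are close to each other. -/
theorem Generic.exists_code_length (h : Generic lam π) {η : ℝ} (hη : 0 < η) :
    ∃ r, ∀ x ∈ base lam, ∀ y ∈ base lam, SameCode lam π r x y → |x - y| < η := by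
  set tot := ∑ i, lam i with htot
  obtain ⟨K, hK⟩ := exists_nat_gt (tot / η)
  obtain ⟨v0, hv0, hv⟩ := exists_pos_lower_bound
    (ι := (Fin (K + 1) → Fin m) × {q : Fin (K + 1) // (q : ℕ) ≠ 0})
    (fun p => |disp lam π (extWord p.1) p.2.1|) (fun p => abs_pos.2 (h.disp_ne_zero _ p.2.2))
  obtain ⟨M, hM⟩ := exists_nat_gt (tot / v0)
  have main : ∀ x ∈ base lam, ∀ y ∈ base lam, x ≤ y →
      SameCode lam π (K + (M + 1) * K) x y → y - x < η := by
    intro x hx y hy hxy hcode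
    by_contra hge
    push Not at hge
    have hmaps : ∀ k ∈ Finset.range (K + 1), ⌊(iet lam π)^[k] x / η⌋₊ ∈ Finset.range K := by
      intro k _
      have hk := iterate_mem h.nonneg π hx k
      rw [Finset.mem_range, Nat.floor_lt (div_nonneg hk.1 hη.le)]
      exact (div_lt_div_of_pos_right hk.2 hη).trans hK
    obtain ⟨k, hk, l, hl, hkl, hfl⟩ : ∃ k ∈ Finset.range (K + 1), ∃ l ∈ Finset.range (K + 1),
        k < l ∧ ⌊(iet lam π)^[k] x / η⌋₊ = ⌊(iet lam π)^[l] x / η⌋₊ := by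
      obtain ⟨k, hk, l, hl, hne, he⟩ := Finset.exists_ne_map_eq_of_card_lt_of_maps_to
        (by simp) hmaps
      rcases lt_or_gt_of_ne hne with h1 | h1
      · exact ⟨k, hk, l, hl, h1, he⟩
      · exact ⟨l, hl, k, hk, h1, he.symm⟩
    rw [Finset.mem_range] at hk hl
    set X0 := (iet lam π)^[k] x with hX0
    set Y0 := (iet lam π)^[k] y with hY0
    set a := itin lam π X0 with ha
    set q := l - k with hq
    set R := (M + 1) * K with hR
    have hXb : X0 ∈ base lam := iterate_mem h.nonneg π hx k
    have hYb : Y0 ∈ base lam := iterate_mem h.nonneg π hy k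
    have hYX : Y0 - X0 = y - x :=
      iterate_sub_of_itin_eq h.nonneg π hx hy (hcode.mono (by omega))
    have hcode' : SameCode lam π R X0 Y0 := hcode.iterate (by omega)
    have hTq : (iet lam π)^[q] X0 = X0 + disp lam π a q := iterate_eq h.nonneg π hXb q
    have hTl : (iet lam π)^[q] X0 = (iet lam π)^[l] x := by
      rw [hX0, ← Function.iterate_add_apply, hq, Nat.sub_add_cancel hkl.le]
    have hqR : q ≤ R := by
      have h1 : q ≤ K := by omega
      have h2 : (M + 1) * K = M * K + K := by ring
      omega
    have hTqY : (iet lam π)^[q] Y0 = Y0 + disp lam π a q := by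
      have := iterate_sub_of_itin_eq h.nonneg π hXb hYb (hcode'.mono hqR)
      linarith
    have hclose : |disp lam π a q| < η := by
      have h1 : disp lam π a q = (iet lam π)^[l] x - X0 := by linarith
      rw [h1]
      have e1 := Nat.floor_le (div_nonneg hXb.1 hη.le)
      have e2 := Nat.lt_floor_add_one (X0 / η)
      have e3 := Nat.floor_le (div_nonneg (iterate_mem h.nonneg π hx l).1 hη.le)
      have e4 := Nat.lt_floor_add_one ((iet lam π)^[l] x / η)
      rw [← hfl] at e3 e4
      rw [le_div_iff₀ hη] at e1 e3
      rw [div_lt_iff₀ hη] at e2 e4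
      rw [abs_lt]
      constructor <;> linarith
    have hper : ∀ i, i + q < R → a (i + q) = a i := by
      intro i hi
      rw [abs_lt] at hclose
      rcases le_total 0 (disp lam π a q) with hs | hs
      · have := itin_eq_of_between h.nonneg π hXb hYb hcode' (z := (iet lam π)^[q] X0)
          (by linarith) (by linarith) i (by omega)
        rwa [itin_iterate] at this
      · have := itin_eq_of_between h.nonneg π hXb hYb hcode' (z := (iet lam π)^[q] Y0)
          (by linarith) (by linarith) i (by omega)
        rw [itin_iterate, ← hcode' _ hi] at this
        exact this
    have hmul : ∀ j, j * q ≤ R → disp lam π a (j * q) = j * disp lam π a q := by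
      have hpj : ∀ j i, i < q → i + j * q < R → a (i + j * q) = a i := by
        intro j
        induction j with
        | zero => simp
        | succ j ih =>
          intro i hi hlt
          have e : i + (j + 1) * q = (i + j * q) + q := by ring
          rw [e] at hlt ⊢
          rw [hper _ hlt, ih i hi (by omega)]
      intro j
      induction j with
      | zero => simp [disp]
      | succ j ih =>
        intro hj
        have e : (j + 1) * q = j * q + q := by ring
        rw [e] at hj ⊢
        have h1 : disp lam π a (j * q + q) = disp lam π a (j * q) + disp lam π a q := by
          unfold disp
          rw [Finset.sum_range_add]
          congr 1
          refine Finset.sum_congr rfl fun i hi => ?_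
          rw [Finset.mem_range] at hi
          rw [add_comm, hpj j i hi (by omega)]
        rw [h1, ih (by omega)]
        push_cast
        ring
    have hv' : v0 ≤ |disp lam π a q| := by
      have := hv (fun i => a i, ⟨⟨q, by omega⟩, by simp only; omega⟩)
      simp only at this
      rwa [disp_congr lam π (b := a) (fun j hj => ?_)] at this
      rw [extWord_of_lt _ (by omega : j < K + 1)]
    have hMq : M * q ≤ R := by
      have : q ≤ K := by omega
      rw [hR]
      nlinarith
    have h1 := iterate_eq h.nonneg π hXb (M * q)
    have h2 := iterate_mem h.nonneg π hXb (M * q)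
    have h1' : (iet lam π)^[M * q] X0 = X0 + M * disp lam π a q := by rw [h1, ← ha, hmul M hMq]
    rw [h1'] at h2
    have h3 : |(M : ℝ) * disp lam π a q| < tot := by
      rw [abs_lt]
      constructor <;> linarith [h2.1, h2.2, hXb.1, hXb.2]
    rw [abs_mul, Nat.abs_cast] at h3
    rw [div_lt_iff₀ hv0] at hM
    have : (M : ℝ) * v0 ≤ M * |disp lam π a q| :=
      mul_le_mul_of_nonneg_left hv' (Nat.cast_nonneg M)
    linarith
  refine ⟨K + (M + 1) * K, fun x hx y hy hcode => ?_⟩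
  rcases le_total x y with hxy | hxy
  · rw [abs_sub_comm, abs_of_nonneg (by linarith)]
    exact main x hx y hy hxy hcode
  · rw [abs_of_nonneg (by linarith)]
    exact main y hy x hx hxy hcode.symm

end

/-! ### Cylinders and their widths -/

section

set_option linter.unusedSectionVars false

variable {m : ℕ} [NeZero m] {lam : Fin m → ℝ} {π : Equiv.Perm (Fin m)}

/-- Left endpoint of the cylinder of the word `a 0, …, a n`. -/
def cylL (lam : Fin m → ℝ) (π : Equiv.Perm (Fin m)) (a : ℕ → Fin m) (n : ℕ) : ℝ :=
  (Finset.range (n + 1)).sup' Finset.nonempty_range_add_one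
    (fun k => pre lam (a k) - disp lam π a k)

/-- Right endpoint of the cylinder of the word `a 0, …, a n`. -/
def cylR (lam : Fin m → ℝ) (π : Equiv.Perm (Fin m)) (a : ℕ → Fin m) (n : ℕ) : ℝ :=
  (Finset.range (n + 1)).inf' Finset.nonempty_range_add_one
    (fun k => pre lam (a k) + lam (a k) - disp lam π a k)

/-- (Signed) width of the cylinder of the word `a 0, …, a n`. -/
def wid (lam : Fin m → ℝ) (π : Equiv.Perm (Fin m)) (a : ℕ → Fin m) (n : ℕ) : ℝ :=
  cylR lam π a n - cylL lam π a n

theorem cylL_le_iff {a : ℕ → Fin m} {n : ℕ} {x : ℝ} :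
    cylL lam π a n ≤ x ↔ ∀ k ≤ n, pre lam (a k) ≤ x + disp lam π a k := by
  unfold cylL
  rw [Finset.sup'_le_iff]
  simp only [Finset.mem_range, Nat.lt_succ_iff, sub_le_iff_le_add]

theorem lt_cylR_iff {a : ℕ → Fin m} {n : ℕ} {x : ℝ} :
    x < cylR lam π a n ↔ ∀ k ≤ n, x + disp lam π a k < pre lam (a k) + lam (a k) := by
  unfold cylR
  rw [Finset.lt_inf'_iff]
  simp only [Finset.mem_range, Nat.lt_succ_iff, lt_sub_iff_add_lt]

theorem exists_cylL_eq (lam : Fin m → ℝ) (π : Equiv.Perm (Fin m)) (a : ℕ → Fin m) (n : ℕ) :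
    ∃ k ≤ n, cylL lam π a n = pre lam (a k) - disp lam π a k := by
  obtain ⟨k, hk, he⟩ := Finset.exists_mem_eq_sup' (Finset.nonempty_range_add_one (n := n))
    (fun k => pre lam (a k) - disp lam π a k)
  exact ⟨k, Nat.lt_succ_iff.1 (Finset.mem_range.1 hk), he⟩

theorem exists_cylR_eq (lam : Fin m → ℝ) (π : Equiv.Perm (Fin m)) (a : ℕ → Fin m) (n : ℕ) :
    ∃ k ≤ n, cylR lam π a n = pre lam (a k) + lam (a k) - disp lam π a k := by
  obtain ⟨k, hk, he⟩ := Finset.exists_mem_eq_inf' (Finset.nonempty_range_add_one (n := n))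
    (fun k => pre lam (a k) + lam (a k) - disp lam π a k)
  exact ⟨k, Nat.lt_succ_iff.1 (Finset.mem_range.1 hk), he⟩

theorem le_wid_iff {a : ℕ → Fin m} {n : ℕ} {c : ℝ} : c ≤ wid lam π a n ↔
    ∀ k ≤ n, ∀ l ≤ n, c + (pre lam (a l) - disp lam π a l) ≤
      pre lam (a k) + lam (a k) - disp lam π a k := by
  constructor
  · intro h k hk l hl
    have h1 : pre lam (a l) - disp lam π a l ≤ cylL lam π a n :=
      Finset.le_sup' (fun k => pre lam (a k) - disp lam π a k) (Finset.mem_range.2 (by omega))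
    have h2 : cylR lam π a n ≤ pre lam (a k) + lam (a k) - disp lam π a k :=
      Finset.inf'_le (fun k => pre lam (a k) + lam (a k) - disp lam π a k)
        (Finset.mem_range.2 (by omega))
    unfold wid at h
    linarith
  · intro h
    obtain ⟨l, hl, h1⟩ := exists_cylL_eq lam π a n
    obtain ⟨k, hk, h2⟩ := exists_cylR_eq lam π a n
    have := h k hk l hl
    unfold wid
    linarith

theorem wid_congr (lam : Fin m → ℝ) (π : Equiv.Perm (Fin m)) {a b : ℕ → Fin m} {n : ℕ}
    (h : ∀ k ≤ n, a k = b k) : wid lam π a n = wid lam π b n := by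
  have key : ∀ {a b : ℕ → Fin m}, (∀ k ≤ n, a k = b k) → wid lam π a n ≤ wid lam π b n := by
    intro a b h
    rw [le_wid_iff]
    intro k hk l hl
    have := le_wid_iff.1 (le_refl (wid lam π a n)) k hk l hl
    rwa [h k hk, h l hl, disp_congr lam π (b := b) (fun j hj => h j (hj.le.trans hk)),
      disp_congr lam π (a := a) (b := b) (fun j hj => h j (hj.le.trans hl))] at this
  exact le_antisymm (key h) (key fun k hk => (h k hk).symm)

theorem pre_add_vec (p q : Fin m → ℝ) (b : Fin m) : pre (p + q) b = pre p b + pre q b := by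
  simp [← preLin_apply]

theorem pre_smul_vec (r : ℝ) (p : Fin m → ℝ) (b : Fin m) : pre (r • p) b = r * pre p b := by
  simp [← preLin_apply]

theorem disp_add_vec (p q : Fin m → ℝ) (a : ℕ → Fin m) (k : ℕ) :
    disp (p + q) π a k = disp p π a k + disp q π a k := by
  simp [disp, ← wvecLin_apply, Finset.sum_add_distrib]

theorem disp_smul_vec (r : ℝ) (p : Fin m → ℝ) (a : ℕ → Fin m) (k : ℕ) :
    disp (r • p) π a k = r * disp p π a k := by
  simp [disp, ← wvecLin_apply, Finset.mul_sum]

theorem wid_add_le (p q : Fin m → ℝ) (a : ℕ → Fin m) (n : ℕ) :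
    wid p π a n + wid q π a n ≤ wid (p + q) π a n := by
  rw [le_wid_iff]
  intro k hk l hl
  have h1 := le_wid_iff.1 (le_refl (wid p π a n)) k hk l hl
  have h2 := le_wid_iff.1 (le_refl (wid q π a n)) k hk l hl
  simp only [pre_add_vec, disp_add_vec, Pi.add_apply]
  linarith

theorem le_wid_smul {r : ℝ} (hr : 0 ≤ r) (p : Fin m → ℝ) (a : ℕ → Fin m) (n : ℕ) :
    r * wid p π a n ≤ wid (r • p) π a n := by
  rw [le_wid_iff]
  intro k hk l hl
  have h1 := le_wid_iff.1 (le_refl (wid p π a n)) k hk l hl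
  simp only [pre_smul_vec, disp_smul_vec, Pi.smul_apply, smul_eq_mul]
  nlinarith

theorem isClosed_le_wid (π : Equiv.Perm (Fin m)) (a : ℕ → Fin m) (n : ℕ) (c : ℝ) :
    IsClosed {lam : Fin m → ℝ | c ≤ wid lam π a n} := by
  simp only [le_wid_iff, ofPred_forall]
  refine isClosed_iInter fun k => isClosed_iInter fun _ => isClosed_iInter fun l =>
    isClosed_iInter fun _ => isClosed_le ?_ ?_
  · unfold disp pre wvec pre
    fun_prop
  · unfold disp pre wvec pre
    fun_prop

theorem mem_cyl_iff (hpos : ∀ j, 0 ≤ lam j) {a : ℕ → Fin m} {n : ℕ} {x : ℝ} :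
    x ∈ Ico (cylL lam π a n) (cylR lam π a n) ↔
      x ∈ base lam ∧ ∀ k ≤ n, itin lam π x k = a k := by
  rw [mem_Ico, cylL_le_iff, lt_cylR_iff]
  constructor
  · rintro ⟨h1, h2⟩
    have h3 : ∀ k < n + 1, x + disp lam π a k ∈ block lam (a k) := fun k hk =>
      ⟨h1 k (by omega), h2 k (by omega)⟩
    refine ⟨?_, fun k hk => (itin_eq_of_forall_mem hpos π h3 k (by omega)).1⟩
    have := h3 0 (by omega)
    simp only [disp, Finset.range_zero, Finset.sum_empty, add_zero] at this
    exact block_subset hpos _ this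
  · rintro ⟨hx, h⟩
    have h3 : ∀ k ≤ n, x + disp lam π a k ∈ block lam (a k) := by
      intro k hk
      have := iterate_mem_block hpos π hx k
      rwa [iterate_eq hpos π hx, h k hk,
        disp_congr lam π (fun j hj => h j (hj.le.trans hk))] at this
    exact ⟨fun k hk => (h3 k hk).1, fun k hk => (h3 k hk).2⟩

theorem wid_itin_pos (hpos : ∀ j, 0 ≤ lam j) {x : ℝ} (hx : x ∈ base lam) (n : ℕ) :
    0 < wid lam π (itin lam π x) n := by
  have := (mem_cyl_iff hpos (π := π) (a := itin lam π x) (n := n)).2 ⟨hx, fun _ _ => rfl⟩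
  have h2 := this.1.trans_lt this.2
  unfold wid
  linarith

theorem exists_itin_of_wid_pos (hpos : ∀ j, 0 ≤ lam j) {a : ℕ → Fin m} {n : ℕ}
    (h : 0 < wid lam π a n) : ∃ x ∈ base lam, ∀ k ≤ n, itin lam π x k = a k := by
  have : cylL lam π a n ∈ Ico (cylL lam π a n) (cylR lam π a n) :=
    ⟨le_rfl, by unfold wid at h; linarith⟩
  obtain ⟨h1, h2⟩ := (mem_cyl_iff hpos).1 this
  exact ⟨_, h1, h2⟩

/-- The admissible words of length `n + 1`. -/
def words (lam : Fin m → ℝ) (π : Equiv.Perm (Fin m)) (n : ℕ) : Finset (Fin (n + 1) → Fin m) :=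
  Finset.univ.filter fun w => 0 < wid lam π (extWord w) n

theorem mem_words {n : ℕ} {w : Fin (n + 1) → Fin m} :
    w ∈ words lam π n ↔ 0 < wid lam π (extWord w) n := by simp [words]

theorem extWord_trunc (a : ℕ → Fin m) {n k : ℕ} (hk : k ≤ n) :
    extWord (fun i : Fin (n + 1) => a i) k = a k := by
  rw [extWord_of_lt _ (Nat.lt_succ_of_le hk)]

theorem wid_extWord_trunc (lam : Fin m → ℝ) (π : Equiv.Perm (Fin m)) (a : ℕ → Fin m) (n : ℕ) :
    wid lam π (extWord (fun i : Fin (n + 1) => a i)) n = wid lam π a n :=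
  wid_congr lam π fun _ hk => extWord_trunc a hk

theorem trunc_mem_words (hpos : ∀ j, 0 ≤ lam j) {x : ℝ} (hx : x ∈ base lam) (n : ℕ) :
    (fun i : Fin (n + 1) => itin lam π x i) ∈ words lam π n := by
  rw [mem_words, wid_extWord_trunc]
  exact wid_itin_pos hpos hx n

theorem sum_words_wid (hpos : ∀ j, 0 ≤ lam j) (n : ℕ) :
    ∑ w ∈ words lam π n, wid lam π (extWord w) n = ∑ i, lam i := by
  have hun : base lam = ⋃ w ∈ words lam π n,
      Ico (cylL lam π (extWord w) n) (cylR lam π (extWord w) n) := by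
    ext x
    simp only [mem_iUnion, mem_cyl_iff hpos]
    constructor
    · intro hx
      exact ⟨_, trunc_mem_words hpos hx n, hx, fun k hk => (extWord_trunc _ hk).symm⟩
    · rintro ⟨w, -, hx, -⟩
      exact hx
  have hv : volume (base lam) = ∑ w ∈ words lam π n, ENNReal.ofReal (wid lam π (extWord w) n) := by
    rw [hun, measure_biUnion_finset]
    · simp only [Real.volume_Ico, wid]
    · intro w _ w' _ hww'
      rw [Function.onFun, Set.disjoint_left]
      intro x hx hx'
      rw [mem_cyl_iff hpos] at hx hx'
      apply hww'
      funext i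
      have h1 := hx.2 i (Nat.lt_succ_iff.1 i.isLt)
      have h2 := hx'.2 i (Nat.lt_succ_iff.1 i.isLt)
      rw [h1, extWord_of_lt _ i.isLt, extWord_of_lt _ i.isLt] at h2
      exact h2
    · exact fun _ _ => measurableSet_Ico
  rw [Real.volume_Ico, sub_zero, ← ENNReal.ofReal_sum_of_nonneg
    (fun w hw => (mem_words.1 hw).le)] at hv
  have h1 : 0 ≤ ∑ i, lam i := Finset.sum_nonneg fun i _ => hpos i
  have h2 : 0 ≤ ∑ w ∈ words lam π n, wid lam π (extWord w) n :=
    Finset.sum_nonneg fun w hw => (mem_words.1 hw).le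
  exact ((ENNReal.ofReal_eq_ofReal_iff h1 h2).1 hv).symm

/-- If the widths of a set of words add up to the total length, there are no other words. -/
theorem words_eq_of_sum_le (hpos : ∀ j, 0 ≤ lam j) {n : ℕ} {W : Finset (Fin (n + 1) → Fin m)}
    (hW : ∀ w ∈ W, 0 < wid lam π (extWord w) n)
    (hsum : ∑ i, lam i ≤ ∑ w ∈ W, wid lam π (extWord w) n) : words lam π n = W := by
  have hsub : W ⊆ words lam π n := fun w hw => mem_words.2 (hW w hw)
  refine (Finset.Subset.antisymm hsub fun w hw => ?_).symm
  by_contra hwW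
  have := Finset.sum_lt_sum_of_subset hsub hw hwW (mem_words.1 hw)
    (fun w hw _ => (mem_words.1 hw).le)
  rw [sum_words_wid hpos] at this
  linarith

end

/-! ### Integer length vectors obtained by counting -/

section

set_option linter.unusedSectionVars false

variable {m : ℕ} [NeZero m] {lam : Fin m → ℝ} {π : Equiv.Perm (Fin m)}

theorem lt_of_block_lt (hpos : ∀ j, 0 ≤ lam j) {x y : ℝ} {i j : Fin m} (hx : x ∈ block lam i)
    (hy : y ∈ block lam j) (hij : i < j) : x < y := by
  rw [mem_block_iff] at hx hy
  have := cum_mono hpos (show (i : ℕ) + 1 ≤ j from hij)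
  linarith

theorem lt_iff_of_mem_block (hpos : ∀ j, 0 ≤ lam j) {x y : ℝ} {i j : Fin m}
    (hx : x ∈ block lam i) (hy : y ∈ block lam j) : x < y ↔ i < j ∨ (i = j ∧ x < y) := by
  constructor
  · intro h
    rcases lt_trichotomy i j with h1 | h1 | h1
    · exact Or.inl h1
    · exact Or.inr ⟨h1, h⟩
    · exact absurd (lt_of_block_lt hpos hy hx h1) (not_lt.2 h.le)
  · rintro (h | ⟨-, h⟩)
    · exact lt_of_block_lt hpos hx hy h
    · exact h

theorem iet_lt_iff (hpos : ∀ j, 0 ≤ lam j) {x y : ℝ} {i j : Fin m}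
    (hx : x ∈ block lam i) (hy : y ∈ block lam j) :
    iet lam π x < iet lam π y ↔ π i < π j ∨ (i = j ∧ x < y) := by
  rw [iet_of_mem hpos π hx, iet_of_mem hpos π hy,
    lt_iff_of_mem_block (lam := lam ∘ π.symm) (fun _ => hpos _) (add_wvec_mem_block.2 hx)
      (add_wvec_mem_block.2 hy), π.injective.eq_iff]
  refine or_congr_right (and_congr_right fun h => ?_)
  rw [h]
  exact add_lt_add_iff_right _

theorem sum_filter_count {p : ℕ} (l : ℕ → Fin m) (S : Fin m → Prop)
    [DecidablePred S] :
    ∑ b ∈ Finset.univ.filter S, (∑ i ∈ Finset.range p, if l i = b then (1 : ℝ) else 0) =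
      ∑ i ∈ Finset.range p, if S (l i) then (1 : ℝ) else 0 := by
  rw [Finset.sum_comm]
  refine Finset.sum_congr rfl fun i _ => ?_
  rw [Finset.sum_ite_eq]
  simp

/-- If the letters of the points `y i` are distributed according to `χ` at all times up to `n`,
then all cylinders have nonnegative width for `χ`, and those of the `y i` have width at least one. -/
theorem wid_count (hpos : ∀ j, 0 ≤ lam j) {p n : ℕ} {y : ℕ → ℝ} (hy : ∀ i, y i ∈ base lam)
    {χ : Fin m → ℝ} (hχ : ∀ k ≤ n, ∀ b, χ b =
      ∑ i ∈ Finset.range p, if itin lam π (y i) k = b then (1 : ℝ) else 0)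
    {x : ℝ} (hx : x ∈ base lam) {δ : ℝ} (hδ : δ = 0 ∨ (δ = 1 ∧ ∃ i < p, y i = x)) :
    δ ≤ wid χ π (itin lam π x) n := by
  set a := itin lam π x with ha
  set Z : ℕ → ℝ := fun k => ∑ i ∈ Finset.range p,
    if (iet lam π)^[k] (y i) < (iet lam π)^[k] x then (1 : ℝ) else 0 with hZ
  set Q : ℕ → ℝ := fun k => ∑ i ∈ Finset.range p,
    if itin lam π (y i) k = a k ∧ (iet lam π)^[k] (y i) < (iet lam π)^[k] x then (1 : ℝ) else 0
    with hQ
  have hZ1 : ∀ k ≤ n, Z k = pre χ (a k) + Q k := by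
    intro k hk
    rw [pre, Finset.sum_congr rfl (fun b _ => hχ k hk b),
      sum_filter_count (fun i => itin lam π (y i) k), hZ, hQ,
      ← Finset.sum_add_distrib]
    refine Finset.sum_congr rfl fun i _ => ?_
    have e := lt_iff_of_mem_block hpos (iterate_mem_block hpos π (hy i) k)
      (iterate_mem_block hpos π hx k)
    rw [← ha] at e
    rcases lt_trichotomy (itin lam π (y i) k) (a k) with h | h | h
    · have h' := e.2 (Or.inl h)
      simp [h, h.ne, h']
    · simp [h]
    · have h' : ¬ (iet lam π)^[k] (y i) < (iet lam π)^[k] x := fun h' => by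
        rcases e.1 h' with h1 | h1
        · exact h.not_gt h1
        · exact h.ne' h1.1
      simp [h.ne', h.le, h']
  have hZ2 : ∀ k ≤ n, Z (k + 1) =
      ∑ b ∈ Finset.univ.filter (fun b => π b < π (a k)), χ b + Q k := by
    intro k hk
    rw [Finset.sum_congr rfl (fun b _ => hχ k hk b),
      sum_filter_count (fun i => itin lam π (y i) k), hZ, hQ,
      ← Finset.sum_add_distrib]
    refine Finset.sum_congr rfl fun i _ => ?_
    simp only [Function.iterate_succ_apply', iet_lt_iff hpos
      (iterate_mem_block hpos π (hy i) k) (iterate_mem_block hpos π hx k), ← ha]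
    rcases lt_trichotomy (π (itin lam π (y i) k)) (π (a k)) with h | h | h
    · have : itin lam π (y i) k ≠ a k := fun e => h.ne (by rw [e])
      simp [h, this]
    · have := π.injective h
      simp [this]
    · have : itin lam π (y i) k ≠ a k := fun e => h.ne' (by rw [e])
      simp [this]
  have hZ3 : ∀ k ≤ n, Z k = Z 0 + disp χ π a k := by
    intro k
    induction k with
    | zero => simp [disp]
    | succ k ih =>
      intro hk
      have h1 := ih (by omega)
      rw [hZ1 k (by omega)] at h1
      rw [disp_succ, hZ2 k (by omega), wvec]
      linarith
  have hQ0 : ∀ k, 0 ≤ Q k := fun k => Finset.sum_nonneg fun i _ => by split_ifs <;> simp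
  have hQ1 : ∀ k ≤ n, Q k + δ ≤ χ (a k) := by
    intro k hk
    rw [hχ k hk]
    have hle : ∀ i ∈ Finset.range p,
        (if itin lam π (y i) k = a k ∧ (iet lam π)^[k] (y i) < (iet lam π)^[k] x then (1 : ℝ) else 0)
        ≤ if itin lam π (y i) k = a k then (1 : ℝ) else 0 := by
      intro i _
      by_cases h1 : itin lam π (y i) k = a k
      · simp only [h1, true_and, if_true]
        split_ifs <;> norm_num
      · simp [h1]
    rcases hδ with rfl | ⟨rfl, i0, hi0, hxy⟩
    · rw [add_zero]
      exact Finset.sum_le_sum hle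
    · rw [← Finset.add_sum_erase _ _ (Finset.mem_range.2 hi0), hQ]
      simp only
      rw [← Finset.add_sum_erase _ _ (Finset.mem_range.2 hi0)]
      simp only [hxy, lt_irrefl, and_false, if_false, ← ha, if_true]
      have := Finset.sum_le_sum fun i (hi : i ∈ (Finset.range p).erase i0) =>
        hle i (Finset.mem_of_mem_erase hi)
      linarith
  rw [le_wid_iff]
  intro k hk l hl
  have h1 := hZ1 k hk
  have h2 := hZ1 l hl
  have h3 := hZ3 k hk
  have h4 := hZ3 l hl
  have h5 := hQ1 k hk
  have h6 := hQ0 l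
  linarith

theorem not_sameCode_card_le (hpos : ∀ j, 0 < lam j) {n p : ℕ} {y : ℕ → ℝ}
    (hy : ∀ i, y i ∈ base lam)
    (hne : ∀ i j, i < j → j < p → ¬ SameCode lam π (n + 1) (y i) (y j)) : p ≤ (n + 1) * m := by
  have hnn : ∀ j, 0 ≤ lam j := fun j => (hpos j).le
  have hL : ∀ i : Fin p, ∃ q : Fin (n + 1) × Fin m, ∃ z ∈ base lam,
      SameCode lam π (n + 1) z (y i) ∧ (iet lam π)^[q.1] z = pre lam q.2 := by
    intro i
    set a := itin lam π (y i)
    obtain ⟨k, hk, he⟩ := exists_cylL_eq lam π a n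
    have hw : 0 < wid lam π a n := wid_itin_pos hnn (hy i) n
    have hmem : cylL lam π a n ∈ Ico (cylL lam π a n) (cylR lam π a n) :=
      ⟨le_rfl, by unfold wid at hw; linarith⟩
    obtain ⟨h1, h2⟩ := (mem_cyl_iff hnn).1 hmem
    refine ⟨(⟨k, by omega⟩, a k), _, h1, fun j hj => h2 j (by omega), ?_⟩
    rw [iterate_eq hnn π h1, disp_congr lam π (fun j hj => h2 j (by simp only at hj; omega))]
    simp only
    linarith
  choose q z hz hzc hzq using hL
  have hinj : Function.Injective q := by
    intro i j hij
    have h1 := hzq i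
    rw [hij, ← hzq j] at h1
    have h2 := (iet_injective hnn π).iterate _ h1
    have h3 : SameCode lam π (n + 1) (y i) (y j) := (hzc i).symm.trans (h2 ▸ hzc j)
    rcases lt_trichotomy (i : ℕ) j with h | h | h
    · exact (hne i j h j.isLt h3).elim
    · exact Fin.ext h
    · exact (hne j i h i.isLt h3.symm).elim
  have := Fintype.card_le_of_injective q hinj
  simpa using this

/-- Closed pseudo-orbits through a given point. -/
def IsLoop (lam : Fin m → ℝ) (π : Equiv.Perm (Fin m)) (n : ℕ) (x : ℝ) (L : ℕ) : Prop :=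
  1 ≤ L ∧ ∃ P : ℕ → ℝ, P 0 = x ∧ P L = x ∧ (∀ i, P i ∈ base lam) ∧
    ∀ i < L, SameCode lam π n (iet lam π (P i)) (P (i + 1))

theorem Generic.exists_loop (h : Generic lam π) (hz : ∀ c : Fin m, (π c : ℕ) = 0 → (c : ℕ) ≠ 0)
    (n : ℕ) {x : ℝ} (hx : x ∈ base lam) : ∃ L, IsLoop lam π n x L := by
  set U : Set ℝ := {z | ∃ L, 1 ≤ L ∧ ∃ P : ℕ → ℝ, P 0 = x ∧ P L = z ∧ (∀ i, P i ∈ base lam) ∧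
    ∀ i < L, SameCode lam π n (iet lam π (P i)) (P (i + 1))} with hU
  refine h.base_subset hz (U := U) (n := n) ?_ ?_ ?_ x hx
  · rintro z hzb z' hzb' hc ⟨L, hL, P, h0, hPL, hb, hs⟩
    refine ⟨L, hL, Function.update P L z', ?_, by simp, ?_, ?_⟩
    · rw [Function.update_of_ne (by omega), h0]
    · intro i
      by_cases hi : i = L
      · simp [hi, hzb']
      · rw [Function.update_of_ne hi]
        exact hb i
    · intro i hi
      rw [Function.update_of_ne hi.ne]
      by_cases hi' : i + 1 = L
      · rw [hi', Function.update_self]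
        have := hs i hi
        rw [hi', hPL] at this
        exact this.trans hc
      · rw [Function.update_of_ne hi']
        exact hs i hi
  · rintro z hzb ⟨L, hL, P, h0, hPL, hb, hs⟩
    refine ⟨L + 1, by omega, Function.update P (L + 1) (iet lam π z), ?_, by simp, ?_, ?_⟩
    · rw [Function.update_of_ne (by omega), h0]
    · intro i
      by_cases hi : i = L + 1
      · rw [hi, Function.update_self]
        exact iet_mem h.nonneg π hzb
      · rw [Function.update_of_ne hi]
        exact hb i
    · intro i hi
      rw [Function.update_of_ne hi.ne]
      by_cases hi' : i = L
      · rw [hi', Function.update_self, hPL]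
        exact fun _ _ => rfl
      · rw [Function.update_of_ne (by omega)]
        exact hs i (by omega)
  · refine ⟨iet lam π x, iet_mem h.nonneg π hx, 1, le_rfl,
      fun i => if i = 0 then x else iet lam π x, by simp, by simp, ?_, ?_⟩
    · intro i
      simp only
      split_ifs
      · exact hx
      · exact iet_mem h.nonneg π hx
    · intro i hi k _
      simp [show i = 0 by omega]

/-- Every point lies on a periodic pseudo-orbit with distinct codes. -/
theorem Generic.exists_simple_loop (h : Generic lam π)
    (hz : ∀ c : Fin m, (π c : ℕ) = 0 → (c : ℕ) ≠ 0) (n : ℕ) {x : ℝ} (hx : x ∈ base lam) :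
    ∃ p : ℕ, 1 ≤ p ∧ ∃ P : ℕ → ℝ, P 0 = x ∧ (∀ i, P i ∈ base lam) ∧ (∀ i, P (i + p) = P i) ∧
      (∀ i, SameCode lam π n (iet lam π (P i)) (P (i + 1))) ∧
      ∀ i j, i < j → j < p → ¬ SameCode lam π n (P i) (P j) := by
  have hex := h.exists_loop hz n hx
  obtain ⟨hL, P, h0, hPL, hb, hs⟩ := Nat.find_spec hex
  have hmin := fun {k} (hk : k < Nat.find hex) => Nat.find_min hex hk
  set L := Nat.find hex with hLdef
  refine ⟨L, hL, fun i => P (i % L), by simp [h0], fun i => hb _, fun i => by simp, ?_, ?_⟩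
  · intro i
    have hlt := Nat.mod_lt i (show L > 0 by omega)
    have hm := hs (i % L) hlt
    simp only
    by_cases hi : i % L + 1 = L
    · rw [hi, hPL, ← h0] at hm
      have : (i + 1) % L = 0 := by
        rw [Nat.add_mod]
        rcases Nat.lt_or_ge 1 L with h1 | h1
        · rw [Nat.mod_eq_of_lt h1, hi, Nat.mod_self]
        · rw [show L = 1 by omega, Nat.mod_one]
      rw [this]
      exact hm
    · have : (i + 1) % L = i % L + 1 := by
        rw [Nat.add_mod, Nat.mod_eq_of_lt (show 1 < L by omega), Nat.mod_eq_of_lt (by omega)]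
      rw [this]
      exact hm
  · intro i j hij hj hc
    simp only [Nat.mod_eq_of_lt hj, Nat.mod_eq_of_lt (hij.trans hj)] at hc
    rcases Nat.eq_zero_or_pos i with rfl | hi
    · rw [h0] at hc
      refine hmin hj ⟨by omega, Function.update P j x, ?_, by simp, ?_, ?_⟩
      · rw [Function.update_of_ne (by omega), h0]
      · intro i
        by_cases hi : i = j
        · simp [hi, hx]
        · rw [Function.update_of_ne hi]
          exact hb i
      · intro i hi
        rw [Function.update_of_ne hi.ne]
        by_cases hi' : i + 1 = j
        · rw [hi', Function.update_self]
          have := hs i (by omega)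
          rw [hi'] at this
          exact this.trans hc.symm
        · rw [Function.update_of_ne hi']
          exact hs i (by omega)
    · refine hmin (k := L - (j - i)) (by omega) ⟨by omega,
        fun t => if t < i then P t else P (t + (j - i)), ?_, ?_, ?_, ?_⟩
      · simp [hi, h0]
      · simp only
        rw [if_neg (by omega), show L - (j - i) + (j - i) = L by omega, hPL]
      · intro t
        simp only
        split_ifs
        · exact hb _
        · exact hb _
      · intro t ht
        simp only
        by_cases h1 : t + 1 < i
        · rw [if_pos h1, if_pos (by omega)]
          exact hs t (by omega)
        · by_cases h2 : t + 1 = i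
          · rw [if_neg h1, if_pos (by omega), show t + 1 + (j - i) = j by omega]
            have := hs t (by omega)
            rw [h2] at this
            exact this.trans hc
          · rw [if_neg h1, if_neg (by omega), show t + 1 + (j - i) = t + (j - i) + 1 by omega]
            exact hs _ (by omega)

theorem sum_range_shift {p : ℕ} {f : ℕ → ℝ} (hf : ∀ i, f (i + p) = f i) (k : ℕ) :
    ∑ i ∈ Finset.range p, f (i + k) = ∑ i ∈ Finset.range p, f i := by
  induction k with
  | zero => simp
  | succ k ih =>
    have h1 := Finset.sum_range_succ' (fun i => f (i + k)) p
    have h2 := Finset.sum_range_succ (fun i => f (i + k)) p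
    simp only [zero_add] at h1
    rw [add_comm p k, hf] at h2
    rw [← ih]
    have e : ∀ i, i + 1 + k = i + (k + 1) := fun i => by ring
    simp only [e] at h1
    linarith

/-- The admissible integer vector attached to a point. -/
theorem Generic.exists_count_vec (h : Generic lam π)
    (hz : ∀ c : Fin m, (π c : ℕ) = 0 → (c : ℕ) ≠ 0) (n : ℕ) {x : ℝ} (hx : x ∈ base lam) :
    ∃ χ : Fin m → ℝ, (∀ j, 0 ≤ χ j) ∧ ∑ j, χ j ≤ (n + 1) * m ∧
      (∀ w ∈ words lam π (n + 1), 0 ≤ wid χ π (extWord w) (n + 1)) ∧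
      1 ≤ wid χ π (itin lam π x) (n + 1) ∧
      ∑ j, χ j ≤ ∑ w ∈ words lam π (n + 1), wid χ π (extWord w) (n + 1) := by
  obtain ⟨p, hp, P, h0, hb, hper, hs, hne⟩ := h.exists_simple_loop hz (n + 1) hx
  have hshift : ∀ k ≤ n + 1, ∀ i, itin lam π (P i) k = itin lam π (P (i + k)) 0 := by
    intro k
    induction k with
    | zero => simp
    | succ k ih =>
      intro hk i
      rw [← itin_iet, hs i k (by omega), ih (by omega), show i + 1 + k = i + (k + 1) by ring]
  set χ : Fin m → ℝ := fun b =>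
    ∑ i ∈ Finset.range p, if itin lam π (P i) 0 = b then (1 : ℝ) else 0 with hχ
  have hχk : ∀ k ≤ n + 1, ∀ b, χ b =
      ∑ i ∈ Finset.range p, if itin lam π (P i) k = b then (1 : ℝ) else 0 := by
    intro k hk b
    simp only [hshift k hk]
    exact (sum_range_shift (f := fun i => if itin lam π (P i) 0 = b then (1 : ℝ) else 0)
      (fun i => by simp only [hper]) k).symm
  have hsum : ∑ j, χ j = p := by
    have := sum_filter_count (p := p) (fun i => itin lam π (P i) 0) (fun _ => True)
    simpa [hχ] using this
  have hnonneg : ∀ w ∈ words lam π (n + 1), 0 ≤ wid χ π (extWord w) (n + 1) := by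
    intro w hw
    obtain ⟨y, hy, hyw⟩ := exists_itin_of_wid_pos h.nonneg (mem_words.1 hw)
    rw [← wid_congr χ π hyw]
    exact wid_count h.nonneg hb hχk hy (Or.inl rfl)
  have hone : ∀ i < p, 1 ≤ wid χ π (itin lam π (P i)) (n + 1) := fun i hi =>
    wid_count h.nonneg hb hχk (hb i) (Or.inr ⟨rfl, i, hi, rfl⟩)
  refine ⟨χ, fun j => Finset.sum_nonneg fun i _ => by split_ifs <;> simp, ?_, hnonneg, ?_, ?_⟩
  · rw [hsum]
    exact_mod_cast not_sameCode_card_le h.pos hb hne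
  · have := hone 0 (by omega)
    rwa [h0] at this
  · set E : Finset (Fin (n + 1 + 1) → Fin m) :=
      (Finset.range p).image fun i => fun k : Fin (n + 1 + 1) => itin lam π (P i) k with hE
    have hEsub : E ⊆ words lam π (n + 1) := by
      intro w hw
      obtain ⟨i, -, rfl⟩ := Finset.mem_image.1 hw
      exact trunc_mem_words h.nonneg (hb i) (n + 1)
    have hinj : Set.InjOn (fun i => fun k : Fin (n + 1 + 1) => itin lam π (P i) k)
        (Finset.range p : Set ℕ) := by
      intro i hi j hj hij
      rw [Finset.mem_coe, Finset.mem_range] at hi hj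
      have hc : SameCode lam π (n + 1) (P i) (P j) := fun k hk =>
        congrFun hij ⟨k, by omega⟩
      rcases lt_trichotomy i j with h1 | h1 | h1
      · exact (hne i j h1 hj hc).elim
      · exact h1
      · exact (hne j i h1 hi hc.symm).elim
    calc ∑ j, χ j = ∑ i ∈ Finset.range p, (1 : ℝ) := by rw [hsum]; simp
      _ ≤ ∑ i ∈ Finset.range p, wid χ π (itin lam π (P i)) (n + 1) :=
        Finset.sum_le_sum fun i hi => hone i (Finset.mem_range.1 hi)
      _ = ∑ w ∈ E, wid χ π (extWord w) (n + 1) := by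
        rw [hE, Finset.sum_image hinj]
        exact Finset.sum_congr rfl fun i _ => (wid_extWord_trunc χ π _ _).symm
      _ ≤ _ := Finset.sum_le_sum_of_subset_of_nonneg hEsub fun w hw _ => hnonneg w hw

end

/-! ### Admissible length vectors -/

section

set_option linter.unusedSectionVars false

variable {m : ℕ} [NeZero m] {lam : Fin m → ℝ} {π : Equiv.Perm (Fin m)}

theorem sameCode_tinv_of_between (hpos : ∀ j, 0 ≤ lam j) {x y q : ℝ} {n : ℕ} (hx : x ∈ base lam)
    (hy : y ∈ base lam) (hxy : SameCode lam π n x y)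
    (hq : ((iet lam π)^[n] x ≤ q ∧ q ≤ (iet lam π)^[n] y) ∨
      ((iet lam π)^[n] y ≤ q ∧ q ≤ (iet lam π)^[n] x)) :
    SameCode lam π n x ((tinv lam π)^[n] q) := by
  have hd := iterate_sub_of_itin_eq hpos π hx hy hxy
  obtain ⟨z, hzq⟩ : ∃ z, z = x + (q - (iet lam π)^[n] x) := ⟨_, rfl⟩
  have key : z ∈ base lam ∧ SameCode lam π n x z := by
    rcases hq with ⟨h1, h2⟩ | ⟨h1, h2⟩
    · have h3 : x ≤ z := by linarith
      have h4 : z ≤ y := by linarith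
      exact ⟨⟨hx.1.trans h3, h4.trans_lt hy.2⟩,
        fun k hk => (itin_eq_of_between hpos π hx hy hxy h3 h4 k hk).symm⟩
    · have h3 : y ≤ z := by linarith
      have h4 : z ≤ x := by linarith
      exact ⟨⟨hy.1.trans h3, h4.trans_lt hx.2⟩,
        fun k hk => (hxy k hk).trans
          (itin_eq_of_between hpos π hy hx (SameCode.symm hxy) h3 h4 k hk).symm⟩
  have h5 := iterate_sub_of_itin_eq hpos π hx key.1 key.2
  have h6 : (iet lam π)^[n] z = q := by linarith
  rw [← h6, tinv_iterate_iterate hpos π key.1]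
  exact key.2

theorem Generic.exists_special (h : Generic lam π) {x y : ℝ} {n : ℕ} (hx : x ∈ base lam)
    (hy : y ∈ base lam) (hxy : SameCode lam π n x y) (hne : itin lam π x n ≠ itin lam π y n) :
    ∃ c : Fin m, (c : ℕ) ≠ 0 ∧ SameCode lam π n x ((tinv lam π)^[n] (pre lam c)) ∧
      (itin lam π x n = c ∨ (itin lam π x n : ℕ) + 1 = c) := by
  have hx' := iterate_mem_block h.nonneg π hx n
  have hy' := iterate_mem_block h.nonneg π hy n
  have hpre : ∀ {b c : Fin m}, b ≤ c → pre lam b ≤ pre lam c := fun {b c} hbc => by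
    rw [pre_eq_cum, pre_eq_cum]; exact cum_mono h.nonneg hbc
  rcases lt_or_gt_of_ne hne with hlt | hlt
  · have hc : (itin lam π x n : ℕ) + 1 < m := lt_of_le_of_lt hlt (itin lam π y n).2
    refine ⟨⟨_, hc⟩, by simp, ?_, Or.inr rfl⟩
    refine sameCode_tinv_of_between h.nonneg hx hy hxy (Or.inl ⟨?_, ?_⟩)
    · rw [mem_block_iff] at hx'
      rw [pre_eq_cum]
      exact hx'.2.le
    · exact (hpre (show (⟨_, hc⟩ : Fin m) ≤ itin lam π y n from hlt)).trans hy'.1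
  · refine ⟨itin lam π x n, ?_, ?_, Or.inl rfl⟩
    · have : (itin lam π y n : ℕ) < itin lam π x n := hlt
      omega
    refine sameCode_tinv_of_between h.nonneg hx hy hxy (Or.inr ⟨?_, hx'.1⟩)
    rw [mem_block_iff] at hy'
    refine hy'.2.le.trans ?_
    rw [pre_eq_cum]
    exact cum_mono h.nonneg hlt

/-- Vectors that are compatible with the words of length `n + 1` of `lam`. -/
structure Adm (lam : Fin m → ℝ) (π : Equiv.Perm (Fin m)) (n : ℕ) (χ : Fin m → ℝ) : Prop where
  nonneg : ∀ j, 0 ≤ χ j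
  wid_nonneg : ∀ w ∈ words lam π n, 0 ≤ wid χ π (extWord w) n
  sum_le : ∑ j, χ j ≤ ∑ w ∈ words lam π n, wid χ π (extWord w) n

theorem Adm.add {n : ℕ} {χ ψ : Fin m → ℝ} (h : Adm lam π n χ) (h' : Adm lam π n ψ) :
    Adm lam π n (χ + ψ) where
  nonneg j := add_nonneg (h.nonneg j) (h'.nonneg j)
  wid_nonneg w hw := (add_nonneg (h.wid_nonneg w hw) (h'.wid_nonneg w hw)).trans
    (wid_add_le _ _ _ _)
  sum_le := by
    simp only [Pi.add_apply, Finset.sum_add_distrib]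
    refine (add_le_add h.sum_le h'.sum_le).trans ?_
    rw [← Finset.sum_add_distrib]
    exact Finset.sum_le_sum fun w _ => wid_add_le _ _ _ _

theorem zero_le_wid_zero (a : ℕ → Fin m) (n : ℕ) : 0 ≤ wid (0 : Fin m → ℝ) π a n := by
  have := le_wid_smul (π := π) (le_refl (0 : ℝ)) (0 : Fin m → ℝ) a n
  simpa using this

theorem adm_zero (n : ℕ) : Adm lam π n 0 where
  nonneg _ := le_rfl
  wid_nonneg _ _ := zero_le_wid_zero _ _
  sum_le := by
    simpa using Finset.sum_nonneg fun w _ => zero_le_wid_zero _ _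

theorem Adm.sum {ι : Type*} {n : ℕ} {χ : ι → Fin m → ℝ} (s : Finset ι)
    (h : ∀ i ∈ s, Adm lam π n (χ i)) : Adm lam π n (∑ i ∈ s, χ i) := by
  induction s using Finset.induction_on with
  | empty => simpa using adm_zero n
  | insert i s hi ih =>
    rw [Finset.sum_insert hi]
    exact (h i (by simp)).add (ih fun j hj => h j (by simp [hj]))

theorem Adm.wid_itin_nonneg {n : ℕ} {χ : Fin m → ℝ} (h : Adm lam π n χ) (hpos : ∀ j, 0 ≤ lam j)
    {x : ℝ} (hx : x ∈ base lam) : 0 ≤ wid χ π (itin lam π x) n := by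
  rw [← wid_extWord_trunc]
  exact h.wid_nonneg _ (trunc_mem_words hpos hx n)

theorem adm_smul_self (hpos : ∀ j, 0 ≤ lam j) {r : ℝ} (hr : 0 ≤ r) (n : ℕ) :
    Adm lam π n (r • lam) where
  nonneg j := mul_nonneg hr (hpos j)
  wid_nonneg w hw := (mul_nonneg hr (mem_words.1 hw).le).trans (le_wid_smul hr _ _ _)
  sum_le := by
    simp only [Pi.smul_apply, smul_eq_mul]
    rw [← Finset.mul_sum, ← sum_words_wid (π := π) hpos n, Finset.mul_sum]
    exact Finset.sum_le_sum fun w _ => le_wid_smul hr _ _ _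

/-- A vector whose cylinders are all wide around the preimages of the discontinuity `pre lam c`. -/
theorem Generic.exists_special_vec (h : Generic lam π)
    (hz : ∀ c : Fin m, (π c : ℕ) = 0 → (c : ℕ) ≠ 0) (n : ℕ) (c : Fin m) :
    ∃ χ : Fin m → ℝ, Adm lam π (n + 1) χ ∧ ∑ j, χ j ≤ 2 * ((n + 1) * m) ∧
      ((c : ℕ) ≠ 0 → ∀ x ∈ base lam, SameCode lam π (n + 1) x ((tinv lam π)^[n + 1] (pre lam c)) →
        (itin lam π x (n + 1) = c ∨ (itin lam π x (n + 1) : ℕ) + 1 = c) →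
        1 ≤ wid χ π (itin lam π x) (n + 1)) := by
  by_cases hc : (c : ℕ) = 0
  · refine ⟨0, adm_zero _, ?_, fun h => absurd hc h⟩
    simp only [Pi.zero_apply, Finset.sum_const_zero]
    positivity
  obtain ⟨b, hb⟩ : ∃ b : Fin m, (b : ℕ) + 1 = c := ⟨⟨(c : ℕ) - 1, by omega⟩, by simp; omega⟩
  obtain ⟨t, ht, hs⟩ := h.exists_left_shadow_iterate hc (n + 1)
  obtain ⟨s, hs0, hst, hsb⟩ : ∃ s, 0 < s ∧ s < t ∧ s ≤ lam b := by
    refine ⟨min (t / 2) (lam b), lt_min (by linarith) (h.pos b), ?_, min_le_right _ _⟩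
    exact (min_le_left _ _).trans_lt (by linarith)
  obtain ⟨hs1, hs2, hs3⟩ := hs s hs0.le hst (n + 1) 0 le_rfl
  rw [add_zero] at hs1 hs2 hs3
  rw [Function.iterate_zero, id] at hs1
  have hs3 := hs3 (by omega)
  obtain ⟨y, hy⟩ : ∃ y, y = (tinv lam π)^[n + 1] (pre lam c) := ⟨_, rfl⟩
  rw [← hy] at hs1 hs2 hs3 ⊢
  have hyb : y ∈ base lam := hy ▸ tinv_iterate_mem h.nonneg π (pre_mem_base h.pos c) _
  have hyc : (iet lam π)^[n + 1] y = pre lam c := by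
    rw [hy]; exact iterate_tinv_iterate h.nonneg π (pre_mem_base h.pos c) (n + 1) 0
  have hl1 : itin lam π y (n + 1) = c := by
    unfold itin; rw [hyc]; exact letter_eq h.nonneg (pre_mem_block h.pos c)
  have hl2 : itin lam π (y - s) (n + 1) = b := by
    unfold itin; rw [hs1]; exact letter_eq h.nonneg (pre_sub_mem_block hb hs0 hsb)
  obtain ⟨χ₁, a1, a2, a3, a4, a5⟩ := h.exists_count_vec hz n hyb
  obtain ⟨χ₂, b1, b2, b3, b4, b5⟩ := h.exists_count_vec hz n hs3
  have A1 : Adm lam π (n + 1) χ₁ := ⟨a1, a3, a5⟩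
  have A2 : Adm lam π (n + 1) χ₂ := ⟨b1, b3, b5⟩
  refine ⟨χ₁ + χ₂, A1.add A2, ?_, ?_⟩
  · simp only [Pi.add_apply, Finset.sum_add_distrib]
    linarith
  rintro - x hx hsc hlet
  refine le_trans ?_ (wid_add_le _ _ _ _)
  have w1 := A1.wid_itin_nonneg h.nonneg hx
  have w2 := A2.wid_itin_nonneg h.nonneg hx
  rcases hlet with hlet | hlet
  · have : wid χ₁ π (itin lam π x) (n + 1) = wid χ₁ π (itin lam π y) (n + 1) := by
      refine wid_congr _ _ fun k hk => ?_
      rcases hk.lt_or_eq with hk | rfl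
      · exact hsc k hk
      · rw [hlet, hl1]
    linarith
  · have : wid χ₂ π (itin lam π x) (n + 1) = wid χ₂ π (itin lam π (y - s)) (n + 1) := by
      refine wid_congr _ _ fun k hk => ?_
      rcases hk.lt_or_eq with hk | rfl
      · exact (hsc k hk).trans (hs2 k hk).symm
      · rw [hl2]; exact Fin.ext (by omega)
    linarith

/-- Along an unbranched step, the widths of the cylinders of a compatible vector increase. -/
theorem wid_le_of_unbranched (hpos : ∀ j, 0 ≤ lam j) {p : Fin m → ℝ} (hp : ∀ j, 0 ≤ p j) {n : ℕ}
    (hw : words p π (n + 1) = words lam π (n + 1)) {x : ℝ}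
    (hwx : 0 < wid p π (itin lam π x) (n + 1))
    (hub : ∀ y ∈ base lam, SameCode lam π (n + 1) (iet lam π x) y →
      itin lam π (iet lam π x) (n + 1) = itin lam π y (n + 1)) :
    wid p π (itin lam π x) (n + 1) ≤ wid p π (itin lam π (iet lam π x)) (n + 1) := by
  obtain ⟨a, ha⟩ : ∃ a, a = itin lam π x := ⟨_, rfl⟩
  obtain ⟨a', ha'⟩ : ∃ a', a' = itin lam π (iet lam π x) := ⟨_, rfl⟩
  have hshift : ∀ k, a' k = a (k + 1) := fun k => by rw [ha, ha']; exact itin_iet lam π x k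
  rw [← ha] at hwx
  rw [← ha, ← ha']
  have key : ∀ y ∈ Ico (cylL p π a (n + 1)) (cylR p π a (n + 1)),
      y + wvec p π (a 0) ∈ Ico (cylL p π a' (n + 1)) (cylR p π a' (n + 1)) := by
    intro y hy
    rw [mem_cyl_iff hp] at hy
    have hTy : y + wvec p π (a 0) = iet p π y := by
      rw [iet_of_mem hp π (j := a 0)]
      have := iterate_mem_block hp π hy.1 0
      rwa [hy.2 0 (by omega)] at this
    rw [hTy, mem_cyl_iff hp]
    have hTb := iet_mem hp π hy.1
    refine ⟨hTb, ?_⟩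
    have h1 := trunc_mem_words (π := π) hp hTb (n + 1)
    rw [hw, mem_words, wid_extWord_trunc] at h1
    obtain ⟨z, hz, hzk⟩ := exists_itin_of_wid_pos hpos h1
    have h2 : ∀ k < n + 1, a' k = itin p π (iet p π y) k := fun k hk => by
      rw [itin_iet, hy.2 (k + 1) (by omega), hshift]
    have h3 := hub z hz fun k hk => by
      rw [← ha', hzk k hk.le, h2 k hk]
    intro k hk
    rcases hk.lt_or_eq with hk | rfl
    · exact (h2 k hk).symm
    · rw [ha', h3, hzk _ le_rfl]
  have hLR : cylL p π a (n + 1) < cylR p π a (n + 1) := sub_pos.1 hwx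
  have hsub : Ico (cylL p π a (n + 1) + wvec p π (a 0)) (cylR p π a (n + 1) + wvec p π (a 0)) ⊆
      Ico (cylL p π a' (n + 1)) (cylR p π a' (n + 1)) := fun y hy => by
    have := key (y - wvec p π (a 0)) ⟨by linarith [hy.1], by linarith [hy.2]⟩
    simpa using this
  rw [Set.Ico_subset_Ico_iff (by linarith)] at hsub
  unfold wid
  linarith [hsub.1, hsub.2]

theorem Generic.exists_wide_vec (h : Generic lam π) (hm : 2 ≤ m)
    (hz : ∀ c : Fin m, (π c : ℕ) = 0 → (c : ℕ) ≠ 0) (n : ℕ) :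
    ∃ p : Fin m → ℝ, (∀ j, 0 < p j) ∧ ∑ j, p j ≤ 1 + m * (2 * ((n + 1) * m)) ∧
      words p π (n + 1) = words lam π (n + 1) ∧
      ∀ w ∈ words lam π (n + 1), 1 ≤ wid p π (extWord w) (n + 1) := by
  choose χ hχ1 hχ2 hχ3 using fun c => h.exists_special_vec hz n c
  have hsum : 0 < ∑ j, lam j := Finset.sum_pos (fun j _ => h.pos j) Finset.univ_nonempty
  have hr : 0 < (∑ j, lam j)⁻¹ := inv_pos.2 hsum
  have hA0 := adm_smul_self (π := π) h.nonneg hr.le (n + 1)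
  have hA1 : Adm lam π (n + 1) (∑ c, χ c) := Adm.sum _ fun c _ => hχ1 c
  obtain ⟨p, hp⟩ : ∃ p, p = (∑ j, lam j)⁻¹ • lam + ∑ c, χ c := ⟨_, rfl⟩
  have hA : Adm lam π (n + 1) p := hp ▸ hA0.add hA1
  have hpos : ∀ j, 0 < p j := fun j => by
    rw [hp]
    exact add_pos_of_pos_of_nonneg (mul_pos hr (h.pos j)) (hA1.nonneg j)
  have hwords : words p π (n + 1) = words lam π (n + 1) := by
    refine words_eq_of_sum_le hA.nonneg (fun w hw => ?_) hA.sum_le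
    rw [hp]
    refine lt_of_lt_of_le ?_ (wid_add_le _ _ _ _)
    exact add_pos_of_pos_of_nonneg
      ((mul_pos hr (mem_words.1 hw)).trans_le (le_wid_smul hr.le _ _ _)) (hA1.wid_nonneg w hw)
  have hspec : ∀ x ∈ base lam, ∀ c : Fin m, (c : ℕ) ≠ 0 →
      SameCode lam π (n + 1) x ((tinv lam π)^[n + 1] (pre lam c)) →
      (itin lam π x (n + 1) = c ∨ (itin lam π x (n + 1) : ℕ) + 1 = c) →
      1 ≤ wid p π (itin lam π x) (n + 1) := by
    intro x hx c hc h1 h2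
    have h3 := hχ3 c hc x hx h1 h2
    have h4 : Adm lam π (n + 1) ((∑ j, lam j)⁻¹ • lam + ∑ c' ∈ Finset.univ.erase c, χ c') :=
      hA0.add (Adm.sum _ fun c _ => hχ1 c)
    have h5 : p = χ c + ((∑ j, lam j)⁻¹ • lam + ∑ c' ∈ Finset.univ.erase c, χ c') := by
      rw [hp, ← Finset.add_sum_erase _ χ (Finset.mem_univ c)]; abel
    rw [h5]
    have := h4.wid_itin_nonneg h.nonneg hx
    exact le_trans (by linarith) (wid_add_le _ _ _ _)
  refine ⟨p, hpos, ?_, hwords, ?_⟩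
  · rw [hp]
    simp only [Pi.add_apply, Pi.smul_apply, smul_eq_mul, Finset.sum_add_distrib, Finset.sum_apply]
    rw [← Finset.mul_sum, inv_mul_cancel₀ hsum.ne', Finset.sum_comm]
    have : ∑ c : Fin m, ∑ j, χ c j ≤ ∑ c : Fin m, (2 * ((n + 1) * m) : ℝ) :=
      Finset.sum_le_sum fun c _ => hχ2 c
    simp only [Finset.sum_const, Finset.card_univ, Fintype.card_fin, nsmul_eq_mul] at this
    linarith
  obtain ⟨c, hc⟩ : ∃ c : Fin m, (c : ℕ) ≠ 0 := ⟨⟨1, hm⟩, by simp⟩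
  have hyb := tinv_iterate_mem h.nonneg π (pre_mem_base h.pos c) (n + 1)
  have hyc : itin lam π ((tinv lam π)^[n + 1] (pre lam c)) (n + 1) = c := by
    unfold itin
    have := iterate_tinv_iterate h.nonneg π (pre_mem_base h.pos c) (n + 1) 0
    rw [add_zero] at this
    rw [this]
    exact letter_eq h.nonneg (pre_mem_block h.pos c)
  have hall := h.base_subset (n := n + 2) (U := {x | 1 ≤ wid p π (itin lam π x) (n + 1)}) hz
    (fun x hx y hy hxy hxU => by
      have : wid p π (itin lam π y) (n + 1) = wid p π (itin lam π x) (n + 1) :=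
        wid_congr _ _ fun k hk => (hxy k (by omega)).symm
      simpa [this] using hxU)
    (fun x hx hxU => by
      by_cases hub : ∀ y ∈ base lam, SameCode lam π (n + 1) (iet lam π x) y →
          itin lam π (iet lam π x) (n + 1) = itin lam π y (n + 1)
      · have hxU : 1 ≤ wid p π (itin lam π x) (n + 1) := hxU
        exact hxU.trans (wid_le_of_unbranched h.nonneg (fun j => (hpos j).le) hwords
          (by linarith) hub)
      · push Not at hub
        obtain ⟨y, hy, hxy, hne⟩ := hub
        have hTx := iet_mem h.nonneg π hx
        obtain ⟨c, hc, h1, h2⟩ := h.exists_special hTx hy hxy hne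
        exact hspec _ hTx c hc h1 h2)
    ⟨_, hyb, hspec _ hyb c hc (fun _ _ => rfl) (Or.inl hyc)⟩
  intro w hw
  obtain ⟨x, hx, hxw⟩ := exists_itin_of_wid_pos h.nonneg (mem_words.1 hw)
  rw [← wid_congr p π hxw]
  exact hall x hx

end

/-! ### For almost every length vector, all cylinders of some length `n` have width `≥ ε / n` -/

section

set_option linter.unusedSectionVars false

variable {m : ℕ} [NeZero m] {lam : Fin m → ℝ} {π : Equiv.Perm (Fin m)}

theorem measurable_wid (π : Equiv.Perm (Fin m)) (a : ℕ → Fin m) (n : ℕ) :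
    Measurable fun lam : Fin m → ℝ => wid lam π a n :=
  measurable_of_Ici fun c => (isClosed_le_wid π a n c).measurableSet

/-- Positive vectors of total length less than `R`. -/
def simplexBelow (m : ℕ) (R : ℝ) : Set (Fin m → ℝ) := {lam | (∀ j, 0 < lam j) ∧ ∑ j, lam j < R}

theorem measurableSet_simplexBelow (m : ℕ) (R : ℝ) : MeasurableSet (simplexBelow m R) := by
  refine MeasurableSet.inter ?_ ?_
  · have : {lam : Fin m → ℝ | ∀ j, 0 < lam j} = ⋂ j, {lam | 0 < lam j} := by ext; simp
    rw [show (fun lam : Fin m → ℝ => ∀ j, 0 < lam j) = {lam : Fin m → ℝ | ∀ j, 0 < lam j} from rfl,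
      this]
    exact MeasurableSet.iInter fun j => measurableSet_lt measurable_const (measurable_pi_apply j)
  · exact measurableSet_lt (f := fun lam : Fin m → ℝ => ∑ j, lam j) (by fun_prop) measurable_const

theorem volume_simplexBelow_lt_top (m : ℕ) (R : ℝ) : volume (simplexBelow m R) < ⊤ := by
  refine (measure_mono (t := Icc (0 : Fin m → ℝ) (fun _ => R)) fun lam hl => ?_).trans_lt
    isCompact_Icc.measure_lt_top
  refine ⟨fun j => (hl.1 j).le, fun j => ?_⟩
  exact (Finset.single_le_sum (fun i _ => (hl.1 i).le) (Finset.mem_univ j)).trans hl.2.le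

/-- The length vectors with a prescribed set of words of length `n + 1`. -/
def cell (π : Equiv.Perm (Fin m)) (R : ℝ) (n : ℕ) (W : Finset (Fin (n + 1) → Fin m)) :
    Set (Fin m → ℝ) := {lam | lam ∈ simplexBelow m R ∧ words lam π n = W}

theorem measurableSet_cell (π : Equiv.Perm (Fin m)) (R : ℝ) (n : ℕ)
    (W : Finset (Fin (n + 1) → Fin m)) : MeasurableSet (cell π R n W) := by
  refine (measurableSet_simplexBelow m R).inter ?_
  have : {lam : Fin m → ℝ | words lam π n = W} =
      ⋂ w, {lam | 0 < wid lam π (extWord w) n ↔ w ∈ W} := by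
    ext lam
    simp only [mem_ofPred_eq, mem_iInter, Finset.ext_iff, mem_words]
  rw [show (fun lam : Fin m → ℝ => words lam π n = W) = {lam | words lam π n = W} from rfl, this]
  refine MeasurableSet.iInter fun w => ?_
  have h1 : MeasurableSet {lam : Fin m → ℝ | 0 < wid lam π (extWord w) n} :=
    measurableSet_lt measurable_const (measurable_wid π _ n)
  by_cases hw : w ∈ W
  · simpa [hw] using h1
  · have := h1.compl
    simpa [hw, compl_ofPred] using this

theorem volume_cell_narrow_le {R θ : ℝ} (hR : 0 < R) (hθ : 0 < θ) (hθ1 : θ < 1) {n : ℕ}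
    {W : Finset (Fin (n + 1) → Fin m)} {p : Fin m → ℝ} (hp : ∀ j, 0 < p j) {P : ℝ} (hP : 0 < P)
    (hpP : ∑ j, p j ≤ P) (hpW : words p π n = W) (hwide : ∀ w ∈ W, 1 ≤ wid p π (extWord w) n) :
    volume (cell π R n W ∩ {lam | ∃ w ∈ W, wid lam π (extWord w) n < θ * (R / P)}) ≤
      ENNReal.ofReal (m * θ) * volume (cell π R n W) := by
  obtain ⟨K, hK⟩ : ∃ K, K = cell π R n W := ⟨_, rfl⟩
  obtain ⟨B, hB⟩ : ∃ B, B = K ∩ {lam | ∃ w ∈ W, wid lam π (extWord w) n < θ * (R / P)} := ⟨_, rfl⟩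
  obtain ⟨q, hq⟩ : ∃ q, q = (R / P) • p := ⟨_, rfl⟩
  have hRP : 0 < R / P := div_pos hR hP
  have himg : AffineMap.homothety q (1 - θ) '' K ⊆ K \ B := by
    rintro _ ⟨lam, hl, rfl⟩
    rw [hK] at hl
    obtain ⟨⟨hl1, hl2⟩, hl3⟩ := hl
    obtain ⟨μ, hμ⟩ : ∃ μ, μ = (1 - θ) • lam + (θ * (R / P)) • p := ⟨_, rfl⟩
    have hμ' : AffineMap.homothety q (1 - θ) lam = μ := by
      rw [AffineMap.homothety_apply, hμ, hq]
      simp only [vsub_eq_sub, vadd_eq_add]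
      ext j
      simp only [Pi.add_apply, Pi.smul_apply, Pi.sub_apply, smul_eq_mul]
      ring
    rw [hμ']
    have hμs : ∑ j, μ j = (1 - θ) * ∑ j, lam j + θ * (R / P) * ∑ j, p j := by
      rw [hμ]
      simp only [Pi.add_apply, Pi.smul_apply, smul_eq_mul, Finset.sum_add_distrib, Finset.mul_sum]
    have hμ0 : ∀ j, 0 < μ j := fun j => by
      rw [hμ]
      exact add_pos (mul_pos (by linarith) (hl1 j)) (mul_pos (by positivity) (hp j))
    have hw1 : ∀ w : Fin (n + 1) → Fin m, (1 - θ) * wid lam π (extWord w) n + θ * (R / P) * wid p π (extWord w) n ≤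
        wid μ π (extWord w) n := fun w => by
      rw [hμ]
      exact (add_le_add (le_wid_smul (by linarith) _ _ _) (le_wid_smul (by positivity) _ _ _)).trans
        (wid_add_le _ _ _ _)
    have hw2 : ∀ w ∈ W, θ * (R / P) < wid μ π (extWord w) n := fun w hw => by
      have h1 := hwide w hw
      have h2 : 0 < wid lam π (extWord w) n := mem_words.1 (hl3.symm ▸ hw)
      have h3 : θ * (R / P) * 1 ≤ θ * (R / P) * wid p π (extWord w) n :=
        mul_le_mul_of_nonneg_left h1 (by positivity)
      have h4 : 0 < (1 - θ) * wid lam π (extWord w) n := mul_pos (by linarith) h2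
      linarith [hw1 w]
    have hwords : words μ π n = W := by
      refine words_eq_of_sum_le (fun j => (hμ0 j).le)
        (fun w hw => lt_trans (by positivity) (hw2 w hw)) ?_
      rw [hμs, ← sum_words_wid (π := π) (fun j => (hl1 j).le) n, hl3,
        ← sum_words_wid (π := π) (fun j => (hp j).le) n, hpW, Finset.mul_sum, Finset.mul_sum,
        ← Finset.sum_add_distrib]
      exact Finset.sum_le_sum fun w _ => hw1 w
    have hμR : ∑ j, μ j < R := by
      rw [hμs]
      have h1 : (1 - θ) * ∑ j, lam j < (1 - θ) * R := mul_lt_mul_of_pos_left hl2 (by linarith)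
      have h2 : θ * (R / P) * ∑ j, p j ≤ θ * (R / P) * P :=
        mul_le_mul_of_nonneg_left hpP (by positivity)
      have h3 : θ * (R / P) * P = θ * R := by field_simp
      linarith
    refine ⟨hK ▸ ⟨⟨hμ0, hμR⟩, hwords⟩, fun hb => ?_⟩
    rw [hB] at hb
    obtain ⟨w, hw, hlt⟩ := hb.2
    exact absurd hlt (hw2 w hw).le.not_gt
  have hKfin : volume K ≠ ⊤ :=
    ((measure_mono fun l hl => (hK ▸ hl : l ∈ cell π R n W).1).trans_lt
      (volume_simplexBelow_lt_top m R)).ne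
  have hBK : B ⊆ K := hB ▸ inter_subset_left
  have hBm : MeasurableSet B := by
    rw [hB, hK]
    refine (measurableSet_cell π R n W).inter ?_
    have : {lam : Fin m → ℝ | ∃ w ∈ W, wid lam π (extWord w) n < θ * (R / P)} =
        ⋃ w ∈ W, {lam | wid lam π (extWord w) n < θ * (R / P)} := by
      ext; simp
    rw [this]
    exact Finset.measurableSet_biUnion _ fun w _ =>
      measurableSet_lt (measurable_wid π _ n) measurable_const
  have hvol := measure_mono (μ := volume) himg
  rw [Measure.addHaar_image_homothety, measure_sdiff hBK hBm.nullMeasurableSet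
    (ne_top_of_le_ne_top hKfin (measure_mono hBK)), Module.finrank_fin_fun,
    abs_of_nonneg (pow_nonneg (by linarith) m)] at hvol
  rw [← hK, ← hB]
  have hbern : 1 - m * θ ≤ (1 - θ) ^ m := by
    have := one_add_mul_le_pow (a := -θ) (by linarith) m
    have h2 : (1 : ℝ) + -θ = 1 - θ := by ring
    rw [h2] at this
    linarith
  have hBfin : volume B ≠ ⊤ := ne_top_of_le_ne_top hKfin (measure_mono hBK)
  have e1 : volume K = ENNReal.ofReal (volume K).toReal := (ENNReal.ofReal_toReal hKfin).symm
  have e2 : volume B = ENNReal.ofReal (volume B).toReal := (ENNReal.ofReal_toReal hBfin).symm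
  have hBK' : (volume B).toReal ≤ (volume K).toReal :=
    ENNReal.toReal_mono hKfin (measure_mono hBK)
  rw [e1, e2, ← ENNReal.ofReal_sub _ ENNReal.toReal_nonneg,
    ← ENNReal.ofReal_mul (pow_nonneg (by linarith) m),
    ENNReal.ofReal_le_ofReal_iff (sub_nonneg.2 hBK')] at hvol
  rw [e1, e2, ← ENNReal.ofReal_mul (by positivity)]
  refine ENNReal.ofReal_le_ofReal ?_
  have := mul_le_mul_of_nonneg_right hbern (ENNReal.toReal_nonneg (a := volume K))
  linarith

/-- The generic length vectors with a narrow cylinder of length `n + 2`. -/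
def narrow (π : Equiv.Perm (Fin m)) (R θ : ℝ) (n : ℕ) : Set (Fin m → ℝ) :=
  {lam | Generic lam π ∧ ∑ j, lam j < R ∧ ∃ w ∈ words lam π (n + 1),
    wid lam π (extWord w) (n + 1) < θ * (R / (1 + m * (2 * ((n + 1) * m))))}

theorem volume_narrow_le (hm : 2 ≤ m) (hz : ∀ c : Fin m, (π c : ℕ) = 0 → (c : ℕ) ≠ 0)
    {R θ : ℝ} (hR : 0 < R) (hθ : 0 < θ) (hθ1 : θ < 1) (n : ℕ) :
    volume (narrow π R θ n) ≤ ENNReal.ofReal (m * θ) * volume (simplexBelow m R) := by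
  have hcov : narrow π R θ n ⊆ ⋃ W ∈ (Finset.univ : Finset (Finset (Fin (n + 1 + 1) → Fin m))),
      (narrow π R θ n ∩ cell π R (n + 1) W) := fun lam hl => by
    simp only [Finset.mem_univ, iUnion_true, mem_iUnion]
    exact ⟨words lam π (n + 1), hl, ⟨hl.1.pos, hl.2.1⟩, rfl⟩
  have hcell : ∀ W, volume (narrow π R θ n ∩ cell π R (n + 1) W) ≤
      ENNReal.ofReal (m * θ) * volume (cell π R (n + 1) W) := by
    intro W
    rcases (narrow π R θ n ∩ cell π R (n + 1) W).eq_empty_or_nonempty with he | ⟨lam, hl1, hl2⟩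
    · simp [he]
    obtain ⟨p, h1, h2, h3, h4⟩ := hl1.1.exists_wide_vec hm hz n
    have h5 : words lam π (n + 1) = W := hl2.2
    rw [h5] at h3 h4
    refine (measure_mono fun μ hμ => ?_).trans
      (volume_cell_narrow_le hR hθ hθ1 h1 (by positivity) h2 h3 h4)
    refine ⟨hμ.2, ?_⟩
    have h6 : words μ π (n + 1) = W := hμ.2.2
    have h7 := hμ.1.2.2
    rwa [h6] at h7
  refine (measure_mono hcov).trans ((measure_biUnion_finset_le _ _).trans
    ((Finset.sum_le_sum fun W _ => hcell W).trans ?_))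
  rw [← Finset.mul_sum, ← measure_biUnion_finset]
  · refine mul_le_mul_right (measure_mono ?_) _
    exact iUnion₂_subset fun W _ lam hl => hl.1
  · intro W _ W' _ hne
    exact Set.disjoint_left.2 fun lam h1 h2 => hne (h1.2.symm.trans h2.2)
  · exact fun W _ => measurableSet_cell π R _ W

/-- The cylinders of `T_{(λ,π)}` are infinitely often of width at least `ε / n`. -/
def WideCylinders (lam : Fin m → ℝ) (π : Equiv.Perm (Fin m)) : Prop :=
  ∃ ε > 0, ∀ N : ℕ, ∃ n ≥ N, ∀ x ∈ base lam, ε / n ≤ wid lam π (itin lam π x) n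

theorem ae_wideCylinders (h : PermIrreducible π) (hm : 2 ≤ m) :
    ∀ᵐ lam ∂(volume : Measure (Fin m → ℝ)), (∀ j, 0 < lam j) →
      Generic lam π ∧ WideCylinders lam π := by
  have hz : ∀ c : Fin m, (π c : ℕ) = 0 → (c : ℕ) ≠ 0 := fun c hc hc0 => h.apply_zero_ne hm hc0 hc
  have hnull : ∀ R : ℕ, volume (⋂ j : ℕ, ⋃ N : ℕ, ⋂ n ≥ N,
      narrow π ((R : ℝ) + 1) (1 / ((j : ℝ) + 2)) n) = 0 := by
    intro R
    have hR : (0 : ℝ) < (R : ℝ) + 1 := by positivity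
    have hb : ∀ j : ℕ, volume (⋂ j : ℕ, ⋃ N : ℕ, ⋂ n ≥ N,
        narrow π ((R : ℝ) + 1) (1 / ((j : ℝ) + 2)) n) ≤
        ENNReal.ofReal (m * (1 / ((j : ℝ) + 2))) * volume (simplexBelow m ((R : ℝ) + 1)) := by
      intro j
      refine (measure_mono (iInter_subset _ j)).trans ?_
      have hmono : Monotone fun N : ℕ => ⋂ n ≥ N, narrow π ((R : ℝ) + 1) (1 / ((j : ℝ) + 2)) n :=
        fun N N' hN => biInter_mono (fun n (hn : N' ≤ n) => hN.trans hn) fun _ _ => subset_rfl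
      rw [hmono.measure_iUnion]
      refine iSup_le fun N => (measure_mono (biInter_subset_of_mem (le_refl N))).trans ?_
      refine volume_narrow_le hm hz hR (by positivity) ?_ N
      rw [div_lt_one (by positivity)]
      linarith [(Nat.cast_nonneg j : (0 : ℝ) ≤ j)]
    have hlim : Filter.Tendsto (fun j : ℕ => ENNReal.ofReal (m * (1 / ((j : ℝ) + 2))) *
        volume (simplexBelow m ((R : ℝ) + 1))) Filter.atTop (nhds 0) := by
      have h1 : Filter.Tendsto (fun j : ℕ => (m : ℝ) * (1 / ((j : ℝ) + 2))) Filter.atTop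
          (nhds 0) := by
        have h2 : Filter.Tendsto (fun j : ℕ => 1 / ((j : ℝ) + 2)) Filter.atTop (nhds 0) := by
          refine (tendsto_one_div_atTop_nhds_zero_nat.comp (Filter.tendsto_add_atTop_nat 2)).congr
            fun j => ?_
          simp
        simpa using h2.const_mul (m : ℝ)
      have h3 := ENNReal.tendsto_ofReal h1
      have h4 := ENNReal.Tendsto.mul_const h3 (b := volume (simplexBelow m ((R : ℝ) + 1)))
        (Or.inr (volume_simplexBelow_lt_top m _).ne)
      simpa using h4
    exact le_antisymm (ge_of_tendsto' hlim hb) bot_le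
  have hae := ae_all_iff.2 fun R : ℕ => measure_eq_zero_iff_ae_notMem.1 (hnull R)
  filter_upwards [ae_generic h hm, hae] with lam hgen hnot hpos
  have hg := hgen hpos
  refine ⟨hg, ?_⟩
  obtain ⟨R, hR⟩ := exists_nat_gt (∑ j, lam j)
  have h1 := hnot R
  simp only [mem_iInter, mem_iUnion, not_forall, not_exists] at h1
  obtain ⟨j, hj⟩ := h1
  have hm0 : (0 : ℝ) < m := by exact_mod_cast (by omega : 0 < m)
  refine ⟨(1 / ((j : ℝ) + 2)) * (((R : ℝ) + 1) / (1 + 2 * m * m)), by positivity, fun N => ?_⟩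
  obtain ⟨n, hn, hnn⟩ := hj N
  refine ⟨n + 1, by omega, fun x hx => ?_⟩
  have h2 : ∀ w ∈ words lam π (n + 1),
      (1 / ((j : ℝ) + 2)) * (((R : ℝ) + 1) / (1 + m * (2 * ((n + 1) * m)))) ≤
        wid lam π (extWord w) (n + 1) := by
    intro w hw
    by_contra hlt
    exact hnn ⟨hg, by linarith, w, hw, not_le.1 hlt⟩
  have h3 := h2 _ (trunc_mem_words hg.nonneg hx (n + 1))
  rw [wid_extWord_trunc] at h3
  refine le_trans ?_ h3
  rw [mul_div_assoc, div_div]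
  refine mul_le_mul_of_nonneg_left ?_ (by positivity)
  refine div_le_div_of_nonneg_left (by positivity) (by positivity) ?_
  push_cast
  have hn0 : (0 : ℝ) ≤ n := Nat.cast_nonneg n
  nlinarith [mul_nonneg hn0 hm0.le, mul_pos hm0 hm0]

end

/-! ### Packing estimates -/

section

set_option linter.unusedSectionVars false

variable {m : ℕ} [NeZero m] {lam : Fin m → ℝ} {π : Equiv.Perm (Fin m)}

/-- A function bounded below on many disjoint wide cylinders has a large integral. -/
theorem packing (hpos : ∀ j, 0 ≤ lam j) {n K : ℕ} {τ β : ℝ} (hβ : 0 ≤ β)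
    (hwide : ∀ x ∈ base lam, τ ≤ wid lam π (itin lam π x) n) {q : ℕ → ℝ}
    (hq : ∀ k < K, q k ∈ base lam)
    (hne : ∀ i j, i < j → j < K → ¬ SameCode lam π (n + 1) (q i) (q j)) {F : ℝ → ℂ}
    (hF : ∀ k < K, ∀ y ∈ base lam, SameCode lam π (n + 1) y (q k) → β ≤ ‖F y‖) :
    ENNReal.ofReal (K * τ * β) ≤ ∫⁻ x in base lam, ‖F x‖ₑ := by
  obtain ⟨C, hC⟩ : ∃ C : ℕ → Set ℝ,
      C = fun k => Ico (cylL lam π (itin lam π (q k)) n) (cylR lam π (itin lam π (q k)) n) :=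
    ⟨_, rfl⟩
  have hmem : ∀ k y, y ∈ C k ↔ y ∈ base lam ∧ SameCode lam π (n + 1) y (q k) := fun k y => by
    rw [hC, mem_cyl_iff hpos]
    refine and_congr_right fun _ => ⟨fun h j hj => h j (by omega), fun h j hj => h j (by omega)⟩
  have hdisj : (↑(Finset.range K) : Set ℕ).PairwiseDisjoint C := by
    have hd : ∀ i j, i < j → j < K → Disjoint (C i) (C j) := fun i j hij hj =>
      Set.disjoint_left.2 fun y h1 h2 =>
        hne i j hij hj ((((hmem i y).1 h1).2).symm.trans ((hmem j y).1 h2).2)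
    intro i hi j hj hij
    simp only [Finset.coe_range, mem_Iio] at hi hj
    rcases lt_or_gt_of_ne hij with h | h
    · exact hd i j h hj
    · exact (hd j i h hi).symm
  have hsub : (⋃ k ∈ Finset.range K, C k) ⊆ base lam :=
    iUnion₂_subset fun k _ y hy => ((hmem k y).1 hy).1
  refine le_trans ?_ (lintegral_mono_set hsub)
  rw [lintegral_biUnion_finset hdisj fun k _ => by rw [hC]; exact measurableSet_Ico]
  have hk : ∀ k ∈ Finset.range K, ENNReal.ofReal (τ * β) ≤ ∫⁻ x in C k, ‖F x‖ₑ := by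
    intro k hk
    have hk' := Finset.mem_range.1 hk
    have hm : MeasurableSet (C k) := by rw [hC]; exact measurableSet_Ico
    calc ENNReal.ofReal (τ * β) ≤ ENNReal.ofReal β * volume (C k) := by
          rw [hC]
          simp only [Real.volume_Ico]
          rw [← ENNReal.ofReal_mul hβ, mul_comm]
          exact ENNReal.ofReal_le_ofReal (mul_le_mul_of_nonneg_left (hwide _ (hq k hk')) hβ)
      _ = ∫⁻ _ in C k, ENNReal.ofReal β := (setLIntegral_const _ _).symm
      _ ≤ ∫⁻ x in C k, ‖F x‖ₑ := by
          refine setLIntegral_mono' hm fun y hy => ?_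
          rw [← ofReal_norm]
          obtain ⟨h1, h2⟩ := (hmem k y).1 hy
          exact ENNReal.ofReal_le_ofReal (hF k hk' y h1 h2)
  refine le_trans ?_ (Finset.sum_le_sum hk)
  rw [Finset.sum_const, Finset.card_range, nsmul_eq_mul, mul_assoc,
    ENNReal.ofReal_mul (Nat.cast_nonneg K), ENNReal.ofReal_natCast]

theorem abs_norm_sub_le_of_norm_one {a b u : ℂ} {κ : ℝ} (hu : ‖u‖ = 1) (h : ‖a - u * b‖ ≤ κ) :
    |‖a‖ - ‖b‖| ≤ κ := by
  have := abs_norm_sub_norm_le a (u * b)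
  rw [norm_mul, hu, one_mul] at this
  exact this.trans h

/-- A slowly varying function with values mostly near `{0, 1}` in modulus, not always small,
is bounded below. -/
theorem Generic.quarter_le_norm (h : Generic lam π) (hz : ∀ c : Fin m, (π c : ℕ) = 0 → (c : ℕ) ≠ 0)
    {n J L : ℕ} {τ κ η : ℝ} (hwide : ∀ x ∈ base lam, τ ≤ wid lam π (itin lam π x) n)
    (hL : L ≤ n + 1) (hκ : 0 < κ) (hJ : 1 / 4 + κ * J ≤ 3 / 4) {Φ f : ℝ → ℂ}
    (hΦ : ∀ x ∈ base lam, |‖Φ (iet lam π x)‖ - ‖Φ x‖| ≤ κ)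
    (hΦL : ∀ x ∈ base lam, ∀ y ∈ base lam, SameCode lam π L x y → Φ x = Φ y)
    (hf : ∀ x, ‖f x‖ = 0 ∨ ‖f x‖ = 1) (hΦf : ∫⁻ x in base lam, ‖Φ x - f x‖ₑ ≤ ENNReal.ofReal η)
    (hη0 : 0 ≤ η) (hη : η < J * τ * (1 / 4)) (hx1 : ∃ x ∈ base lam, 3 / 4 < ‖Φ x‖) :
    ∀ x ∈ base lam, 1 / 4 ≤ ‖Φ x‖ := by
  intro x0 hx0
  by_contra hlt
  rw [not_le] at hlt
  have hband : ∀ j : ℕ, j < J → ∃ y ∈ base lam, 1 / 4 + κ * j ≤ ‖Φ y‖ ∧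
      ‖Φ y‖ < 1 / 4 + κ * (j + 1) := by
    intro j hj
    by_contra hno
    push Not at hno
    have hjJ : κ * ((j : ℝ) + 1) ≤ κ * J :=
      mul_le_mul_of_nonneg_left (by exact_mod_cast hj) hκ.le
    have := h.base_subset (n := L) (U := {x | 1 / 4 + κ * (j + 1) ≤ ‖Φ x‖}) hz
      (fun x hx y hy hxy hxU => by
        have : ‖Φ y‖ = ‖Φ x‖ := by rw [hΦL x hx y hy hxy]
        simpa [this] using hxU)
      (fun x hx hxU => by
        have hxU : 1 / 4 + κ * (j + 1) ≤ ‖Φ x‖ := hxU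
        refine hno _ (iet_mem h.nonneg π hx) ?_
        have := (abs_le.1 (hΦ x hx)).1
        linarith)
      (by
        obtain ⟨x1, h1, h2⟩ := hx1
        exact ⟨x1, h1, show 1 / 4 + κ * (j + 1) ≤ ‖Φ x1‖ by linarith⟩) x0 hx0
    have h3 : 1 / 4 + κ * (j + 1) ≤ ‖Φ x0‖ := this
    have : 0 ≤ κ * ((j : ℝ) + 1) := by positivity
    linarith
  choose! q hq1 hq2 hq3 using hband
  have hpk := packing h.nonneg (K := J) (β := 1 / 4) (F := fun x => Φ x - f x) (by norm_num) hwide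
    (q := q) hq1
    (fun i j hij hj hsc => by
      have h1 := hq3 i (hij.trans hj)
      have h2 := hq2 j hj
      rw [hΦL _ (hq1 i (hij.trans hj)) _ (hq1 j hj) (hsc.mono hL)] at h1
      have : κ * ((i : ℝ) + 1) ≤ κ * j :=
        mul_le_mul_of_nonneg_left (by exact_mod_cast hij) hκ.le
      linarith)
    (fun k hk y hy hsc => by
      have e := hΦL y hy _ (hq1 k hk) (hsc.mono hL)
      have h1 := hq2 k hk
      have h2 := hq3 k hk
      rw [← e] at h1 h2
      have h3 : κ * ((k : ℝ) + 1) ≤ κ * J :=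
        mul_le_mul_of_nonneg_left (by exact_mod_cast hk) hκ.le
      have h4 : 0 ≤ κ * (k : ℝ) := by positivity
      have h5 := abs_le.1 ((abs_norm_sub_norm_le (Φ y) (f y)))
      rcases hf y with h6 | h6 <;> rw [h6] at h5 <;> linarith [h5.1, h5.2])
  have := (ENNReal.ofReal_le_ofReal_iff hη0).1 (hpk.trans hΦf)
  linarith

/-- The oscillation of the twisted difference is controlled along a preorbit. -/
theorem norm_le_of_preorbit (hpos : ∀ j, 0 ≤ lam j) {n K M : ℕ} {τ κ η δ : ℝ}
    (hwide : ∀ x ∈ base lam, τ ≤ wid lam π (itin lam π x) n) (hM : M ≤ n + 1)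
    (hκ : 0 ≤ κ) (hδ : 0 ≤ δ) {Δ : ℝ → ℂ}
    (hΔ : ∀ x ∈ base lam, |‖Δ (iet lam π x)‖ - ‖Δ x‖| ≤ κ)
    (hΔM : ∀ x ∈ base lam, ∀ y ∈ base lam, SameCode lam π M x y → ‖Δ x‖ = ‖Δ y‖)
    (h_lint : ∫⁻ x in base lam, ‖Δ x‖ₑ ≤ ENNReal.ofReal η) (hη0 : 0 ≤ η)
    (hη : η < K * τ * (δ / 2)) (hK : κ * K ≤ δ / 2) {q : ℕ → ℝ} (hq : ∀ k < K, q k ∈ base lam)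
    (hTq : ∀ k, k + 1 < K → iet lam π (q (k + 1)) = q k)
    (hne : ∀ i j, i < j → j < K → ¬ SameCode lam π (n + 1) (q i) (q j)) : ‖Δ (q 0)‖ ≤ δ := by
  by_contra hlt
  rw [not_le] at hlt
  have hstep : ∀ k < K, ‖Δ (q 0)‖ - κ * k ≤ ‖Δ (q k)‖ := by
    intro k
    induction k with
    | zero => intro _; simp
    | succ k ih =>
      intro hk
      have h1 := ih (by omega)
      have h2 := hΔ _ (hq (k + 1) hk)
      rw [hTq k hk] at h2
      have := (abs_le.1 h2).2
      push_cast
      linarith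
  have hpk := packing hpos (K := K) (β := δ / 2) (F := Δ) (by linarith) hwide hq hne
    (fun k hk y hy hsc => by
      rw [hΔM y hy _ (hq k hk) (hsc.mono hM)]
      have h1 := hstep k hk
      have h2 : κ * (k : ℝ) ≤ κ * K := mul_le_mul_of_nonneg_left (by exact_mod_cast hk.le) hκ
      linarith)
  have := (ENNReal.ofReal_le_ofReal_iff hη0).1 (hpk.trans h_lint)
  linarith

end

/-! ### Twisted Birkhoff averages -/

section

set_option linter.unusedSectionVars false

variable {m : ℕ} [NeZero m] {lam : Fin m → ℝ} {π : Equiv.Perm (Fin m)}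

/-- The multiplicative cocycle over `T_{(λ,π)}` with values `g j` on the `j`-th interval. -/
def coc (g : Fin m → ℂ) (lam : Fin m → ℝ) (π : Equiv.Perm (Fin m)) (k : ℕ) (x : ℝ) : ℂ :=
  ∏ j ∈ Finset.range k, g (itin lam π x j)

variable {g : Fin m → ℂ}

theorem coc_succ (k : ℕ) (x : ℝ) :
    coc g lam π (k + 1) x = coc g lam π k x * g (itin lam π x k) := Finset.prod_range_succ _ _

theorem coc_succ' (k : ℕ) (x : ℝ) :
    coc g lam π (k + 1) x = g (itin lam π x 0) * coc g lam π k (iet lam π x) := by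
  unfold coc
  rw [Finset.prod_range_succ', mul_comm]
  simp only [itin_iet]

theorem norm_coc (hg : ∀ j, ‖g j‖ = 1) (k : ℕ) (x : ℝ) : ‖coc g lam π k x‖ = 1 := by
  unfold coc
  rw [norm_prod]
  exact Finset.prod_eq_one fun j _ => hg _

theorem coc_congr {k : ℕ} {x y : ℝ} (h : SameCode lam π k x y) :
    coc g lam π k x = coc g lam π k y :=
  Finset.prod_congr rfl fun j hj => by rw [h j (Finset.mem_range.1 hj)]

theorem conj_mul_self_of_norm_one {z : ℂ} (hz : ‖z‖ = 1) : (starRingEnd ℂ) z * z = 1 := by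
  rw [mul_comm, Complex.mul_conj, Complex.normSq_eq_norm_sq, hz]
  simp

/-- Twisted Birkhoff average of `ψ`. -/
def avg (g : Fin m → ℂ) (lam : Fin m → ℝ) (π : Equiv.Perm (Fin m)) (ψ : ℝ → ℂ) (N : ℕ) (x : ℝ) :
    ℂ := (N : ℂ)⁻¹ * ∑ k ∈ Finset.range N,
      (starRingEnd ℂ) (coc g lam π k x) * ψ ((iet lam π)^[k] x)

theorem norm_avg_le (hpos : ∀ j, 0 ≤ lam j) (hg : ∀ j, ‖g j‖ = 1) {ψ : ℝ → ℂ}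
    (hψ : ∀ x ∈ base lam, ‖ψ x‖ ≤ 2) (N : ℕ) {x : ℝ} (hx : x ∈ base lam) :
    ‖avg g lam π ψ N x‖ ≤ 2 := by
  unfold avg
  rw [norm_mul, norm_inv, Complex.norm_natCast]
  have : ‖∑ k ∈ Finset.range N, (starRingEnd ℂ) (coc g lam π k x) * ψ ((iet lam π)^[k] x)‖ ≤
      N * 2 := by
    refine (norm_sum_le_of_le (n := fun _ => 2) _ fun k _ => ?_).trans (by simp)
    rw [norm_mul, RCLike.norm_conj, norm_coc hg, one_mul]
    exact hψ _ (iterate_mem hpos π hx k)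
  rcases Nat.eq_zero_or_pos N with rfl | hN
  · simp
  have hN' : (0 : ℝ) < N := by exact_mod_cast hN
  calc (N : ℝ)⁻¹ * _ ≤ (N : ℝ)⁻¹ * (N * 2) := mul_le_mul_of_nonneg_left this (by positivity)
    _ = 2 := by field_simp

theorem norm_avg_iet_sub_le (hpos : ∀ j, 0 ≤ lam j) (hg : ∀ j, ‖g j‖ = 1) {ψ : ℝ → ℂ}
    (hψ : ∀ x ∈ base lam, ‖ψ x‖ ≤ 2) (N : ℕ) {x : ℝ} (hx : x ∈ base lam) :
    ‖avg g lam π ψ N (iet lam π x) - g (itin lam π x 0) * avg g lam π ψ N x‖ ≤ 4 / N := by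
  obtain ⟨a, ha⟩ : ∃ a : ℕ → ℂ, a = fun k =>
      (starRingEnd ℂ) (coc g lam π k x) * ψ ((iet lam π)^[k] x) := ⟨_, rfl⟩
  have hbd : ∀ k, ‖a k‖ ≤ 2 := fun k => by
    rw [ha, norm_mul, RCLike.norm_conj, norm_coc hg, one_mul]
    exact hψ _ (iterate_mem hpos π hx k)
  have hgg := conj_mul_self_of_norm_one (hg (itin lam π x 0))
  have h1 : ∀ k, (starRingEnd ℂ) (coc g lam π k (iet lam π x)) *
      ψ ((iet lam π)^[k] (iet lam π x)) = g (itin lam π x 0) * a (k + 1) := fun k => by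
    rw [ha]
    simp only [coc_succ', map_mul, Function.iterate_succ_apply]
    linear_combination (-((starRingEnd ℂ) (coc g lam π k (iet lam π x)) *
      ψ ((iet lam π)^[k] (iet lam π x)))) * hgg
  have h2 : avg g lam π ψ N (iet lam π x) - g (itin lam π x 0) * avg g lam π ψ N x =
      (N : ℂ)⁻¹ * (g (itin lam π x 0) * (a N - a 0)) := by
    have h3 : avg g lam π ψ N x = (N : ℂ)⁻¹ * ∑ k ∈ Finset.range N, a k := by rw [ha]; rfl
    rw [h3]
    unfold avg
    simp only [h1]
    rw [← Finset.mul_sum, ← Finset.sum_range_sub a N, Finset.sum_sub_distrib]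
    ring
  rw [h2, norm_mul, norm_mul, hg, one_mul, norm_inv, Complex.norm_natCast, div_eq_inv_mul]
  refine mul_le_mul_of_nonneg_left ?_ (by positivity)
  exact (norm_sub_le _ _).trans (by linarith [hbd N, hbd 0])

theorem avg_congr (hpos : ∀ j, 0 ≤ lam j) {ψ : ℝ → ℂ} {r : ℕ}
    (hψ : ∀ x ∈ base lam, ∀ y ∈ base lam, SameCode lam π r x y → ψ x = ψ y) (N : ℕ) {x y : ℝ}
    (hx : x ∈ base lam) (hy : y ∈ base lam) (hxy : SameCode lam π (N + r) x y) :
    avg g lam π ψ N x = avg g lam π ψ N y := by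
  unfold avg
  congr 1
  refine Finset.sum_congr rfl fun k hk => ?_
  have hk := Finset.mem_range.1 hk
  rw [coc_congr (hxy.mono (by omega)), hψ _ (iterate_mem hpos π hx k) _ (iterate_mem hpos π hy k)
    (hxy.iterate (by omega))]

/-- `f` is an eigenfunction for the cocycle `g`, almost everywhere. -/
theorem ae_iterate_eq_coc (hpos : ∀ j, 0 ≤ lam j) {f : ℝ → ℂ}
    (hf : ∀ᵐ x ∂(volume.restrict (base lam)), f (iet lam π x) = g (itin lam π x 0) * f x) (k : ℕ) :
    ∀ᵐ x ∂(volume.restrict (base lam)), f ((iet lam π)^[k] x) = coc g lam π k x * f x := by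
  induction k with
  | zero => simp [coc]
  | succ k ih =>
    have h1 := ((measurePreserving_iet hpos π).iterate k).quasiMeasurePreserving.ae hf
    filter_upwards [ih, h1] with x h2 h3
    rw [Function.iterate_succ_apply', h3, h2, coc_succ, itin_iterate, zero_add]
    ring

theorem lintegral_avg_sub_le (hpos : ∀ j, 0 ≤ lam j) (hg : ∀ j, ‖g j‖ = 1) {f : ℝ → ℂ}
    (hf : ∀ᵐ x ∂(volume.restrict (base lam)), f (iet lam π x) = g (itin lam π x 0) * f x)
    {ψ : ℝ → ℂ} {D : ℝ → ENNReal} (hD : Measurable D)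
    (hψD : ∀ x ∈ base lam, ‖ψ x - f x‖ₑ ≤ D x) {N : ℕ} (hN : 0 < N) :
    ∃ D' : ℝ → ENNReal, Measurable D' ∧ ∫⁻ x in base lam, D' x = ∫⁻ x in base lam, D x ∧
      ∀ᵐ x ∂(volume.restrict (base lam)), ‖avg g lam π ψ N x - f x‖ₑ ≤ D' x := by
  have hT := measurePreserving_iet hpos π
  have hmeas : ∀ k, Measurable fun x => D ((iet lam π)^[k] x) := fun k =>
    hD.comp (hT.iterate k).measurable
  refine ⟨fun x => (N : ENNReal)⁻¹ * ∑ k ∈ Finset.range N, D ((iet lam π)^[k] x),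
    (Finset.measurable_sum _ fun k _ => hmeas k).const_mul _, ?_, ?_⟩
  · rw [lintegral_const_mul _ (Finset.measurable_sum _ fun k _ => hmeas k),
      lintegral_finsetSum _ fun k _ => hmeas k]
    have : ∀ k ∈ Finset.range N, ∫⁻ x in base lam, D ((iet lam π)^[k] x) =
        ∫⁻ x in base lam, D x := fun k _ => (hT.iterate k).lintegral_comp hD
    rw [Finset.sum_congr rfl this, Finset.sum_const, Finset.card_range, nsmul_eq_mul, ← mul_assoc,
      ENNReal.inv_mul_cancel (by exact_mod_cast hN.ne') (ENNReal.natCast_ne_top N), one_mul]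
  · have h1 := ae_all_iff.2 (ae_iterate_eq_coc (π := π) hpos hf)
    filter_upwards [h1, ae_restrict_mem measurableSet_Ico] with x hx hxb
    have hNC : (N : ℂ) ≠ 0 := by exact_mod_cast hN.ne'
    have h2 : avg g lam π ψ N x - f x = (N : ℂ)⁻¹ * ∑ k ∈ Finset.range N,
        (starRingEnd ℂ) (coc g lam π k x) *
          (ψ ((iet lam π)^[k] x) - f ((iet lam π)^[k] x)) := by
      have h3 : ∀ k ∈ Finset.range N, (starRingEnd ℂ) (coc g lam π k x) *
          (ψ ((iet lam π)^[k] x) - f ((iet lam π)^[k] x)) =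
          (starRingEnd ℂ) (coc g lam π k x) * ψ ((iet lam π)^[k] x) - f x := fun k _ => by
        rw [hx k]
        linear_combination (-f x) * conj_mul_self_of_norm_one (norm_coc (lam := lam) (π := π) hg k x)
      rw [Finset.sum_congr rfl h3, Finset.sum_sub_distrib, mul_sub]
      unfold avg
      simp only [Finset.sum_const, Finset.card_range, nsmul_eq_mul]
      rw [inv_mul_cancel_left₀ hNC]
    rw [h2, enorm_mul]
    have h4 : ‖(N : ℂ)⁻¹‖ₑ = (N : ENNReal)⁻¹ := by
      rw [enorm_inv hNC]
      congr 1
      rw [← ofReal_norm, Complex.norm_natCast, ENNReal.ofReal_natCast]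
    rw [h4]
    refine mul_le_mul_right ((enorm_sum_le _ _).trans (Finset.sum_le_sum fun k _ => ?_)) _
    rw [enorm_mul]
    have h5 : ‖(starRingEnd ℂ) (coc g lam π k x)‖ₑ = 1 := by
      rw [← ofReal_norm, RCLike.norm_conj, norm_coc hg, ENNReal.ofReal_one]
    rw [h5, one_mul]
    exact hψD _ (iterate_mem hpos π hxb k)

/-- The defect of `Φ` being an eigenfunction for the `L`-th iterate. -/
def defect (g : Fin m → ℂ) (lam : Fin m → ℝ) (π : Equiv.Perm (Fin m)) (Φ : ℝ → ℂ) (L : ℕ) (x : ℝ) :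
    ℂ := Φ ((iet lam π)^[L] x) - coc g lam π L x * Φ x

theorem lintegral_defect_le (hpos : ∀ j, 0 ≤ lam j) (hg : ∀ j, ‖g j‖ = 1) {f : ℝ → ℂ}
    (hf : ∀ᵐ x ∂(volume.restrict (base lam)), f (iet lam π x) = g (itin lam π x 0) * f x)
    {Φ : ℝ → ℂ} {D : ℝ → ENNReal} (hD : Measurable D)
    (hΦD : ∀ᵐ x ∂(volume.restrict (base lam)), ‖Φ x - f x‖ₑ ≤ D x) (L : ℕ) :
    ∫⁻ x in base lam, ‖defect g lam π Φ L x‖ₑ ≤ 2 * ∫⁻ x in base lam, D x := by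
  have hT := (measurePreserving_iet hpos π).iterate L
  have h1 := hT.quasiMeasurePreserving.ae hΦD
  have h2 : ∀ᵐ x ∂(volume.restrict (base lam)), ‖defect g lam π Φ L x‖ₑ ≤
      D ((iet lam π)^[L] x) + D x := by
    filter_upwards [hΦD, h1, ae_iterate_eq_coc (π := π) hpos hf L] with x h3 h4 h5
    have h6 : defect g lam π Φ L x = (Φ ((iet lam π)^[L] x) - f ((iet lam π)^[L] x)) -
        coc g lam π L x * (Φ x - f x) := by
      rw [h5]; unfold defect; ring
    rw [h6]
    refine (enorm_sub_le).trans (add_le_add h4 ?_)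
    have h7 : ‖coc g lam π L x‖ₑ = 1 := by
      rw [← ofReal_norm, norm_coc hg, ENNReal.ofReal_one]
    rw [enorm_mul, h7, one_mul]
    exact h3
  refine (lintegral_mono_ae h2).trans ?_
  rw [lintegral_add_left (show Measurable fun x => D ((iet lam π)^[L] x) from
    hD.comp hT.measurable), hT.lintegral_comp hD, two_mul]

theorem abs_norm_defect_iet_sub_le (hpos : ∀ j, 0 ≤ lam j) (hg : ∀ j, ‖g j‖ = 1) {Φ : ℝ → ℂ}
    {κ : ℝ} (hΦ : ∀ x ∈ base lam, ‖Φ (iet lam π x) - g (itin lam π x 0) * Φ x‖ ≤ κ) (L : ℕ) {x : ℝ}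
    (hx : x ∈ base lam) :
    |‖defect g lam π Φ L (iet lam π x)‖ - ‖defect g lam π Φ L x‖| ≤ 2 * κ := by
  refine abs_norm_sub_le_of_norm_one (hg (itin lam π x L)) ?_
  have h1 := hΦ _ (iterate_mem hpos π hx L)
  have h2 := hΦ x hx
  rw [itin_iterate, zero_add, ← Function.iterate_succ_apply' (iet lam π) L x] at h1
  have h3 := (coc_succ (g := g) (lam := lam) (π := π) L x).symm.trans (coc_succ' L x)
  have h4 : defect g lam π Φ L (iet lam π x) - g (itin lam π x L) * defect g lam π Φ L x =
      (Φ ((iet lam π)^[L + 1] x) - g (itin lam π x L) * Φ ((iet lam π)^[L] x)) -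
      coc g lam π L (iet lam π x) * (Φ (iet lam π x) - g (itin lam π x 0) * Φ x) := by
    unfold defect
    rw [← Function.iterate_succ_apply]
    linear_combination Φ x * h3
  rw [h4]
  refine (norm_sub_le _ _).trans ?_
  rw [norm_mul, norm_coc hg, one_mul]
  linarith

theorem norm_defect_congr (hpos : ∀ j, 0 ≤ lam j) {Φ : ℝ → ℂ} {L : ℕ}
    (hΦ : ∀ x ∈ base lam, ∀ y ∈ base lam, SameCode lam π L x y → Φ x = Φ y) {x y : ℝ}
    (hx : x ∈ base lam) (hy : y ∈ base lam) (hxy : SameCode lam π (2 * L) x y) :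
    ‖defect g lam π Φ L x‖ = ‖defect g lam π Φ L y‖ := by
  unfold defect
  rw [hΦ _ (iterate_mem hpos π hx L) _ (iterate_mem hpos π hy L) (hxy.iterate (by omega)),
    hΦ _ hx _ hy (hxy.mono (by omega)), coc_congr (hxy.mono (by omega : L ≤ 2 * L))]

end

/-! ### Approximation by functions of finitely many letters -/

section

set_option linter.unusedSectionVars false

variable {m : ℕ} [NeZero m] {lam : Fin m → ℝ} {π : Equiv.Perm (Fin m)}

/-- A representative, depending only on the first `r + 1` letters, of the cylinder of `x`. -/
theorem Generic.exists_representative (h : Generic lam π) {θ : ℝ} (hθ : 0 < θ) :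
    ∃ (r : ℕ) (p : ℝ → ℝ), (∀ x ∈ base lam, |p x - x| < θ) ∧
      ∀ x y, SameCode lam π r x y → p x = p y := by
  obtain ⟨r, hr⟩ := h.exists_code_length hθ
  refine ⟨r + 1, fun x => cylL lam π (extWord (fun i : Fin (r + 1) => itin lam π x i)) r,
    fun x hx => ?_, fun x y hxy => ?_⟩
  · have h1 : x ∈ Ico (cylL lam π (extWord (fun i : Fin (r + 1) => itin lam π x i)) r)
        (cylR lam π (extWord (fun i : Fin (r + 1) => itin lam π x i)) r) :=
      (mem_cyl_iff h.nonneg).2 ⟨hx, fun k hk => (extWord_trunc _ hk).symm⟩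
    have h2 := (mem_cyl_iff h.nonneg).1 (left_mem_Ico.2 (h1.1.trans_lt h1.2))
    refine hr _ h2.1 _ hx fun k hk => ?_
    rw [h2.2 k hk.le, extWord_trunc _ hk.le]
  · have : (fun i : Fin (r + 1) => itin lam π x i) = fun i : Fin (r + 1) => itin lam π y i :=
      funext fun i => hxy i i.2
    simp only [this]

theorem Generic.exists_approx (h : Generic lam π) {f : ℝ → ℂ} (hfm : Measurable f)
    (hf : ∀ x, ‖f x‖ = 0 ∨ ‖f x‖ = 1) {η : ℝ} (hη : 0 < η) :
    ∃ (r : ℕ) (ψ : ℝ → ℂ) (D : ℝ → ENNReal), Measurable D ∧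
      ∫⁻ x in base lam, D x ≤ ENNReal.ofReal η ∧ (∀ x ∈ base lam, ‖ψ x - f x‖ₑ ≤ D x) ∧
      (∀ x ∈ base lam, ‖ψ x‖ ≤ 2) ∧
      ∀ x ∈ base lam, ∀ y ∈ base lam, SameCode lam π r x y → ψ x = ψ y := by
  have hf1 : ∀ x, ‖f x‖ ≤ 1 := fun x => by rcases hf x with h | h <;> rw [h] <;> norm_num
  have htot : 0 ≤ ∑ i, lam i := Finset.sum_nonneg fun i _ => h.nonneg i
  have h_lint : Integrable ((base lam).indicator f) volume := by
    rw [integrable_indicator_iff measurableSet_Ico]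
    exact Measure.integrableOn_of_bounded (M := 1) (by simp) hfm.aestronglyMeasurable
      (Filter.Eventually.of_forall hf1)
  obtain ⟨u, hu1, hu2, hu3, -⟩ := h_lint.exists_hasCompactSupport_lintegral_sub_le
    (ε := ENNReal.ofReal (η / 2)) (by simpa using hη)
  have huc := hu1.uniformContinuous_of_continuous hu3
  obtain ⟨η', hη'⟩ : ∃ η' : ℝ, η' = η / (2 * (∑ i, lam i + 1)) := ⟨_, rfl⟩
  have hη'0 : 0 < η' := by rw [hη']; positivity
  obtain ⟨θ, hθ, hθu⟩ := Metric.uniformContinuous_iff.1 huc η' hη'0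
  obtain ⟨r, p, hp, hpc⟩ := h.exists_representative hθ
  refine ⟨r, fun x => if ‖u (p x)‖ ≤ 2 then u (p x) else 0,
    fun x => ‖u x - f x‖ₑ + ENNReal.ofReal η', ?_, ?_, ?_, ?_, ?_⟩
  · exact ((hu3.measurable.sub hfm).enorm).add_const _
  · rw [lintegral_add_right _ measurable_const, setLIntegral_const, Real.volume_Ico, sub_zero,
      ← ENNReal.ofReal_mul hη'0.le]
    have h1 : ∫⁻ x in base lam, ‖u x - f x‖ₑ ≤ ENNReal.ofReal (η / 2) := by
      refine le_trans ?_ hu2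
      rw [← lintegral_indicator measurableSet_Ico]
      refine lintegral_mono fun x => ?_
      by_cases hx : x ∈ base lam
      · rw [indicator_of_mem hx, indicator_of_mem hx, enorm_sub_rev]
      · rw [indicator_of_notMem hx]; exact zero_le
    refine (add_le_add_left h1 _).trans ?_
    rw [← ENNReal.ofReal_add (by positivity) (by positivity)]
    refine ENNReal.ofReal_le_ofReal ?_
    have h2 : η' * ∑ i, lam i ≤ η / 2 := by
      rw [hη', div_mul_eq_mul_div, div_le_div_iff₀ (by positivity) (by norm_num)]
      nlinarith
    linarith
  · intro x hx
    have h1 : ‖u (p x) - u x‖ ≤ η' := by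
      rw [← dist_eq_norm]
      exact (hθu (by rw [Real.dist_eq]; exact hp x hx)).le
    have h2 : ‖u (p x) - f x‖ ≤ ‖u x - f x‖ + η' := by
      have : u (p x) - f x = (u (p x) - u x) + (u x - f x) := by ring
      rw [this]
      exact (norm_add_le _ _).trans (by linarith)
    have h3 : ‖(if ‖u (p x)‖ ≤ 2 then u (p x) else 0) - f x‖ ≤ ‖u x - f x‖ + η' := by
      split_ifs with hc
      · exact h2
      · push Not at hc
        refine le_trans ?_ h2
        have := norm_sub_norm_le (u (p x)) (f x)
        rw [zero_sub, norm_neg]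
        linarith [hf1 x]
    dsimp only
    rw [← ofReal_norm, ← ofReal_norm, ← ENNReal.ofReal_add (norm_nonneg _) hη'0.le]
    exact ENNReal.ofReal_le_ofReal h3
  · intro x _
    dsimp only
    split_ifs with hc
    · exact hc
    · simp
  · intro x _ y _ hxy
    simp only [hpc x y hxy]

end

/-! ### Continuity of almost eigenfunctions at the discontinuities -/

section

set_option linter.unusedSectionVars false

variable {m : ℕ} [NeZero m] {lam : Fin m → ℝ} {π : Equiv.Perm (Fin m)}

theorem SameCode.iterate_sub (hpos : ∀ j, 0 ≤ lam j) {x x' : ℝ} {n a : ℕ} (hx : x ∈ base lam)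
    (hx' : x' ∈ base lam) (hxx : SameCode lam π (n + 1) x x') (ha : a ≤ n) {b : Fin m}
    (hb : (iet lam π)^[a] x ∈ block lam b) :
    (iet lam π)^[a] x + (x' - x) ∈ block lam b := by
  have h1 := iterate_sub_of_itin_eq hpos π hx hx' (n := a) fun k hk => hxx k (by omega)
  have h2 := iterate_mem_block hpos π hx' a
  rw [← hxx a (by omega), show itin lam π x a = b from letter_eq hpos hb] at h2
  rwa [← h1, add_sub_cancel]

theorem Generic.tinv_iterate_pre_injective (h : Generic lam π) {c : Fin m} (hc : (c : ℕ) ≠ 0)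
    {i j : ℕ} (hij : i < j) : (tinv lam π)^[i] (pre lam c) ≠ (tinv lam π)^[j] (pre lam c) := by
  intro he
  have hpc := pre_mem_base h.pos c
  have h1 := iterate_tinv_iterate h.nonneg π hpc j 0
  have h2 := iterate_tinv_iterate h.nonneg π hpc i 0
  simp only [add_zero, Function.iterate_zero, id_eq] at h1 h2
  refine h.iterate_pre_ne c hc (k := j - i) (by omega) ?_
  nth_rewrite 1 [← h2]
  rw [← Function.iterate_add_apply, he, show j - i + i = j by omega, h1]

theorem Generic.not_sameCode_tinv (h : Generic lam π) {c : Fin m} (hc : (c : ℕ) ≠ 0)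
    {i j n : ℕ} (hij : i < j) (hj : j ≤ n) :
    ¬ SameCode lam π (n + 1) ((tinv lam π)^[i] (pre lam c)) ((tinv lam π)^[j] (pre lam c)) := by
  intro hs
  have hpc := pre_mem_base h.pos c
  have hmem := tinv_iterate_mem h.nonneg π hpc
  have h1 := iterate_tinv_iterate h.nonneg π hpc j 0
  have h2 := iterate_tinv_iterate h.nonneg π hpc i 0
  simp only [add_zero, Function.iterate_zero, id_eq] at h1 h2
  have h3 := hs.iterate_sub h.nonneg (a := i) (hmem i) (hmem j) (by omega) (b := c)
    (by rw [h2]; exact pre_mem_block h.pos c)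
  have h4 := hs.symm.iterate_sub h.nonneg (a := j) (hmem j) (hmem i) (by omega) (b := c)
    (by rw [h1]; exact pre_mem_block h.pos c)
  rw [h2] at h3
  rw [h1] at h4
  refine h.tinv_iterate_pre_injective hc hij ?_
  have h5 := h3.1
  have h6 := h4.1
  linarith

theorem Generic.not_sameCode_tinv_sub (h : Generic lam π) {b c : Fin m} (hbc : (b : ℕ) + 1 = c)
    {i j n : ℕ} {s : ℝ} (hi : i ≤ n) (hj : j ≤ n) (hs : 0 < s) (hsb : s ≤ lam b)
    (hsij : s ≤ |(tinv lam π)^[i] (pre lam c) - (tinv lam π)^[j] (pre lam c)|)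
    (hmi : (tinv lam π)^[i] (pre lam c) - s ∈ base lam)
    (hmj : (tinv lam π)^[j] (pre lam c) - s ∈ base lam)
    (hTi : (iet lam π)^[i] ((tinv lam π)^[i] (pre lam c) - s) = pre lam c - s)
    (hTj : (iet lam π)^[j] ((tinv lam π)^[j] (pre lam c) - s) = pre lam c - s) :
    ¬ SameCode lam π (n + 1) ((tinv lam π)^[i] (pre lam c) - s)
      ((tinv lam π)^[j] (pre lam c) - s) := by
  intro hsc
  have hb := pre_sub_mem_block hbc hs hsb
  have h3 := hsc.iterate_sub h.nonneg (a := i) hmi hmj hi (b := b) (by rwa [hTi])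
  have h4 := hsc.symm.iterate_sub h.nonneg (a := j) hmj hmi hj (b := b) (by rwa [hTj])
  rw [hTi, mem_block_iff, hbc, ← pre_eq_cum lam c] at h3
  rw [hTj, mem_block_iff, hbc, ← pre_eq_cum lam c] at h4
  have h5 := h3.2
  have h6 := h4.2
  refine absurd hsij (not_le.2 (abs_lt.2 ⟨by linarith, by linarith⟩))

theorem Generic.exists_norm_sub_le (h : Generic lam π) {g : Fin m → ℂ}
    {Φ : ℝ → ℂ} {L K n : ℕ} {τ κ η δ : ℝ} (hg : ∀ j, ‖g j‖ = 1)
    (hwide : ∀ x ∈ base lam, τ ≤ wid lam π (itin lam π x) n) (hL : 0 < L) (hL2 : 2 * L ≤ n + 1)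
    (hLK : L + K ≤ n) (hκ : 0 ≤ κ) (hδ : 0 ≤ δ)
    (hΦ : ∀ x ∈ base lam, ‖Φ (iet lam π x) - g (itin lam π x 0) * Φ x‖ ≤ κ)
    (hΦL : ∀ x ∈ base lam, ∀ y ∈ base lam, SameCode lam π L x y → Φ x = Φ y)
    (h_lint : ∫⁻ x in base lam, ‖defect g lam π Φ L x‖ₑ ≤ ENNReal.ofReal η) (hη0 : 0 ≤ η)
    (hη : η < K * τ * (δ / 2)) (hK : 2 * κ * K ≤ δ / 2) {c : Fin m} (hc : (c : ℕ) ≠ 0) :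
    ∃ t > 0, ∀ s, 0 < s → s < t → ‖Φ (pre lam c) - Φ (pre lam c - s)‖ ≤ 2 * δ := by
  obtain ⟨b, hbc⟩ : ∃ b : Fin m, (b : ℕ) + 1 = c := ⟨⟨(c : ℕ) - 1, by omega⟩, by simp; omega⟩
  have hpc := pre_mem_base h.pos c
  obtain ⟨t1, ht1, H1⟩ := h.exists_left_shadow_iterate hc n
  obtain ⟨t2, ht2, H2⟩ := exists_common_pos (ι := Fin n × Fin n) (P := fun p s =>
    p.1 < p.2 → s ≤ |(tinv lam π)^[p.1] (pre lam c) - (tinv lam π)^[p.2] (pre lam c)|) (by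
      rintro ⟨i, j⟩
      by_cases hij : i < j
      · refine ⟨|(tinv lam π)^[i] (pre lam c) - (tinv lam π)^[j] (pre lam c)|,
          abs_pos.2 (sub_ne_zero.2 (h.tinv_iterate_pre_injective hc hij)), fun s _ h2 _ => h2.le⟩
      · exact ⟨1, one_pos, fun s _ _ h3 => absurd h3 hij⟩)
  refine ⟨min (lam b) (min t1 t2), lt_min (h.pos b) (lt_min ht1 ht2), fun s hs0 hs => ?_⟩
  have hsb : s < lam b := hs.trans_le (min_le_left _ _)
  have hs1 : s < t1 := hs.trans_le ((min_le_right _ _).trans (min_le_left _ _))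
  have hs2 : s < t2 := hs.trans_le ((min_le_right _ _).trans (min_le_right _ _))
  have H1 := H1 s hs0.le hs1
  have H2 := H2 s hs0.le hs2
  have hΔ : ∀ x ∈ base lam,
      |‖defect g lam π Φ L (iet lam π x)‖ - ‖defect g lam π Φ L x‖| ≤ 2 * κ :=
    fun x hx => abs_norm_defect_iet_sub_le h.nonneg hg hΦ L hx
  have hΔM : ∀ x ∈ base lam, ∀ y ∈ base lam, SameCode lam π (2 * L) x y →
      ‖defect g lam π Φ L x‖ = ‖defect g lam π Φ L y‖ :=
    fun x hx y hy hxy => norm_defect_congr h.nonneg hΦL hx hy hxy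
  have e1 : ‖defect g lam π Φ L ((tinv lam π)^[L] (pre lam c))‖ ≤ δ :=
    norm_le_of_preorbit (q := fun k => (tinv lam π)^[L + k] (pre lam c)) h.nonneg hwide hL2
      (by positivity) hδ hΔ hΔM h_lint hη0 hη hK
      (fun k _ => tinv_iterate_mem h.nonneg π hpc _)
      (fun k _ => iet_tinv_iterate h.nonneg π hpc _)
      (fun i j hij hj => h.not_sameCode_tinv hc (by omega) (by omega))
  have hTs : ∀ i, i ≤ n → (iet lam π)^[i] ((tinv lam π)^[i] (pre lam c) - s) = pre lam c - s :=
    fun i hi => by simpa using (H1 i 0 (by omega)).1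
  have hms : ∀ i, 0 < i → i ≤ n → (tinv lam π)^[i] (pre lam c) - s ∈ base lam :=
    fun i hi0 hi => by simpa using (H1 i 0 (by omega)).2.2 (by omega)
  have e2 : ‖defect g lam π Φ L ((tinv lam π)^[L] (pre lam c) - s)‖ ≤ δ :=
    norm_le_of_preorbit (q := fun k => (tinv lam π)^[L + k] (pre lam c) - s) h.nonneg hwide hL2
      (by positivity) hδ hΔ hΔM h_lint hη0 hη hK
      (fun k hk => hms _ (by omega) (by omega))
      (fun k hk => by
        have := (H1 1 (L + k) (by omega)).1
        rwa [Function.iterate_one, show 1 + (L + k) = L + (k + 1) by ring] at this)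
      (fun i j hij hj => h.not_sameCode_tinv_sub hbc (by omega) (by omega) hs0 hsb.le
        (H2 (⟨L + i, by omega⟩, ⟨L + j, by omega⟩) (by simpa using hij))
        (hms _ (by omega) (by omega)) (hms _ (by omega) (by omega)) (hTs _ (by omega))
        (hTs _ (by omega)))
  have hcode : SameCode lam π L ((tinv lam π)^[L] (pre lam c) - s)
      ((tinv lam π)^[L] (pre lam c)) := by simpa using (H1 L 0 (by omega)).2.1
  have h1 := iterate_tinv_iterate h.nonneg π hpc L 0
  simp only [add_zero, Function.iterate_zero, id_eq] at h1
  have h2 : Φ (pre lam c) - Φ (pre lam c - s) =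
      defect g lam π Φ L ((tinv lam π)^[L] (pre lam c)) -
        defect g lam π Φ L ((tinv lam π)^[L] (pre lam c) - s) := by
    unfold defect
    rw [h1, hTs L (by omega), coc_congr hcode, hΦL _ (hms L hL (by omega)) _
      (tinv_iterate_mem h.nonneg π hpc L) hcode]
    ring
  rw [h2]
  exact (norm_sub_le _ _).trans (by linarith)

end

section

set_option linter.unusedSectionVars false

variable {m : ℕ} [NeZero m] {lam : Fin m → ℝ} {π : Equiv.Perm (Fin m)}

theorem exists_three_quarters_lt {Φ f : ℝ → ℂ} {η : ℝ} (hfm : Measurable f)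
    (hf : ∀ x, ‖f x‖ = 0 ∨ ‖f x‖ = 1) (h_lint : ∫⁻ x in base lam, ‖Φ x - f x‖ₑ ≤ ENNReal.ofReal η)
    (hη0 : 0 ≤ η) (hη : 4 * η < (volume {x ∈ base lam | f x ≠ 0}).toReal) :
    ∃ x ∈ base lam, 3 / 4 < ‖Φ x‖ := by
  by_contra! hcon
  set A := {x ∈ base lam | f x ≠ 0} with hA
  have hAm : MeasurableSet A :=
    measurableSet_Ico.inter (hfm (measurableSet_singleton (0 : ℂ)).compl)
  have h1 : ENNReal.ofReal (1 / 4) * volume A ≤ ∫⁻ x in base lam, ‖Φ x - f x‖ₑ := by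
    rw [← setLIntegral_const]
    refine (setLIntegral_mono_ae' hAm (Filter.Eventually.of_forall fun x hx => ?_)).trans
      (lintegral_mono_set fun x hx => hx.1)
    have h2 : ‖f x‖ = 1 := (hf x).resolve_left (norm_ne_zero_iff.2 hx.2)
    rw [← ofReal_norm]
    refine ENNReal.ofReal_le_ofReal ?_
    have h3 := norm_sub_norm_le (f x) (Φ x)
    rw [norm_sub_rev] at h3
    linarith [hcon x hx.1]
  have hAfin : volume A ≠ ⊤ :=
    ((measure_mono fun x hx => hx.1 : volume A ≤ volume (base lam)).trans_lt (by simp)).ne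
  have h4 := ENNReal.toReal_mono ENNReal.ofReal_ne_top (h1.trans h_lint)
  rw [ENNReal.toReal_mul, ENNReal.toReal_ofReal (by norm_num), ENNReal.toReal_ofReal hη0] at h4
  linarith

theorem Generic.exists_almost_eigenfunction (h : Generic lam π)
    (hz : ∀ c : Fin m, (π c : ℕ) = 0 → (c : ℕ) ≠ 0) (hW : WideCylinders lam π) {g : Fin m → ℂ}
    (hg : ∀ j, ‖g j‖ = 1) {f : ℝ → ℂ} (hfm : Measurable f) (hf : ∀ x, ‖f x‖ = 0 ∨ ‖f x‖ = 1)
    (hfe : ∀ᵐ x ∂(volume.restrict (base lam)), f (iet lam π x) = g (itin lam π x 0) * f x)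
    (hfpos : 0 < volume {x ∈ base lam | f x ≠ 0}) {δ : ℝ} (hδ : 0 < δ) (hδ1 : δ ≤ 1) :
    ∃ (Φ : ℝ → ℂ) (L : ℕ), (∀ x ∈ base lam, 1 / 4 ≤ ‖Φ x‖) ∧ (∀ x ∈ base lam, ‖Φ x‖ ≤ 2) ∧
      (∀ x ∈ base lam, ‖Φ (iet lam π x) - g (itin lam π x 0) * Φ x‖ ≤ δ) ∧
      (∀ x ∈ base lam, ∀ y ∈ base lam, SameCode lam π L x y → Φ x = Φ y) ∧
      ∀ c : Fin m, (c : ℕ) ≠ 0 →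
        ∃ t > 0, ∀ s, 0 < s → s < t → ‖Φ (pre lam c) - Φ (pre lam c - s)‖ ≤ 2 * δ := by
  obtain ⟨ε, hε, hW⟩ := hW
  have hAfin : volume {x ∈ base lam | f x ≠ 0} ≠ ⊤ :=
    ((measure_mono fun x hx => hx.1 : _ ≤ volume (base lam)).trans_lt (by simp)).ne
  have hα := ENNReal.toReal_pos hfpos.ne' hAfin
  obtain ⟨α, hαdef⟩ : ∃ α, α = (volume {x ∈ base lam | f x ≠ 0}).toReal := ⟨_, rfl⟩
  rw [← hαdef] at hα
  obtain ⟨η, hη0, hη1, hη2⟩ : ∃ η : ℝ, 0 < η ∧ 4 * η < α ∧ η < δ ^ 2 * ε / 512 := by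
    refine ⟨min (α / 4) (δ ^ 2 * ε / 512) / 2, by positivity, ?_, ?_⟩
    · have := min_le_left (α / 4) (δ ^ 2 * ε / 512)
      linarith
    · have := min_le_right (α / 4) (δ ^ 2 * ε / 512)
      have h2 : 0 < δ ^ 2 * ε / 512 := by positivity
      linarith
  obtain ⟨r, ψ, D, hD, hDint, hψD, hψ2, hψr⟩ := h.exists_approx hfm hf hη0
  obtain ⟨N0, hN0⟩ := exists_nat_gt (128 / δ)
  obtain ⟨n, hn, hwide⟩ := hW (64 + 4 * r + N0)
  obtain ⟨L, hL⟩ : ∃ L, L = n / 2 := ⟨_, rfl⟩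
  obtain ⟨N, hN⟩ : ∃ N, N = L - r := ⟨_, rfl⟩
  have hNn : n ≤ 4 * N := by omega
  have hnR : (0 : ℝ) < n := by exact_mod_cast (by omega : 0 < n)
  have hNnR : (n : ℝ) ≤ 4 * N := by exact_mod_cast hNn
  have hNR : (0 : ℝ) < N := by linarith
  have hδN : 32 ≤ δ * N := by
    have h1 : (N0 : ℝ) ≤ n := by exact_mod_cast (by omega : N0 ≤ n)
    have h2 : 128 < δ * n := by
      rw [div_lt_iff₀ hδ] at hN0
      nlinarith
    nlinarith
  have hτ0 : 0 < ε / n := by positivity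
  obtain ⟨D', hD', hDD', hΦD⟩ :=
    lintegral_avg_sub_le h.nonneg hg hfe hD hψD (N := N) (by omega)
  have hΦf : ∫⁻ x in base lam, ‖avg g lam π ψ N x - f x‖ₑ ≤ ENNReal.ofReal η :=
    (lintegral_mono_ae hΦD).trans (hDD'.le.trans hDint)
  have hΦT : ∀ x ∈ base lam, ‖avg g lam π ψ N (iet lam π x) -
      g (itin lam π x 0) * avg g lam π ψ N x‖ ≤ 4 / N :=
    fun x hx => norm_avg_iet_sub_le h.nonneg hg hψ2 N hx
  have hΦL : ∀ x ∈ base lam, ∀ y ∈ base lam, SameCode lam π L x y →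
      avg g lam π ψ N x = avg g lam π ψ N y := fun x hx y hy hxy =>
    avg_congr h.nonneg hψr N hx hy (hxy.mono (by omega))
  refine ⟨avg g lam π ψ N, L, ?_, fun x hx => norm_avg_le h.nonneg hg hψ2 N hx,
    fun x hx => (hΦT x hx).trans ?_, hΦL, fun c hc => ?_⟩
  · have hJ : ((N / 8 : ℕ) : ℝ) ≤ N / 8 := Nat.cast_div_le
    have hJ' : (n : ℝ) / 64 ≤ (N / 8 : ℕ) := by
      rw [div_le_iff₀ (by norm_num)]
      exact_mod_cast (by omega : n ≤ N / 8 * 64)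
    refine h.quarter_le_norm hz (J := N / 8) (κ := 4 / N) (η := η) hwide (by omega) (by positivity)
      ?_ (fun x hx => abs_norm_sub_le_of_norm_one (hg _) (hΦT x hx)) hΦL hf hΦf hη0.le ?_
      (exists_three_quarters_lt hfm hf hΦf hη0.le (by rwa [← hαdef]))
    · have : 4 / (N : ℝ) * (N / 8 : ℕ) ≤ 4 / N * (N / 8) := by gcongr
      have h2 : 4 / (N : ℝ) * (N / 8) = 1 / 2 := by field_simp; norm_num
      linarith
    · have h1 : (n : ℝ) / 64 * (ε / n) ≤ (N / 8 : ℕ) * (ε / n) := by gcongr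
      have h2 : (n : ℝ) / 64 * (ε / n) = ε / 64 := by field_simp
      have h3 : δ ^ 2 * ε ≤ ε := mul_le_of_le_one_left hε.le (pow_le_one₀ hδ.le hδ1)
      linarith
  · rw [div_le_iff₀ hNR]
    linarith
  · have hK1 : (⌊δ * N / 16⌋₊ : ℝ) ≤ δ * N / 16 := Nat.floor_le (by positivity)
    have hK2 : δ * N / 16 < ⌊δ * N / 16⌋₊ + 1 := Nat.lt_floor_add_one _
    obtain ⟨K, hKdef⟩ : ∃ K, K = ⌊δ * N / 16⌋₊ := ⟨_, rfl⟩
    rw [← hKdef] at hK1 hK2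
    have hKN : K ≤ N := by
      have : (K : ℝ) ≤ N := by nlinarith
      exact_mod_cast this
    have hK3 : δ * n / 128 ≤ K := by nlinarith
    refine h.exists_norm_sub_le (τ := ε / n) (κ := 4 / N) (η := 2 * η) (K := K) (n := n) hg hwide
      (by omega) (by omega) (by omega) (by positivity) hδ.le hΦT hΦL ?_ (by positivity) ?_ ?_ hc
    · refine (lintegral_defect_le h.nonneg hg hfe hD' hΦD L).trans ?_
      rw [hDD', ENNReal.ofReal_mul (by norm_num), ENNReal.ofReal_ofNat]
      gcongr
    · have h1 : δ * n / 128 * (ε / n) * (δ / 2) ≤ K * (ε / n) * (δ / 2) := by gcongr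
      have h2 : δ * n / 128 * (ε / n) * (δ / 2) = δ ^ 2 * ε / 256 := by field_simp; norm_num
      linarith
    · have h1 : 2 * (4 / (N : ℝ)) * K ≤ 2 * (4 / N) * (δ * N / 16) := by gcongr
      have h2 : 2 * (4 / (N : ℝ)) * (δ * N / 16) = δ / 2 := by field_simp; norm_num
      linarith

end

/-! ### The permutation `σ_π` and products over its orbits -/

section

variable {m : ℕ}

theorem piExt_le_iff (π : Equiv.Perm (Fin m)) (i : ℕ) : piExt π i ≤ m ↔ i ≤ m := by
  unfold piExt
  split_ifs with h
  · have := (π ⟨i - 1, by omega⟩).2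
    omega
  · rfl

theorem one_le_piExt_iff (π : Equiv.Perm (Fin m)) (i : ℕ) : 1 ≤ piExt π i ↔ 1 ≤ i := by
  unfold piExt
  split_ifs with h
  · omega
  · rfl

theorem piExt_injective (π : Equiv.Perm (Fin m)) : Function.Injective (piExt π) := by
  intro i j hij
  have h1 := piExt_le_iff π i
  have h2 := piExt_le_iff π j
  have h3 := one_le_piExt_iff π i
  have h4 := one_le_piExt_iff π j
  rw [hij] at h1 h3
  by_cases hi : 1 ≤ i ∧ i ≤ m
  · have hj : 1 ≤ j ∧ j ≤ m := by omega
    unfold piExt at hij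
    rw [dif_pos hi, dif_pos hj] at hij
    have h5 := congrArg Fin.val (π.injective (Fin.ext (Nat.succ_injective hij)))
    simp only at h5
    omega
  · have hj : ¬ (1 ≤ j ∧ j ≤ m) := by omega
    unfold piExt at hij
    rwa [dif_neg hi, dif_neg hj] at hij

theorem piExtInv_eq (π : Equiv.Perm (Fin m)) : piExtInv π = piExt π.symm := rfl

theorem piExt_of_lt (π : Equiv.Perm (Fin m)) (b : Fin m) : piExt π ((b : ℕ) + 1) = π b + 1 := by
  unfold piExt
  rw [dif_pos ⟨by omega, b.2⟩]
  rfl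

theorem piExt_of_gt (π : Equiv.Perm (Fin m)) {i : ℕ} (hi : m < i) : piExt π i = i := by
  unfold piExt
  rw [dif_neg (by omega)]

theorem sigmaPi_le (π : Equiv.Perm (Fin m)) {i : ℕ} (hi : i ≤ m) : sigmaPi π i ≤ m := by
  have h1 := (piExt_le_iff π i).2 hi
  rcases h1.lt_or_eq with h2 | h2
  · have := (piExt_le_iff π.symm (piExt π i + 1)).2 h2
    rw [sigmaPi, piExtInv_eq]
    omega
  · rw [sigmaPi, piExtInv_eq, h2, piExt_of_gt _ (by omega)]
    omega

theorem sigmaPi_injective (π : Equiv.Perm (Fin m)) : Function.Injective (sigmaPi π) := by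
  intro i j hij
  have h1 := (one_le_piExt_iff π.symm (piExt π i + 1)).2 (by omega)
  have h2 := (one_le_piExt_iff π.symm (piExt π j + 1)).2 (by omega)
  unfold sigmaPi at hij
  rw [piExtInv_eq] at hij
  have h3 := piExt_injective π.symm (show piExt π.symm (piExt π i + 1) =
    piExt π.symm (piExt π j + 1) by omega)
  exact piExt_injective π (by omega)

theorem sigmaPi_zero (π : Equiv.Perm (Fin m)) {k : Fin m} (hk : (π k : ℕ) = 0) :
    sigmaPi π 0 = k := by
  have h1 : piExt π 0 = 0 := by unfold piExt; rw [dif_neg (by omega)]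
  have h2 := piExt_of_lt π.symm (π k)
  rw [hk, π.symm_apply_apply] at h2
  rw [sigmaPi, piExtInv_eq, h1, h2]
  omega

theorem sigmaPi_of_top (π : Equiv.Perm (Fin m)) {b : Fin m} (hb : (π b : ℕ) + 1 = m) :
    sigmaPi π ((b : ℕ) + 1) = m := by
  rw [sigmaPi, piExt_of_lt, hb, piExtInv_eq, piExt_of_gt _ (by omega)]
  omega

theorem sigmaPi_of_succ (π : Equiv.Perm (Fin m)) {b k : Fin m} (hb : (π b : ℕ) + 1 = π k) :
    sigmaPi π ((b : ℕ) + 1) = k := by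
  have h2 := piExt_of_lt π.symm (π k)
  rw [π.symm_apply_apply] at h2
  rw [sigmaPi, piExt_of_lt, hb, piExtInv_eq, h2]
  omega

theorem prod_orbitOf_sigmaPi (π : Equiv.Perm (Fin m)) (i : ℕ) (z : ℕ → ℂ) :
    ∏ s ∈ orbitOf π i, z (sigmaPi π s) = ∏ s ∈ orbitOf π i, z s := by
  have hmaps : ∀ s ∈ orbitOf π i, sigmaPi π s ∈ orbitOf π i := by
    intro s hs
    simp only [orbitOf, Finset.mem_filter, Finset.mem_Iic] at hs ⊢
    obtain ⟨h1, n, hn⟩ := hs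
    exact ⟨sigmaPi_le π h1, n + 1, by rw [Function.iterate_succ_apply', hn]⟩
  have himg : (orbitOf π i).image (sigmaPi π) = orbitOf π i :=
    Finset.eq_of_subset_of_card_le (Finset.image_subset_iff.2 hmaps)
      (Finset.card_image_of_injective _ (sigmaPi_injective π)).ge
  conv_rhs => rw [← himg]
  rw [Finset.prod_image (sigmaPi_injective π).injOn]

/-- A function on the intervals, extended by `d` and shifted to one-based indices. -/
def extendOne {α : Type*} (d : α) (g : Fin m → α) (i : ℕ) : α :=
  if h : 1 ≤ i ∧ i ≤ m then g ⟨i - 1, by omega⟩ else d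

theorem extendOne_succ {α : Type*} (d : α) (g : Fin m → α) (b : Fin m) :
    extendOne d g ((b : ℕ) + 1) = g b := by
  unfold extendOne
  rw [dif_pos ⟨by omega, b.2⟩]
  rfl

theorem extendOne_zero {α : Type*} (d : α) (g : Fin m → α) : extendOne d g 0 = d := by
  unfold extendOne
  rw [dif_neg (by omega)]

theorem extendOne_top {α : Type*} (d : α) (g : Fin m → α) : extendOne d g (m + 1) = d := by
  unfold extendOne
  rw [dif_neg (by omega)]

theorem sum_bvec_mul (nu : Fin m → ℝ) {S : Finset ℕ} (hS : S ⊆ Finset.Iic m) :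
    ∑ i : Fin m, (bvec S i : ℝ) * nu i =
      ∑ s ∈ S, extendOne 0 nu (s + 1) - ∑ s ∈ S, extendOne 0 nu s := by
  have hfil : ∀ F : ℕ → ℝ, ∑ s ∈ S, F s =
      ∑ s ∈ Finset.range (m + 1), if s ∈ S then F s else 0 := fun F => by
    rw [← Finset.sum_filter]
    refine Finset.sum_congr ?_ fun _ _ => rfl
    ext s
    simp only [Finset.mem_filter, Finset.mem_range]
    refine ⟨fun hs => ⟨?_, hs⟩, fun hs => hs.2⟩
    have := Finset.mem_Iic.1 (hS hs)
    omega
  rw [hfil, hfil, Finset.sum_range_succ, Finset.sum_range_succ', extendOne_top, extendOne_zero]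
  simp only [ite_self, add_zero]
  rw [← Finset.sum_sub_distrib,
    ← Fin.sum_univ_eq_sum_range (fun k => (if k ∈ S then extendOne 0 nu (k + 1) else 0) -
      if k + 1 ∈ S then extendOne 0 nu (k + 1) else 0) m]
  refine Finset.sum_congr rfl fun i _ => ?_
  rw [extendOne_succ, bvec]
  split_ifs <;> simp

theorem exists_int_of_junction_relations (π : Equiv.Perm (Fin m)) (nu : Fin m → ℝ) {z : ℕ → ℂ}
    (hz0 : ∀ i ≤ m, z i ≠ 0)
    (hz : ∀ i ≤ m, extendOne 1 (fun j => Complex.exp (2 * Real.pi * Complex.I * (nu j : ℂ))) i * z i =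
      extendOne 1 (fun j => Complex.exp (2 * Real.pi * Complex.I * (nu j : ℂ))) (sigmaPi π i + 1) *
        z (sigmaPi π i)) {S : Finset ℕ} (hS : S ∈ orbitsOf π) :
    ∃ k : ℤ, ∑ i : Fin m, (bvec S i : ℝ) * nu i = (k : ℝ) := by
  obtain ⟨i, -, rfl⟩ := Finset.mem_image.1 hS
  have hsub : orbitOf π i ⊆ Finset.Iic m := Finset.filter_subset _ _
  have hle : ∀ s ∈ orbitOf π i, s ≤ m := fun s hs => Finset.mem_Iic.1 (hsub hs)
  have hu : ∀ k, extendOne 1 (fun j => Complex.exp (2 * Real.pi * Complex.I * (nu j : ℂ))) k =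
      Complex.exp (2 * Real.pi * Complex.I * (extendOne 0 nu k : ℝ)) := fun k => by
    unfold extendOne
    split_ifs <;> simp
  simp only [hu] at hz
  have h1 := Finset.prod_congr rfl fun s hs => hz s (hle s hs)
  rw [Finset.prod_mul_distrib, prod_orbitOf_sigmaPi π i (fun s =>
    Complex.exp (2 * Real.pi * Complex.I * (extendOne 0 nu (s + 1) : ℝ)) * z s),
    Finset.prod_mul_distrib] at h1
  have h2 := mul_right_cancel₀ (Finset.prod_ne_zero_iff.2 fun s hs => hz0 s (hle s hs)) h1
  rw [← Complex.exp_sum, ← Complex.exp_sum, ← Finset.mul_sum, ← Finset.mul_sum, eq_comm,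
    Complex.exp_eq_exp_iff_exists_int] at h2
  obtain ⟨n, hn⟩ := h2
  refine ⟨n, ?_⟩
  rw [sum_bvec_mul nu hsub]
  have h3 : (2 * Real.pi * Complex.I : ℂ) ≠ 0 := Complex.two_pi_I_ne_zero
  have h4 : ((∑ s ∈ orbitOf π i, (extendOne 0 nu (s + 1) : ℝ) : ℝ) : ℂ) -
      ((∑ s ∈ orbitOf π i, (extendOne 0 nu s : ℝ) : ℝ) : ℂ) = n := by
    push_cast
    refine mul_left_cancel₀ h3 ?_
    linear_combination hn
  exact_mod_cast h4

end

/-! ### Junction relations -/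

section

set_option linter.unusedSectionVars false

variable {m : ℕ} [NeZero m] {lam : Fin m → ℝ} {π : Equiv.Perm (Fin m)}

theorem exists_left_sameCode (hpos : ∀ j, 0 ≤ lam j) {y : ℝ} (hy : y ∈ base lam)
    (hne : ∀ k c, (iet lam π)^[k] y ≠ pre lam c) (J : ℕ) :
    ∃ t > 0, ∀ s, 0 ≤ s → s < t → y - s ∈ base lam ∧ SameCode lam π J (y - s) y := by
  obtain ⟨t, ht, hs⟩ := exists_common_pos (ι := Fin (J + 1))
    (P := fun k s => (iet lam π)^[k] y - s ∈ block lam (itin lam π y k)) (fun k =>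
      exists_sub_mem_block (iterate_mem_block hpos π hy k) (hne k _))
  refine ⟨t, ht, fun s h1 h2 => ⟨?_, fun k hk => ?_⟩⟩
  · exact block_subset hpos _ (hs s h1 h2 ⟨0, by omega⟩)
  · refine (itin_eq_of_forall_mem hpos π (n := J) (fun k hk => ?_) k hk).1
    have := hs s h1 h2 ⟨k, by omega⟩
    simp only [iterate_eq hpos π hy k] at this
    rwa [show y - s + disp lam π (itin lam π y) k = y + disp lam π (itin lam π y) k - s by ring]

theorem Generic.iterate_iet_pre_ne (h : Generic lam π)
    (hz : ∀ c : Fin m, (π c : ℕ) = 0 → (c : ℕ) ≠ 0) {b : Fin m} (hb : (π b : ℕ) ≠ 0) (k : ℕ)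
    (c : Fin m) : (iet lam π)^[k] (iet lam π (pre lam b)) ≠ pre lam c := by
  rw [← Function.iterate_succ_apply]
  by_cases hc : (c : ℕ) ≠ 0
  · exact h.iterate_pre_ne b hc (Nat.succ_ne_zero k)
  push Not at hc
  have hpi : ∀ j : Fin m, iet lam π (pre lam j) = pre (lam ∘ π.symm) (π j) := fun j => by
    rw [iet_of_mem h.nonneg π (pre_mem_block h.pos j), pre_add_wvec]
  obtain ⟨b0, hb0⟩ : ∃ b0, π b0 = c := ⟨π.symm c, by simp⟩
  have hb0' : (π b0 : ℕ) = 0 := by rw [hb0, hc]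
  have h0 : iet lam π (pre lam b0) = pre lam c := by
    rw [hpi, pre_eq_cum, pre_eq_cum, hb0', hc, cum_zero, cum_zero]
  rw [← h0, Function.iterate_succ_apply']
  intro he
  have h1 := iet_injective h.nonneg π he
  rcases Nat.eq_zero_or_pos k with rfl | hk
  · have h2 : b = b0 := block_unique h.nonneg (pre_mem_block h.pos b)
      (by rw [show pre lam b = pre lam b0 from h1]; exact pre_mem_block h.pos b0)
    exact hb (by rw [h2, hb0'])
  · exact h.iterate_pre_ne b (hz b0 hb0') hk.ne' h1

theorem iet_pre (hpos : ∀ j, 0 < lam j) (b : Fin m) :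
    iet lam π (pre lam b) = cum (lam ∘ π.symm) (π b) := by
  rw [iet_of_mem (fun j => (hpos j).le) π (pre_mem_block hpos b), pre_add_wvec, pre_eq_cum]

theorem iet_cum_succ_sub (hpos : ∀ j, 0 < lam j) {b : Fin m} {s : ℝ}
    (hb : cum lam ((b : ℕ) + 1) - s ∈ block lam b) :
    iet lam π (cum lam ((b : ℕ) + 1) - s) = cum (lam ∘ π.symm) ((π b : ℕ) + 1) - s := by
  rw [iet_of_mem (fun j => (hpos j).le) π hb]
  have h1 := pre_add_wvec lam π b
  rw [pre_eq_cum, pre_eq_cum] at h1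
  rw [cum_succ, cum_succ, ← h1]
  simp only [Function.comp_apply, Equiv.symm_apply_apply]
  ring

theorem Generic.exists_junction_values (h : Generic lam π)
    (hz : ∀ c : Fin m, (π c : ℕ) = 0 → (c : ℕ) ≠ 0) {g : Fin m → ℂ} (hg : ∀ j, ‖g j‖ = 1)
    {Φ : ℝ → ℂ} {L : ℕ} {δ : ℝ} (hδ : 0 ≤ δ)
    (hΦ1 : ∀ x ∈ base lam, 1 / 4 ≤ ‖Φ x‖) (hΦ2 : ∀ x ∈ base lam, ‖Φ x‖ ≤ 2)
    (hΦ : ∀ x ∈ base lam, ‖Φ (iet lam π x) - g (itin lam π x 0) * Φ x‖ ≤ δ)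
    (hΦL : ∀ x ∈ base lam, ∀ y ∈ base lam, SameCode lam π L x y → Φ x = Φ y)
    (hΦc : ∀ c : Fin m, (c : ℕ) ≠ 0 →
      ∃ t > 0, ∀ s, 0 < s → s < t → ‖Φ (pre lam c) - Φ (pre lam c - s)‖ ≤ 2 * δ) :
    ∃ z : ℕ → ℂ, (∀ i ≤ m, 1 / 4 ≤ ‖z i‖ ∧ ‖z i‖ ≤ 2) ∧ ∀ i ≤ m,
      ‖extendOne 1 g i * z i - extendOne 1 g (sigmaPi π i + 1) * z (sigmaPi π i)‖ ≤ 4 * δ := by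
  obtain ⟨t1, ht1, H1⟩ := exists_common_pos (ι := {c : Fin m // (c : ℕ) ≠ 0})
    (P := fun c s => 0 < s → ‖Φ (pre lam c.1) - Φ (pre lam c.1 - s)‖ ≤ 2 * δ) (fun c => by
      obtain ⟨t, ht, H⟩ := hΦc c.1 c.2
      exact ⟨t, ht, fun s _ h2 h3 => H s h3 h2⟩)
  obtain ⟨t2, ht2, H2⟩ := exists_common_pos (ι := {b : Fin m // (π b : ℕ) ≠ 0})
    (P := fun b s => iet lam π (pre lam b.1) - s ∈ base lam ∧
      SameCode lam π L (iet lam π (pre lam b.1) - s) (iet lam π (pre lam b.1)))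
    (fun b => exists_left_sameCode h.nonneg (iet_mem h.nonneg π (pre_mem_base h.pos b.1))
      (h.iterate_iet_pre_ne hz b.2) L)
  obtain ⟨t3, ht3, H3⟩ := exists_pos_lower_bound (ι := Fin m) lam h.pos
  obtain ⟨s, hs0, hs1, hs2, hs3⟩ : ∃ s, 0 < s ∧ s < t1 ∧ s < t2 ∧ s < t3 := by
    obtain ⟨s, hs0, hs⟩ := exists_between (lt_min ht1 (lt_min ht2 ht3))
    exact ⟨s, hs0, hs.trans_le (min_le_left _ _),
      hs.trans_le ((min_le_right _ _).trans (min_le_left _ _)),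
      hs.trans_le ((min_le_right _ _).trans (min_le_right _ _))⟩
  have hblk : ∀ b : Fin m, cum lam ((b : ℕ) + 1) - s ∈ block lam b := fun b => by
    rw [mem_block_iff, cum_succ]
    have := H3 b
    constructor <;> linarith
  obtain ⟨z, hzdef⟩ : ∃ z : ℕ → ℂ, z = fun i => if i < m then Φ (cum lam i) else
    Φ (cum lam m - s) := ⟨_, rfl⟩
  have hzlt : ∀ c : Fin m, z c = Φ (pre lam c) := fun c => by
    rw [hzdef, pre_eq_cum]; exact if_pos c.2
  have hzm : z m = Φ (cum lam m - s) := by rw [hzdef]; exact if_neg (lt_irrefl m)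
  have hmpos : 0 < m := Nat.pos_of_ne_zero (NeZero.ne m)
  have htop : cum lam m - s ∈ base lam := by
    have := block_subset h.nonneg _ (hblk ⟨m - 1, by omega⟩)
    simpa [Nat.sub_add_cancel hmpos] using this
  have hleft : ∀ b : Fin m, ‖z ((b : ℕ) + 1) - Φ (cum lam ((b : ℕ) + 1) - s)‖ ≤ 2 * δ := by
    intro b
    rcases (Nat.succ_le_of_lt b.2).lt_or_eq with hb | hb
    · have h1 := hzlt ⟨(b : ℕ) + 1, hb⟩
      have h2 := H1 s hs0.le hs1 ⟨⟨(b : ℕ) + 1, hb⟩, by simp⟩ hs0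
      simp only [pre_eq_cum] at h1 h2
      rw [h1]
      exact h2
    · rw [show (b : ℕ) + 1 = m from hb, hzm, sub_self, norm_zero]
      positivity
  have himg : ∀ b : Fin m,
      ‖Φ (cum (lam ∘ π.symm) ((π b : ℕ) + 1) - s) - g b * z ((b : ℕ) + 1)‖ ≤ 3 * δ := by
    intro b
    have h1 := hΦ _ (block_subset h.nonneg b (hblk b))
    rw [iet_cum_succ_sub h.pos (hblk b),
      show itin lam π (cum lam ((b : ℕ) + 1) - s) 0 = b from letter_eq h.nonneg (hblk b)] at h1
    have h2 : ‖g b * Φ (cum lam ((b : ℕ) + 1) - s) - g b * z ((b : ℕ) + 1)‖ ≤ 2 * δ := by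
      rw [← mul_sub, norm_mul, hg, one_mul, norm_sub_rev]
      exact hleft b
    have h3 := norm_sub_le_norm_sub_add_norm_sub
      (Φ (cum (lam ∘ π.symm) ((π b : ℕ) + 1) - s)) (g b * Φ (cum lam ((b : ℕ) + 1) - s))
      (g b * z ((b : ℕ) + 1))
    linarith
  have hright : ∀ k : Fin m, ‖Φ (cum (lam ∘ π.symm) (π k)) - g k * z k‖ ≤ δ := fun k => by
    have h1 := hΦ _ (pre_mem_base h.pos k)
    rwa [iet_pre h.pos, itin_pre_zero h.pos, ← hzlt] at h1
  refine ⟨z, fun i hi => ?_, fun i hi => ?_⟩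
  · rcases hi.lt_or_eq with hi | rfl
    · have h1 := hzlt ⟨i, hi⟩
      simp only at h1
      rw [h1]
      exact ⟨hΦ1 _ (pre_mem_base h.pos _), hΦ2 _ (pre_mem_base h.pos _)⟩
    · rw [hzm]
      exact ⟨hΦ1 _ htop, hΦ2 _ htop⟩
  · rcases Nat.eq_zero_or_pos i with rfl | hi0
    · obtain ⟨k, hk⟩ : ∃ k, (π k : ℕ) = 0 := ⟨π.symm ⟨0, hmpos⟩, by simp⟩
      have h1 := hright k
      have h2 := hzlt ⟨0, hmpos⟩
      rw [pre_eq_cum] at h2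
      simp only [cum_zero] at h2
      rw [hk, cum_zero, ← h2] at h1
      rw [sigmaPi_zero π hk, extendOne_zero, one_mul, extendOne_succ]
      linarith
    · obtain ⟨b, rfl⟩ : ∃ b : Fin m, i = (b : ℕ) + 1 :=
        ⟨⟨i - 1, by omega⟩, by simp only; omega⟩
      rw [extendOne_succ, norm_sub_rev]
      have h1 := himg b
      rcases (Nat.succ_le_of_lt (π b).2).lt_or_eq with hb | hb
      · obtain ⟨k, hk⟩ : ∃ k, (π b : ℕ) + 1 = π k := ⟨π.symm ⟨(π b : ℕ) + 1, hb⟩, by simp⟩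
        rw [sigmaPi_of_succ π hk, extendOne_succ]
        have h2 := hright k
        obtain ⟨h3, h4⟩ := H2 s hs0.le hs2 ⟨k, by omega⟩
        have h5 := hΦL _ h3 _ (iet_mem h.nonneg π (pre_mem_base h.pos k)) h4
        simp only [iet_pre h.pos] at h5
        rw [hk, h5] at h1
        have h6 := norm_sub_le_norm_sub_add_norm_sub (g k * z k) (Φ (cum (lam ∘ π.symm) (π k)))
          (g b * z ((b : ℕ) + 1))
        rw [norm_sub_rev (g k * z k) (Φ _)] at h6
        linarith
      · have hb' : (π b : ℕ) + 1 = m := hb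
        rw [sigmaPi_of_top π hb', extendOne_top, one_mul, hzm]
        rw [hb', cum_top, sum_comp_symm, ← cum_top] at h1
        linarith

theorem exists_exact_junction_values {u : ℕ → ℂ} {σ : ℕ → ℕ} (hσ : ∀ i ≤ m, σ i ≤ m)
    (happ : ∀ δ : ℝ, 0 < δ → δ ≤ 1 → ∃ z : ℕ → ℂ, (∀ i ≤ m, 1 / 4 ≤ ‖z i‖ ∧ ‖z i‖ ≤ 2) ∧
      ∀ i ≤ m, ‖u i * z i - u (σ i + 1) * z (σ i)‖ ≤ 4 * δ) :
    ∃ z : ℕ → ℂ, (∀ i ≤ m, z i ≠ 0) ∧ ∀ i ≤ m, u i * z i = u (σ i + 1) * z (σ i) := by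
  obtain ⟨ext, hext⟩ : ∃ ext : (Fin (m + 1) → ℂ) → ℕ → ℂ, ext = fun z i => z (Fin.ofNat (m + 1) i) :=
    ⟨_, rfl⟩
  have hres : ∀ (z : ℕ → ℂ) i, i ≤ m → ext (fun j => z j) i = z i := fun z i hi => by
    rw [hext]
    simp [Nat.mod_eq_of_lt (Nat.lt_succ_of_le hi)]
  obtain ⟨F, hF⟩ : ∃ F : (Fin (m + 1) → ℂ) → ℝ, F = fun z => ∑ i ∈ Finset.range (m + 1),
    ‖u i * ext z i - u (σ i + 1) * ext z (σ i)‖ := ⟨_, rfl⟩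
  have hFc : Continuous F := by
    rw [hF, hext]
    fun_prop
  have hK : IsCompact (Set.pi univ fun _ : Fin (m + 1) => {w : ℂ | 1 / 4 ≤ ‖w‖ ∧ ‖w‖ ≤ 2}) := by
    refine isCompact_univ_pi fun _ => ?_
    refine (isCompact_closedBall (0 : ℂ) 2).of_isClosed_subset ?_ fun w hw => by
      simpa using hw.2
    exact (isClosed_le continuous_const continuous_norm).inter
      (isClosed_le continuous_norm continuous_const)
  have happ' : ∀ δ : ℝ, 0 < δ → δ ≤ 1 → ∃ z ∈ Set.pi univ
      fun _ : Fin (m + 1) => {w : ℂ | 1 / 4 ≤ ‖w‖ ∧ ‖w‖ ≤ 2}, F z ≤ (m + 1) * (4 * δ) := by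
    intro δ h0 h1
    obtain ⟨z, hz1, hz2⟩ := happ δ h0 h1
    refine ⟨fun j => z j, fun j _ => hz1 j (by omega), ?_⟩
    rw [hF]
    refine (Finset.sum_le_card_nsmul _ _ (4 * δ) fun i hi => ?_).trans (by simp)
    have hi' : i ≤ m := Nat.lt_succ_iff.1 (Finset.mem_range.1 hi)
    rw [hres z i hi', hres z _ (hσ i hi')]
    exact hz2 i hi'
  obtain ⟨z1, hz1, -⟩ := happ' 1 one_pos le_rfl
  obtain ⟨z, hz, hmin⟩ := hK.exists_isMinOn ⟨z1, hz1⟩ hFc.continuousOn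
  have hFz : F z ≤ 0 := by
    refine le_of_forall_pos_le_add fun ε hε => ?_
    have hm : (0 : ℝ) < 4 * (m + 1) := by positivity
    obtain ⟨w, hw, hwF⟩ := happ' (min 1 (ε / (4 * (m + 1)))) (by positivity) (min_le_left _ _)
    have h1 : F z ≤ F w := hmin hw
    have h2 : min 1 (ε / (4 * (m + 1))) * (4 * ((m : ℝ) + 1)) ≤ ε := by
      rw [← le_div_iff₀ hm]
      exact min_le_right _ _
    linarith
  refine ⟨ext z, fun i hi => ?_, fun i hi => ?_⟩
  · rw [hext]
    have := (hz (Fin.ofNat (m + 1) i) (mem_univ _)).1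
    exact norm_pos_iff.1 (by linarith)
  · have h1 : ‖u i * ext z i - u (σ i + 1) * ext z (σ i)‖ ≤ F z := by
      rw [hF]
      exact Finset.single_le_sum
        (f := fun i => ‖u i * ext z i - u (σ i + 1) * ext z (σ i)‖)
        (fun _ _ => norm_nonneg _) (Finset.mem_range.2 (Nat.lt_succ_of_le hi))
    exact sub_eq_zero.1 (norm_le_zero_iff.1 (h1.trans hFz))

end

section

set_option linter.unusedSectionVars false

variable {m : ℕ} [NeZero m] {lam : Fin m → ℝ} {π : Equiv.Perm (Fin m)}

theorem norm_exp_two_pi_I_mul (t : ℝ) : ‖Complex.exp (2 * Real.pi * Complex.I * (t : ℂ))‖ = 1 := by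
  rw [show (2 * Real.pi * Complex.I * (t : ℂ) : ℂ) = ((2 * Real.pi * t : ℝ) : ℂ) * Complex.I by
    push_cast; ring]
  exact Complex.norm_exp_ofReal_mul_I _

theorem phiFn_eq (hpos : ∀ j, 0 ≤ lam j) (nu : Fin m → ℝ) {x : ℝ} (hx : x ∈ base lam) :
    phiFn lam nu x = Complex.exp (2 * Real.pi * Complex.I * (nu (itin lam π x 0) : ℂ)) :=
  phiFn_of_mem hpos nu (iterate_mem_block hpos π hx 0)

/-- Junction relations obtained from an eigenfunction. -/
theorem Generic.exists_junction_relations (h : Generic lam π)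
    (hz : ∀ c : Fin m, (π c : ℕ) = 0 → (c : ℕ) ≠ 0) (hW : WideCylinders lam π) {g : Fin m → ℂ}
    (hg : ∀ j, ‖g j‖ = 1) {f : ℝ → ℂ} (hfm : Measurable f)
    (hfe : ∀ᵐ x ∂(volume.restrict (base lam)), f (iet lam π x) = g (itin lam π x 0) * f x)
    (hfpos : 0 < volume {x ∈ base lam | f x ≠ 0}) :
    ∃ z : ℕ → ℂ, (∀ i ≤ m, z i ≠ 0) ∧
      ∀ i ≤ m, extendOne 1 g i * z i = extendOne 1 g (sigmaPi π i + 1) * z (sigmaPi π i) := by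
  refine exists_exact_junction_values (fun i hi => sigmaPi_le π hi) fun δ hδ hδ1 => ?_
  have hf1 : ∀ x, f x ≠ 0 → ‖f x / (‖f x‖ : ℂ)‖ = 1 := fun x hx => by
    rw [norm_div, Complex.norm_real, norm_norm, div_self (norm_ne_zero_iff.2 hx)]
  obtain ⟨Φ, L, h1, h2, h3, h4, h5⟩ := h.exists_almost_eigenfunction hz hW hg
    (f := fun x => f x / (‖f x‖ : ℂ))
    (hfm.div (Complex.measurable_ofReal.comp hfm.norm)) (fun x => by
      by_cases hx : f x = 0
      · left; simp [hx]
      · right; exact hf1 x hx)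
    (by
      filter_upwards [hfe] with x hx
      rw [hx, norm_mul, hg, one_mul, mul_div_assoc])
    (by
      refine hfpos.trans_le (measure_mono fun x hx => ⟨hx.1, ?_⟩)
      rw [← norm_ne_zero_iff, hf1 x hx.2]
      exact one_ne_zero) hδ hδ1
  exact h.exists_junction_values hz hg hδ.le h1 h2 h3 h4 h5

end

theorem junction_relations_of_one (π : Equiv.Perm (Fin 1)) {lam : Fin 1 → ℝ} (hpos : ∀ j, 0 < lam j)
    {g : Fin 1 → ℂ} {f : ℝ → ℂ}
    (hfe : ∀ᵐ x ∂(volume.restrict (base lam)), f (iet lam π x) = g (itin lam π x 0) * f x)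
    (hfpos : 0 < volume {x ∈ base lam | f x ≠ 0}) :
    ∃ z : ℕ → ℂ, (∀ i ≤ 1, z i ≠ 0) ∧
      ∀ i ≤ 1, extendOne 1 g i * z i = extendOne 1 g (sigmaPi π i + 1) * z (sigmaPi π i) := by
  have hnn : ∀ j, 0 ≤ lam j := fun j => (hpos j).le
  rw [ae_restrict_iff' measurableSet_Ico] at hfe
  obtain ⟨x, ⟨hx, hfx⟩, hxe⟩ := ((frequently_ae_mem_iff.2 hfpos.ne').and_eventually hfe).exists
  have hid : iet lam π x = x := by
    rw [iet_of_mem hnn π (letter_spec hx), wvec, pre]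
    simp [Subsingleton.elim _ (0 : Fin 1)]
  have hxe := hxe hx
  rw [hid] at hxe
  have hg : g 0 = 1 := by
    rw [Subsingleton.elim (itin lam π x 0) 0] at hxe
    exact mul_right_cancel₀ hfx (by rw [one_mul]; exact hxe.symm)
  have hu : ∀ k, extendOne 1 g k = 1 := fun k => by
    unfold extendOne
    split_ifs
    · rw [Subsingleton.elim (⟨k - 1, _⟩ : Fin 1) 0, hg]
    · rfl
  exact ⟨fun _ => 1, fun i _ => one_ne_zero, fun i _ => by rw [hu, hu]⟩

theorem ae_junction_relations {m : ℕ} [NeZero m] (π : Equiv.Perm (Fin m))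
    (hirr : PermIrreducible π) : ∀ᵐ lam ∂(volume : Measure (Fin m → ℝ)), (∀ j, 0 < lam j) →
      ∀ (g : Fin m → ℂ) (f : ℝ → ℂ), (∀ j, ‖g j‖ = 1) → Measurable f →
        (∀ᵐ x ∂(volume.restrict (base lam)), f (iet lam π x) = g (itin lam π x 0) * f x) →
        0 < volume {x ∈ base lam | f x ≠ 0} →
        ∃ z : ℕ → ℂ, (∀ i ≤ m, z i ≠ 0) ∧ ∀ i ≤ m,
          extendOne 1 g i * z i = extendOne 1 g (sigmaPi π i + 1) * z (sigmaPi π i) := by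
  have hm : m ≠ 0 := NeZero.ne m
  by_cases hm1 : m = 1
  · subst hm1
    exact Filter.Eventually.of_forall fun lam hpos g f _ _ hfe hfpos =>
      junction_relations_of_one π hpos hfe hfpos
  · have hm2 : 2 ≤ m := by omega
    filter_upwards [ae_wideCylinders hirr hm2] with lam hlam hpos g f hg hfm hfe hfpos
    exact (hlam hpos).1.exists_junction_relations
      (fun c hc h0 => hirr.apply_zero_ne hm2 h0 hc) (hlam hpos).2 hg hfm hfe hfpos

/-- for irreducible `π` and Lebesgue-a.e. `λ ∈ ℝ₊^m`, for every `ν ∈ ℝ^m`: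
if some orbit `S ∈ Σ(π)` has `b_S · ν ∉ ℤ`, then the equation
`f(T_{(λ,π)}x) = φ_{(λ,ν)}(x) f(x)` (a.e. on `[0,|λ|)`) admits no measurable solution
that is nonzero on a set of positive Lebesgue measure. -/
theorem stmt7 (m : ℕ) (hm : 1 ≤ m) (π : Equiv.Perm (Fin m))
    (hirr : PermIrreducible π) :
    ∀ᵐ lam ∂(volume : Measure (Fin m → ℝ)), (∀ j, 0 < lam j) →
      ∀ nu : Fin m → ℝ,
        (∃ S ∈ orbitsOf π, ¬ ∃ z : ℤ, ∑ i : Fin m, (bvec S i : ℝ) * nu i = (z : ℝ)) →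
        ¬ ∃ f : ℝ → ℂ, Measurable f ∧
            0 < volume {x ∈ Set.Ico (0 : ℝ) (∑ i, lam i) | f x ≠ 0} ∧
            ∀ᵐ x ∂(volume : Measure ℝ), x ∈ Set.Ico (0 : ℝ) (∑ i, lam i) →
              f (iet lam π x) = phiFn lam nu x * f x := by
  have : NeZero m := ⟨by omega⟩
  filter_upwards [ae_junction_relations π hirr] with lam hlam hpos nu
  rintro ⟨S, hS, hSnu⟩ ⟨f, hfm, hfpos, hfe⟩
  have hfe' : ∀ᵐ x ∂(volume.restrict (base lam)), f (iet lam π x) =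
      (fun j => Complex.exp (2 * Real.pi * Complex.I * (nu j : ℂ))) (itin lam π x 0) * f x := by
    rw [ae_restrict_iff' measurableSet_Ico]
    filter_upwards [hfe] with x hx hxb
    rw [hx hxb, phiFn_eq (π := π) (fun j => (hpos j).le) nu hxb]
  obtain ⟨z, hz0, hz⟩ := hlam hpos _ f (fun j => norm_exp_two_pi_I_mul (nu j)) hfm hfe' hfpos
  exact hSnu (exists_int_of_junction_relations π nu hz0 hz hS)
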